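/- arXiv:2501.15978 — 2 statements merged into one kernel-verified Lean document; each statement's English description precedes it below -/
import Mathlib

section
/- There exists a constant C > 0 such that the following holds: for every spherical profile (μ, k) with μ_1 ≤ 1 and every square-tiled surface τ with profile (μ, k), τ can be transformed into a path-like square-tiled surface by a sequence of at most C·k operations, each operation being either a single vertical cylinder shear or a power of a horizontal cylinder shear. -/
/-! Common definitions: square-tiled surfaces as triples of involutions,
cylinder shears, profiles, etc. -/

inductive Color : Type
  | R | G | B
  deriving DecidableEq

/-- A candidate square-tiled surface on `Fin n`: a triple of permutations
indexed by the three colours. -/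
abbrev Surf (n : ℕ) := Color → Equiv.Perm (Fin n)

/-- `f` is a square-tiled surface on `{1,…,n}` (`n ≥ 1`): the three permutations are
involutions and the subgroup they generate acts transitively. -/
def IsSTS (n : ℕ) (f : Surf n) : Prop :=
  1 ≤ n ∧ (∀ X, f X * f X = 1) ∧
    ∀ x y : Fin n,
      ∃ p ∈ Subgroup.closure ({f Color.R, f Color.G, f Color.B} : Set (Equiv.Perm (Fin n))),
        p x = y

/-- Number of fixed points of a permutation of `Fin n`. -/
def fixedCount {n : ℕ} (π : Equiv.Perm (Fin n)) : ℕ :=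
  (Finset.univ.filter fun x => π x = x).card

/-- Number of cycles of length `i` of `π`, fixed points counted as cycles of length 1. -/
def cycleCount {n : ℕ} (π : Equiv.Perm (Fin n)) (i : ℕ) : ℕ :=
  if i = 1 then fixedCount π else Multiset.count i π.cycleType

/-- The product `τ_R · τ_G · τ_B`. -/
def prodRGB {n : ℕ} (f : Surf n) : Equiv.Perm (Fin n) :=
  f Color.R * f Color.G * f Color.B

/-- Total number of fixed points of the three permutations. -/
def totalFixed {n : ℕ} (f : Surf n) : ℕ :=
  fixedCount (f Color.R) + fixedCount (f Color.G) + fixedCount (f Color.B)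

/-- `f` has profile `(μ, k)`: `μ i` is the number of cycles of length `i` of
`τ_R·τ_G·τ_B` (for `i ≥ 1`), and `k` is the total number of fixed points of the
three involutions. -/
def HasProfile {n : ℕ} (f : Surf n) (μ : ℕ → ℕ) (k : ℕ) : Prop :=
  (∀ i, 1 ≤ i → cycleCount (prodRGB f) i = μ i) ∧ totalFixed f = k

open Classical in
/-- The permutation acting as `σ` on the (`σ`-invariant) set `c` and as the identity
outside of `c`. (Junk value `1` if `c` is not `σ`-invariant.) -/
noncomputable def restrictPerm {α : Type*} (σ : Equiv.Perm α) (c : Set α) : Equiv.Perm α :=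
  if h : ∀ x, σ x ∈ c ↔ x ∈ c then
    { toFun := fun x => if x ∈ c then σ x else x
      invFun := fun x => if x ∈ c then σ.symm x else x
      left_inv := fun x => by
        by_cases hx : x ∈ c
        · simp [hx, (h x).mpr hx]
        · simp [hx]
      right_inv := fun x => by
        by_cases hx : x ∈ c
        · have h1 : σ.symm x ∈ c := (h (σ.symm x)).mp (by simpa using hx)
          simp [hx, h1]
        · simp [hx] }
  else 1

/-- `c` is an `{i,j}`-component of `f`: an orbit of the subgroup generated by
`f i` and `f j`. -/
def IsComponent (n : ℕ) (f : Surf n) (i j : Color) (c : Set (Fin n)) : Prop :=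
  ∃ x : Fin n,
    c = MulAction.orbit ↥(Subgroup.closure ({f i, f j} : Set (Equiv.Perm (Fin n)))) x

/-- The cylinder shear `Shear_{c,i,j}`: replace `f i` by `f i · c_i · c_j` and
`f j` by `f j · c_i · c_j`, keeping the third permutation unchanged. -/
noncomputable def shear {n : ℕ} (f : Surf n) (i j : Color) (c : Set (Fin n)) : Surf n :=
  fun X =>
    if X = i ∨ X = j then f X * restrictPerm (f i) c * restrictPerm (f j) c else f X

/-- `m`-th power of the cylinder shear `Shear_{c,i,j}`. -/
noncomputable def shearPow {n : ℕ} (f : Surf n) (i j : Color) (c : Set (Fin n)) : ℕ → Surf n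
  | 0 => f
  | m + 1 => shear (shearPow f i j c m) i j c

/-- The unordered pair `{i,j}` is `{R,G}` or `{G,B}`. -/
def GoodPair (i j : Color) : Prop :=
  ({i, j} : Set Color) = {Color.R, Color.G} ∨ ({i, j} : Set Color) = {Color.G, Color.B}

/-- `A` (together with its complement) witnesses that `f` is Abelian. -/
def IsAbelianWitness (n : ℕ) (f : Surf n) (A : Set (Fin n)) : Prop :=
  A.Nonempty ∧ Aᶜ.Nonempty ∧ ∀ X : Color, (⇑(f X)) '' A = Aᶜ

/-- `f` is Abelian. -/
def IsAbelian (n : ℕ) (f : Surf n) : Prop :=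
  ∃ A : Set (Fin n), IsAbelianWitness n f A

/-- `f` is path-like: `f G` and `f B` alone generate a transitive subgroup and have
exactly two fixed points in total. -/
def IsPathLike (n : ℕ) (f : Surf n) : Prop :=
  (∀ x y : Fin n,
      ∃ p ∈ Subgroup.closure ({f Color.G, f Color.B} : Set (Equiv.Perm (Fin n))),
        p x = y) ∧
    fixedCount (f Color.G) + fixedCount (f Color.B) = 2

/-- `f` and `f'` are isomorphic square-tiled surfaces. -/
def Isomorphic (n : ℕ) (f f' : Surf n) : Prop :=
  ∃ σ : Equiv.Perm (Fin n), ∀ X, f' X = σ * f X * σ⁻¹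

/-- One power of a cylinder shear. -/
def ShearPowStep (n : ℕ) (f f' : Surf n) : Prop :=
  ∃ (i j : Color) (c : Set (Fin n)) (m : ℕ),
    GoodPair i j ∧ IsComponent n f i j c ∧ 1 ≤ m ∧ f' = shearPow f i j c m

/-- A sequence of `L` powers of cylinder shears from `f` to `f'`. -/
def ShearPowSeq (n : ℕ) : ℕ → Surf n → Surf n → Prop
  | 0, f, f' => f = f'
  | L + 1, f, f' => ∃ g, ShearPowStep n f g ∧ ShearPowSeq n L g f'

/-- A single vertical (i.e. `{R,G}`) cylinder shear. -/
def VertStep (n : ℕ) (f f' : Surf n) : Prop :=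
  ∃ (i j : Color) (c : Set (Fin n)),
    ({i, j} : Set Color) = {Color.R, Color.G} ∧ IsComponent n f i j c ∧ f' = shear f i j c

/-- A power of a horizontal (i.e. `{G,B}`) cylinder shear. -/
def HorizPowStep (n : ℕ) (f f' : Surf n) : Prop :=
  ∃ (i j : Color) (c : Set (Fin n)) (m : ℕ),
    ({i, j} : Set Color) = {Color.G, Color.B} ∧ IsComponent n f i j c ∧ 1 ≤ m ∧
      f' = shearPow f i j c m

/-- A sequence of `L` operations, each a single vertical shear or a power of a
horizontal shear. -/
def MixedSeq (n : ℕ) : ℕ → Surf n → Surf n → Prop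
  | 0, f, f' => f = f'
  | L + 1, f, f' => ∃ g, (VertStep n f g ∨ HorizPowStep n f g) ∧ MixedSeq n L g f'

/-- Profile `([2^{μ2}, 4g-2], 0)` (as far as the partition is concerned;
`totalFixed = 0` gives `k = 0`). -/
def ProfileA (n g μ2 : ℕ) (f : Surf n) : Prop :=
  totalFixed f = 0 ∧ cycleCount (prodRGB f) 2 = μ2 ∧
    cycleCount (prodRGB f) (4 * g - 2) = 1 ∧
    ∀ i, 1 ≤ i → i ≠ 2 → i ≠ 4 * g - 2 → cycleCount (prodRGB f) i = 0

/-- Profile `([2^{μ2}, (2g)^2], 0)`. -/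
def ProfileB (n g μ2 : ℕ) (f : Surf n) : Prop :=
  totalFixed f = 0 ∧ cycleCount (prodRGB f) 2 = μ2 ∧
    cycleCount (prodRGB f) (2 * g) = 2 ∧
    ∀ i, 1 ≤ i → i ≠ 2 → i ≠ 2 * g → cycleCount (prodRGB f) i = 0

/-- `α` is an automorphism of `f`. -/
def IsAut {n : ℕ} (f : Surf n) (α : Equiv.Perm (Fin n)) : Prop :=
  ∀ X, α * f X = f X * α

/-- `q` is (a presentation of) the quotient of `f` by the order-2 automorphism `α`:
there is a surjection `p` whose fibers are exactly the `⟨α⟩`-orbits and which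
intertwines the permutations. -/
def IsQuotientBy (n m : ℕ) (f : Surf n) (α : Equiv.Perm (Fin n)) (q : Surf m) : Prop :=
  ∃ p : Fin n → Fin m, Function.Surjective p ∧
    (∀ x y : Fin n, p x = p y ↔ (y = x ∨ y = α x)) ∧
    ∀ X x, p (f X x) = q X (p x)

/-- `4g - 4` where `g` is the genus of `f`, i.e. `Σ_i μ_i (i-2) - k`. -/
noncomputable def genusFour {n : ℕ} (f : Surf n) : ℤ :=
  (∑ i ∈ Finset.Icc 1 n, (cycleCount (prodRGB f) i : ℤ) * ((i : ℤ) - 2)) - (totalFixed f : ℤ)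

/-- `α` is a hyperelliptic involution of `f`: an order-2 automorphism whose quotient
is a square-tiled surface of genus 0. -/
def IsHyperInvolution {n : ℕ} (f : Surf n) (α : Equiv.Perm (Fin n)) : Prop :=
  IsAut f α ∧ α * α = 1 ∧ α ≠ 1 ∧
    ∃ (m : ℕ) (q : Surf m), IsSTS m q ∧ IsQuotientBy n m f α q ∧ genusFour q = -4

/-- `α` sends every point lying on a cycle of length `2g` of `τ_R·τ_G·τ_B` to a
different cycle (hence exchanges the two cycles of length `2g`). -/
def ExchangesTwoCycles {n : ℕ} (f : Surf n) (α : Equiv.Perm (Fin n)) (g : ℕ) : Prop :=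
  ∀ x : Fin n, ((prodRGB f).cycleOf x).support.card = 2 * g →
    ¬ (prodRGB f).SameCycle x (α x)

/-- Membership in `ST^hyp_Ab([2^{μ2}, 4g-2])`. -/
def InSTHypA (n g μ2 : ℕ) (f : Surf n) : Prop :=
  IsSTS n f ∧ IsAbelian n f ∧ ProfileA n g μ2 f ∧ ∃ α, IsHyperInvolution f α

/-- Membership in `ST^hyp_Ab([2^{μ2}, (2g)^2])`. -/
def InSTHypB (n g μ2 : ℕ) (f : Surf n) : Prop :=
  IsSTS n f ∧ IsAbelian n f ∧ ProfileB n g μ2 f ∧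
    ∃ α, IsHyperInvolution f α ∧ ExchangesTwoCycles f α g

open Relation (EqvGen)
open Equiv.Perm (SameCycle)

/-- Points that are minimal in their class, for a relation `r` on `Fin n`. -/
def minReps {n : ℕ} (r : Fin n → Fin n → Prop) : Set (Fin n) :=
  {x | ∀ y, r x y → x ≤ y}

/-- The number of classes of an equivalence relation on `Fin n`. -/
noncomputable def numClasses {n : ℕ} (r : Fin n → Fin n → Prop) : ℕ :=
  (minReps r).ncard

theorem exists_minRep {n : ℕ} {r : Fin n → Fin n → Prop} (hr : Equivalence r) (x : Fin n) :
    ∃ m, r x m ∧ m ∈ minReps r := by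
  obtain ⟨m, hm, hmin⟩ := (Set.toFinite {y | r x y}).exists_minimal ⟨x, hr.refl x⟩
  refine ⟨m, hm, fun y hy => ?_⟩
  by_contra h
  exact h (hmin (hr.trans hm hy) (le_of_lt (not_le.mp h)))

theorem eq_of_mem_minReps {n : ℕ} {r : Fin n → Fin n → Prop} (hr : Equivalence r) {x y : Fin n}
    (hx : x ∈ minReps r) (hy : y ∈ minReps r) (h : r x y) : x = y :=
  le_antisymm (hx y h) (hy x (hr.symm h))

theorem minReps_anti {n : ℕ} {r s : Fin n → Fin n → Prop} (h : ∀ x y, r x y → s x y) :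
    minReps s ⊆ minReps r :=
  fun _ hx y hy => hx y (h _ y hy)

theorem numClasses_anti {n : ℕ} {r s : Fin n → Fin n → Prop} (h : ∀ x y, r x y → s x y) :
    numClasses s ≤ numClasses r :=
  Set.ncard_le_ncard (minReps_anti h)

theorem numClasses_le_one {n : ℕ} {r : Fin n → Fin n → Prop} (h : ∀ x y, r x y) :
    numClasses r ≤ 1 :=
  (Set.ncard_le_one (Set.toFinite _)).mpr fun a ha b hb => le_antisymm (ha b (h _ _)) (hb a (h _ _))

/-- The relation obtained from `r` by identifying the classes of `a` and `b`. -/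
def mergeRel {n : ℕ} (r : Fin n → Fin n → Prop) (a b : Fin n) : Fin n → Fin n → Prop :=
  fun x y => r x y ∨ (r x a ∧ r b y) ∨ (r x b ∧ r a y)

theorem mergeRel_equivalence {n : ℕ} {r : Fin n → Fin n → Prop} (hr : Equivalence r)
    (a b : Fin n) : Equivalence (mergeRel r a b) where
  refl x := Or.inl (hr.refl x)
  symm {x y} h := by
    rcases h with h | ⟨h, h'⟩ | ⟨h, h'⟩
    · exact Or.inl (hr.symm h)
    · exact Or.inr (Or.inr ⟨hr.symm h', hr.symm h⟩)
    · exact Or.inr (Or.inl ⟨hr.symm h', hr.symm h⟩)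
  trans {x y z} h k := by
    rcases h with h | ⟨h, h'⟩ | ⟨h, h'⟩ <;> rcases k with k | ⟨k, k'⟩ | ⟨k, k'⟩
    · exact Or.inl (hr.trans h k)
    · exact Or.inr (Or.inl ⟨hr.trans h k, k'⟩)
    · exact Or.inr (Or.inr ⟨hr.trans h k, k'⟩)
    · exact Or.inr (Or.inl ⟨h, hr.trans h' k⟩)
    · exact Or.inr (Or.inl ⟨h, k'⟩)
    · exact Or.inl (hr.trans h k')
    · exact Or.inr (Or.inr ⟨h, hr.trans h' k⟩)
    · exact Or.inl (hr.trans h k')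
    · exact Or.inr (Or.inr ⟨h, k'⟩)

theorem mergeRel_self {n : ℕ} {r : Fin n → Fin n → Prop} (hr : Equivalence r) (a b : Fin n) :
    mergeRel r a b a b :=
  Or.inr (Or.inl ⟨hr.refl a, hr.refl b⟩)

theorem numClasses_le_mergeRel {n : ℕ} {r : Fin n → Fin n → Prop} (hr : Equivalence r)
    (a b : Fin n) : numClasses r ≤ numClasses (mergeRel r a b) + 1 := by
  obtain ⟨ma, ha, hma⟩ := exists_minRep hr a
  obtain ⟨mb, hb, hmb⟩ := exists_minRep hr b
  have hsub : minReps r ⊆ insert (max ma mb) (minReps (mergeRel r a b)) := by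
    intro x hx
    by_contra hcon
    simp only [Set.mem_insert_iff, not_or] at hcon
    obtain ⟨hne, hnot⟩ := hcon
    refine hnot fun y hy => ?_
    rcases hy with hy | ⟨hxa, hby⟩ | ⟨hxb, hay⟩
    · exact hx y hy
    · obtain rfl := eq_of_mem_minReps hr hx hma (hr.trans hxa ha)
      have h1 : mb ≤ y := hmb y (hr.trans (hr.symm hb) hby)
      rcases le_total x mb with h | h
      · exact h.trans h1
      · exact absurd (max_eq_left h).symm hne
    · obtain rfl := eq_of_mem_minReps hr hx hmb (hr.trans hxb hb)
      have h1 : ma ≤ y := hma y (hr.trans (hr.symm ha) hay)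
      rcases le_total x ma with h | h
      · exact h.trans h1
      · exact absurd (max_eq_right h).symm hne
  exact (Set.ncard_le_ncard hsub).trans (Set.ncard_insert_le _ _)

theorem numClasses_mergeRel_lt {n : ℕ} {r : Fin n → Fin n → Prop} (hr : Equivalence r)
    {a b : Fin n} (hab : ¬ r a b) : numClasses (mergeRel r a b) + 1 ≤ numClasses r := by
  obtain ⟨ma, ha, hma⟩ := exists_minRep hr a
  obtain ⟨mb, hb, hmb⟩ := exists_minRep hr b
  have hm := mergeRel_equivalence hr a b
  have h1 : mergeRel r a b ma mb := Or.inr (Or.inl ⟨hr.symm ha, hb⟩)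
  have hne : ma ≠ mb := by
    rintro rfl
    exact hab (hr.trans ha (hr.symm hb))
  have hnot : max ma mb ∉ minReps (mergeRel r a b) := by
    intro h
    rcases le_total ma mb with h' | h'
    · rw [max_eq_right h'] at h
      exact hne (le_antisymm h' (h ma (hm.symm h1)))
    · rw [max_eq_left h'] at h
      exact hne (le_antisymm (h mb h1) h')
  have hmem : max ma mb ∈ minReps r := by
    rcases le_total ma mb with h' | h'
    · rwa [max_eq_right h']
    · rwa [max_eq_left h']
  rw [numClasses, ← Set.ncard_insert_of_notMem hnot]
  exact Set.ncard_le_ncard (Set.insert_subset hmem (minReps_anti fun _ _ => Or.inl))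

theorem eqvGen_le {α : Type*} {E r : α → α → Prop} (hr : Equivalence r)
    (h : ∀ x y, E x y → r x y) {x y : α} (hxy : EqvGen E x y) : r x y := by
  induction hxy with
  | rel x y h' => exact h x y h'
  | refl x => exact hr.refl x
  | symm x y _ ih => exact hr.symm ih
  | trans x y z _ _ ih ih' => exact hr.trans ih ih'

theorem eqvGen_equivalence {α : Type*} (E : α → α → Prop) : Equivalence (EqvGen E) :=
  Relation.EqvGen.is_equivalence E

theorem sameCycle_equivalence {α : Type*} (σ : Equiv.Perm α) : Equivalence (SameCycle σ) :=
  ⟨SameCycle.refl σ, SameCycle.symm, SameCycle.trans⟩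

theorem sameCycle_step {α : Type*} (σ : Equiv.Perm α) (x : α) : SameCycle σ x (σ x) :=
  ⟨1, by simp⟩

theorem sameCycle_le {α : Type*} [Finite α] {σ : Equiv.Perm α} {r : α → α → Prop}
    (hr : Equivalence r) (h : ∀ x, r x (σ x)) {x y : α} (hxy : SameCycle σ x y) : r x y := by
  obtain ⟨i, rfl⟩ := hxy.exists_nat_pow_eq
  clear hxy
  induction i with
  | zero => exact hr.refl x
  | succ i ih =>
    rw [pow_succ', Equiv.Perm.mul_apply]
    exact hr.trans ih (h _)

theorem mergeRel_swap_le {n : ℕ} (σ : Equiv.Perm (Fin n)) (a b : Fin n) {x y : Fin n}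
    (h : mergeRel (SameCycle (Equiv.swap a b * σ)) a b x y) :
    mergeRel (SameCycle σ) a b x y := by
  have hm := mergeRel_equivalence (sameCycle_equivalence σ) a b
  have hab := mergeRel_self (sameCycle_equivalence σ) a b
  have hs : ∀ x y, SameCycle (Equiv.swap a b * σ) x y → mergeRel (SameCycle σ) a b x y := by
    intro x y hxy
    refine sameCycle_le hm (fun z => ?_) hxy
    have hz : mergeRel (SameCycle σ) a b z (σ z) := Or.inl (sameCycle_step σ z)
    rw [Equiv.Perm.mul_apply]
    by_cases h1 : σ z = a
    · rw [h1, Equiv.swap_apply_left]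
      exact hm.trans (h1 ▸ hz) hab
    by_cases h2 : σ z = b
    · rw [h2, Equiv.swap_apply_right]
      exact hm.trans (h2 ▸ hz) (hm.symm hab)
    rwa [Equiv.swap_apply_of_ne_of_ne h1 h2]
  rcases h with h | ⟨h, h'⟩ | ⟨h, h'⟩
  · exact hs _ _ h
  · exact hm.trans (hs _ _ h) (hm.trans hab (hs _ _ h'))
  · exact hm.trans (hs _ _ h) (hm.trans (hm.symm hab) (hs _ _ h'))

theorem numClasses_mergeRel_swap {n : ℕ} (σ : Equiv.Perm (Fin n)) (a b : Fin n) :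
    numClasses (mergeRel (SameCycle (Equiv.swap a b * σ)) a b) =
      numClasses (mergeRel (SameCycle σ) a b) := by
  apply le_antisymm
  · refine numClasses_anti fun x y h => mergeRel_swap_le (Equiv.swap a b * σ) a b ?_
    rwa [← mul_assoc, Equiv.swap_mul_self, one_mul]
  · exact numClasses_anti fun x y h => mergeRel_swap_le σ a b h

theorem numClasses_swap_mul_le {n : ℕ} (σ : Equiv.Perm (Fin n)) (a b : Fin n) :
    numClasses (SameCycle (Equiv.swap a b * σ)) ≤ numClasses (SameCycle σ) + 1 := by
  refine (numClasses_le_mergeRel (sameCycle_equivalence _) a b).trans ?_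
  rw [numClasses_mergeRel_swap]
  exact Nat.succ_le_succ (numClasses_anti fun _ _ => Or.inl)

theorem sameCycle_swap_mul {n : ℕ} {σ : Equiv.Perm (Fin n)} {a b : Fin n}
    (hab : ¬ SameCycle σ a b) : SameCycle (Equiv.swap a b * σ) a b := by
  have hper : ∃ m, 0 < m ∧ (σ ^ m) a = a :=
    ⟨orderOf σ, orderOf_pos σ, by rw [pow_orderOf_eq_one]; rfl⟩
  classical
  obtain ⟨hpos, hm⟩ := Nat.find_spec hper
  have key : ∀ i, i < Nat.find hper → ((Equiv.swap a b * σ) ^ i) a = (σ ^ i) a := by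
    intro i
    induction i with
    | zero => intro _; rfl
    | succ i ih =>
      intro hi
      rw [pow_succ', pow_succ', Equiv.Perm.mul_apply, ih (by omega), Equiv.Perm.mul_apply,
        Equiv.Perm.mul_apply, Equiv.swap_apply_of_ne_of_ne]
      · intro h
        exact Nat.find_min hper hi ⟨Nat.succ_pos i, by rwa [pow_succ', Equiv.Perm.mul_apply]⟩
      · intro h
        exact hab ⟨(i + 1 : ℕ), by rwa [zpow_natCast, pow_succ', Equiv.Perm.mul_apply]⟩
  obtain ⟨j, hj⟩ : ∃ j, Nat.find hper = j + 1 := ⟨Nat.find hper - 1, by omega⟩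
  refine ⟨(j + 1 : ℕ), ?_⟩
  rw [zpow_natCast, pow_succ', Equiv.Perm.mul_apply, key j (by omega), Equiv.Perm.mul_apply,
    ← Equiv.Perm.mul_apply σ, ← pow_succ', ← hj, hm, Equiv.swap_apply_left]

theorem numClasses_swap_mul_of_not_sameCycle {n : ℕ} {σ : Equiv.Perm (Fin n)} {a b : Fin n}
    (hab : ¬ SameCycle σ a b) :
    numClasses (SameCycle (Equiv.swap a b * σ)) + 1 ≤ numClasses (SameCycle σ) := by
  have h1 : numClasses (SameCycle (Equiv.swap a b * σ)) ≤
      numClasses (mergeRel (SameCycle (Equiv.swap a b * σ)) a b) := by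
    have he := sameCycle_equivalence (Equiv.swap a b * σ)
    have h := sameCycle_swap_mul hab
    refine numClasses_anti fun x y hxy => ?_
    rcases hxy with hxy | ⟨h1, h2⟩ | ⟨h1, h2⟩
    · exact hxy
    · exact he.trans h1 (he.trans h h2)
    · exact he.trans h1 (he.trans (he.symm h) h2)
  have h2 := numClasses_mergeRel_lt (sameCycle_equivalence σ) hab
  rw [numClasses_mergeRel_swap] at h1
  omega

/-- Two points in the same orbit of the group generated by `R` and `ρ`. -/
def GenRel {n : ℕ} (R ρ : Equiv.Perm (Fin n)) : Fin n → Fin n → Prop :=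
  EqvGen fun x y => y = R x ∨ y = ρ x

theorem genRel_equivalence {n : ℕ} (R ρ : Equiv.Perm (Fin n)) : Equivalence (GenRel R ρ) :=
  eqvGen_equivalence _

theorem genRel_left {n : ℕ} (R ρ : Equiv.Perm (Fin n)) (x : Fin n) : GenRel R ρ x (R x) :=
  EqvGen.rel _ _ (Or.inl rfl)

theorem genRel_right {n : ℕ} (R ρ : Equiv.Perm (Fin n)) (x : Fin n) : GenRel R ρ x (ρ x) :=
  EqvGen.rel _ _ (Or.inr rfl)

theorem genRel_of_sameCycle {n : ℕ} {R ρ : Equiv.Perm (Fin n)} {x y : Fin n}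
    (h : SameCycle ρ x y) : GenRel R ρ x y :=
  sameCycle_le (genRel_equivalence R ρ) (genRel_right R ρ) h

/-- Riemann–Hurwitz inequality for a permutation and an involution. -/
theorem riemann_hurwitz {n : ℕ} (R ρ : Equiv.Perm (Fin n)) (hR : R * R = 1) :
    2 * numClasses (SameCycle (R * ρ)) + 2 * numClasses (SameCycle ρ) + {x | R x = x}.ncard ≤
      n + 4 * numClasses (GenRel R ρ) := by
  obtain ⟨m, hm⟩ : ∃ m, {x | R x ≠ x}.ncard = m := ⟨_, rfl⟩
  induction m using Nat.strong_induction_on generalizing R with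
  | _ m ih =>
  have hinv : ∀ x, R (R x) = x := fun x => by rw [← Equiv.Perm.mul_apply, hR]; rfl
  by_cases hid : ∀ x, R x = x
  · have h1 : R = 1 := Equiv.ext hid
    have h2 : numClasses (SameCycle ρ) ≤ numClasses (GenRel R ρ) := by
      refine numClasses_anti fun x y hxy => ?_
      refine eqvGen_le (sameCycle_equivalence ρ) (fun x y h => ?_) hxy
      rcases h with rfl | rfl
      · rw [hid]
      · exact sameCycle_step ρ x
    have h3 : {x | R x = x}.ncard = n := by
      have : {x | R x = x} = Set.univ := Set.eq_univ_of_forall hid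
      rw [this, Set.ncard_univ, Nat.card_eq_fintype_card, Fintype.card_fin]
    subst h1
    rw [one_mul]
    omega
  push Not at hid
  obtain ⟨a, ha⟩ := hid
  set b := R a with hb
  have hRb : R b = a := hinv a
  set S := Equiv.swap a b * R with hS
  have hSa : S a = a := by
    rw [hS, Equiv.Perm.mul_apply, ← hb, Equiv.swap_apply_right]
  have hSb : S b = b := by
    rw [hS, Equiv.Perm.mul_apply, hRb, Equiv.swap_apply_left]
  have hSx : ∀ x, x ≠ a → x ≠ b → S x = R x := by
    intro x h1 h2
    rw [hS, Equiv.Perm.mul_apply, Equiv.swap_apply_of_ne_of_ne]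
    · intro h; exact h2 (by rw [hb, ← h, hinv])
    · intro h; exact h1 (by rw [← hRb, ← h, hinv])
  have hSS : S * S = 1 := by
    refine Equiv.ext fun x => ?_
    rw [Equiv.Perm.mul_apply, Equiv.Perm.one_apply]
    by_cases h1 : x = a
    · rw [h1, hSa, hSa]
    by_cases h2 : x = b
    · rw [h2, hSb, hSb]
    rw [hSx x h1 h2, hSx, hinv]
    · intro h; exact h2 (by rw [hb, ← h, hinv])
    · intro h; exact h1 (by rw [← hRb, ← h, hinv])
  have hfixS : {x | S x = x}.ncard = {x | R x = x}.ncard + 2 := by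
    have : {x | S x = x} = insert a (insert b {x | R x = x}) := by
      ext x
      simp only [Set.mem_ofPred_eq, Set.mem_insert_iff]
      by_cases h1 : x = a
      · simp [h1, hSa]
      by_cases h2 : x = b
      · simp [h2, hSb]
      simp [h1, h2, hSx x h1 h2]
    rw [this, Set.ncard_insert_of_notMem, Set.ncard_insert_of_notMem]
    · simp only [Set.mem_ofPred_eq, hRb]; exact ha.symm
    · simp only [Set.mem_insert_iff, Set.mem_ofPred_eq, not_or]
      exact ⟨ha.symm, ha⟩
  have hlt : {x | S x ≠ x}.ncard < m := by
    rw [← hm]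
    refine Set.ncard_lt_ncard ⟨fun x hx => ?_, fun h => ?_⟩
    · by_cases h1 : x = a
      · exact absurd (h1 ▸ hSa) hx
      by_cases h2 : x = b
      · exact absurd (h2 ▸ hSb) hx
      rw [Set.mem_ofPred_eq, ← hSx x h1 h2]; exact hx
    · exact h (show a ∈ {x | R x ≠ x} from ha) hSa
  have hI := ih _ hlt S hSS rfl
  have hRS : R = Equiv.swap a b * S := by
    rw [hS, ← mul_assoc, Equiv.swap_mul_self, one_mul]
  have hRρ : R * ρ = Equiv.swap a b * (S * ρ) := by rw [← mul_assoc, ← hRS]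
  have hle1 : ∀ x y, GenRel R ρ x y → mergeRel (GenRel S ρ) a b x y := by
    intro x y hxy
    have hm := mergeRel_equivalence (genRel_equivalence S ρ) a b
    refine eqvGen_le hm (fun x y h => ?_) hxy
    rcases h with rfl | rfl
    · by_cases h1 : x = a
      · rw [h1]; exact mergeRel_self (genRel_equivalence S ρ) a b
      by_cases h2 : x = b
      · rw [h2, hRb]; exact hm.symm (mergeRel_self (genRel_equivalence S ρ) a b)
      rw [← hSx x h1 h2]; exact Or.inl (genRel_left S ρ x)
    · exact Or.inl (genRel_right S ρ x)
  have hcount : numClasses (mergeRel (GenRel S ρ) a b) ≤ numClasses (GenRel R ρ) :=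
    numClasses_anti hle1
  rw [hRρ]
  by_cases hj : GenRel S ρ a b
  · have h1 := numClasses_swap_mul_le (S * ρ) a b
    have h2 : numClasses (GenRel S ρ) ≤ numClasses (mergeRel (GenRel S ρ) a b) := by
      have he := genRel_equivalence S ρ
      refine numClasses_anti fun x y hxy => ?_
      rcases hxy with hxy | ⟨h1, h2⟩ | ⟨h1, h2⟩
      · exact hxy
      · exact he.trans h1 (he.trans hj h2)
      · exact he.trans h1 (he.trans (he.symm hj) h2)
    omega
  · have hns : ¬ SameCycle (S * ρ) a b := by
      intro h
      refine hj (sameCycle_le (genRel_equivalence S ρ) (fun z => ?_) h)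
      exact (genRel_equivalence S ρ).trans (genRel_right S ρ z) (genRel_left S ρ _)
    have h1 := numClasses_swap_mul_of_not_sameCycle hns
    have h2 := numClasses_le_mergeRel (genRel_equivalence S ρ) a b
    omega

theorem numClasses_eqvGen_le_add_ncard {n : ℕ} (E : Fin n → Fin n → Prop)
    (g : Fin n → Fin n) (T : Set (Fin n)) :
    numClasses (EqvGen E) ≤
      numClasses (EqvGen fun x y => E x y ∨ (x ∈ T ∧ y = g x)) + T.ncard := by
  induction T, Set.toFinite T using Set.Finite.induction_on with
  | empty => simp
  | @insert a T haT hT ih =>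
    rw [Set.ncard_insert_of_notMem haT]
    have he := eqvGen_equivalence fun x y => E x y ∨ (x ∈ T ∧ y = g x)
    have h1 := numClasses_le_mergeRel he a (g a)
    have h2 : numClasses (mergeRel (EqvGen fun x y => E x y ∨ (x ∈ T ∧ y = g x)) a (g a)) ≤
        numClasses (EqvGen fun x y => E x y ∨ (x ∈ insert a T ∧ y = g x)) := by
      refine numClasses_anti fun x y hxy => ?_
      refine eqvGen_le (mergeRel_equivalence he a (g a)) (fun x y h => ?_) hxy
      rcases h with h | ⟨h | h, rfl⟩
      · exact Or.inl (EqvGen.rel _ _ (Or.inl h))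
      · rw [h]; exact mergeRel_self he a (g a)
      · exact Or.inl (EqvGen.rel _ _ (Or.inr ⟨h, rfl⟩))
    omega

theorem fixedCount_eq_ncard {n : ℕ} (π : Equiv.Perm (Fin n)) :
    fixedCount π = {x | π x = x}.ncard := by
  rw [fixedCount, ← Set.ncard_coe_finset]
  congr 1
  ext x
  simp

theorem count_two_mul (p : ℕ → Prop) [DecidablePred p] (N : ℕ) :
    ((Finset.range N).filter fun i => p (2 * i)).card +
      ((Finset.range N).filter fun i => p (2 * i + 1)).card =
      ((Finset.range (2 * N)).filter p).card := by
  simp only [Finset.card_filter]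
  induction N with
  | zero => simp
  | succ N ih =>
    rw [show 2 * (N + 1) = 2 * N + 1 + 1 by ring]
    simp only [Finset.sum_range_succ]
    linarith

theorem card_filter_modEq_range_two_mul (N e : ℕ) (hN : 0 < N) :
    ((Finset.range (2 * N)).filter fun j => j ≡ e [MOD N]).card = 2 := by
  have hlt := Nat.mod_lt e hN
  have : ((Finset.range (2 * N)).filter fun j => j ≡ e [MOD N]) = {e % N, e % N + N} := by
    ext j
    rw [Finset.mem_filter, Finset.mem_range, Finset.mem_insert, Finset.mem_singleton, Nat.ModEq]
    constructor
    · rintro ⟨h1, h2⟩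
      by_cases hj : j < N
      · left; rw [← h2, Nat.mod_eq_of_lt hj]
      · right
        rw [← h2, Nat.mod_eq_sub_mod (by omega), Nat.mod_eq_of_lt (by omega)]
        omega
    · rintro (rfl | rfl)
      · exact ⟨by omega, Nat.mod_mod _ _⟩
      · exact ⟨by omega, by simp⟩
  rw [this, Finset.card_pair (by omega)]

/-- The product of the green and blue involutions: the horizontal rotation. -/
def rot {n : ℕ} (f : Surf n) : Equiv.Perm (Fin n) :=
  f Color.G * f Color.B

/-- All three permutations are involutions. -/
def Involutive3 {n : ℕ} (f : Surf n) : Prop := ∀ X, f X * f X = 1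

/-- The horizontal component of `x` is a path. -/
def OneSided {n : ℕ} (f : Surf n) (x : Fin n) : Prop :=
  SameCycle (rot f) x (f Color.G x)

/-- `x` and `y` lie in the same horizontal component. -/
def Horiz {n : ℕ} (f : Surf n) (x y : Fin n) : Prop :=
  SameCycle (rot f) x y ∨ SameCycle (rot f) (f Color.G x) y

section Dihedral

variable {n : ℕ} {f : Surf n}

theorem Involutive3.apply (hf : Involutive3 f) (X : Color) (x : Fin n) : f X (f X x) = x := by
  rw [← Equiv.Perm.mul_apply, hf]; rfl

theorem green_rot (hf : Involutive3 f) (x : Fin n) : f Color.G (rot f x) = f Color.B x := by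
  rw [rot, Equiv.Perm.mul_apply, hf.apply]

theorem rot_blue (hf : Involutive3 f) (x : Fin n) : rot f (f Color.B x) = f Color.G x := by
  rw [rot, Equiv.Perm.mul_apply, hf.apply]

theorem sameCycle_green_blue (hf : Involutive3 f)
    (x : Fin n) : SameCycle (rot f) (f Color.G x) (f Color.B x) := by
  rw [← rot_blue hf]
  exact (sameCycle_step _ _).symm

theorem SameCycle_green (hf : Involutive3 f) {x y : Fin n} (h : SameCycle (rot f) x y) :
    SameCycle (rot f) (f Color.G x) (f Color.G y) := by
  have he : Equivalence fun x y => SameCycle (rot f) (f Color.G x) (f Color.G y) :=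
    ⟨fun _ => SameCycle.refl _ _, fun h => h.symm, fun h h' => h.trans h'⟩
  refine sameCycle_le he (fun x => ?_) h
  rw [green_rot hf]
  exact sameCycle_green_blue hf x

theorem horiz_equivalence (hf : Involutive3 f) : Equivalence (Horiz f) where
  refl x := Or.inl (SameCycle.refl _ _)
  symm {x y} h := by
    rcases h with h | h
    · exact Or.inl h.symm
    · refine Or.inr ?_
      have := SameCycle_green hf h
      rw [hf.apply] at this
      exact this.symm
  trans {x y z} h k := by
    rcases h with h | h <;> rcases k with k | k
    · exact Or.inl (h.trans k)
    · exact Or.inr ((SameCycle_green hf h).trans k)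
    · exact Or.inr (h.trans k)
    · have := SameCycle_green hf h
      rw [hf.apply] at this
      exact Or.inl (this.trans k)

theorem horiz_green (x : Fin n) : Horiz f x (f Color.G x) := Or.inr (SameCycle.refl _ _)

theorem horiz_blue (hf : Involutive3 f)
    (x : Fin n) : Horiz f x (f Color.B x) := Or.inr (sameCycle_green_blue hf x)

theorem OneSided.sameCycle {x y : Fin n} (hx : OneSided f x) (h : Horiz f x y) :
    SameCycle (rot f) x y := by
  rcases h with h | h
  · exact h
  · exact SameCycle.trans hx h

theorem OneSided.of_sameCycle (hf : Involutive3 f)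
    {x y : Fin n} (hx : OneSided f x) (h : SameCycle (rot f) x y) :
    OneSided f y :=
  (h.symm.trans hx).trans (SameCycle_green hf h)

theorem OneSided.of_horiz (hf : Involutive3 f) {x y : Fin n} (hx : OneSided f x) (h : Horiz f x y) :
    OneSided f y :=
  hx.of_sameCycle hf (hx.sameCycle h)

theorem oneSided_of_green_eq {x : Fin n} (h : f Color.G x = x) : OneSided f x := by
  rw [OneSided, h]

theorem oneSided_of_blue_eq (hf : Involutive3 f)
    {x : Fin n} (h : f Color.B x = x) : OneSided f x := by
  have := sameCycle_green_blue hf x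
  rw [h] at this
  exact this.symm

theorem rot_pow_green_rot_pow (hf : Involutive3 f) (i : ℕ) (x : Fin n) :
    (rot f ^ i) (f Color.G ((rot f ^ i) x)) = f Color.G x := by
  induction i with
  | zero => rfl
  | succ i ih =>
    have h : (rot f ^ (i + 1)) x = rot f ((rot f ^ i) x) := by
      rw [pow_succ', Equiv.Perm.mul_apply]
    rw [h, green_rot hf, pow_succ, Equiv.Perm.mul_apply, rot_blue hf, ih]

end Dihedral

theorem pow_apply_eq_pow_apply_iff_modEq {α : Type*} [Finite α] (σ : Equiv.Perm α) (z : α)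
    (a b : ℕ) :
    (σ ^ a) z = (σ ^ b) z ↔ a ≡ b [MOD Function.minimalPeriod σ z] := by
  wlog hab : a ≤ b generalizing a b
  · rw [eq_comm, this b a (by omega)]
    exact ⟨Nat.ModEq.symm, Nat.ModEq.symm⟩
  obtain ⟨c, rfl⟩ := Nat.exists_eq_add_of_le hab
  rw [pow_add, Equiv.Perm.mul_apply, EmbeddingLike.apply_eq_iff_eq, eq_comm,
    Nat.modEq_iff_dvd' (by omega), Nat.add_sub_cancel_left,
    ← Function.isPeriodicPt_iff_minimalPeriod_dvd, Function.IsPeriodicPt, Function.IsFixedPt,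
    Equiv.Perm.iterate_eq_pow]

theorem minimalPeriod_perm_pos {α : Type*} [Finite α] (σ : Equiv.Perm α) (z : α) :
    0 < Function.minimalPeriod σ z := by
  rw [Function.minimalPeriod_pos_iff_mem_periodicPts]
  refine ⟨orderOf σ, orderOf_pos σ, ?_⟩
  rw [Function.IsPeriodicPt, Function.IsFixedPt, Equiv.Perm.iterate_eq_pow, pow_orderOf_eq_one]
  rfl

theorem ncard_sameCycle_sep {α : Type*} [Finite α] (σ : Equiv.Perm α) (z : α) (p : α → Prop)
    (q : ℕ → Prop) [DecidablePred q] (hpq : ∀ i, p ((σ ^ i) z) ↔ q i) :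
    {x | SameCycle σ z x ∧ p x}.ncard =
      ((Finset.range (Function.minimalPeriod σ z)).filter q).card := by
  rw [← Set.ncard_coe_finset]
  have hpos := minimalPeriod_perm_pos σ z
  have himg : {x | SameCycle σ z x ∧ p x} =
      (fun i : ℕ => (σ ^ i) z) '' ((Finset.range (Function.minimalPeriod σ z)).filter q) := by
    ext x
    simp only [Set.mem_ofPred_eq, Set.mem_image, Finset.coe_filter, Finset.mem_range]
    constructor
    · rintro ⟨h, hp⟩
      obtain ⟨i, rfl⟩ := h.exists_nat_pow_eq
      have h1 : (σ ^ (i % Function.minimalPeriod σ z)) z = (σ ^ i) z :=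
        (pow_apply_eq_pow_apply_iff_modEq σ z _ _).mpr (Nat.mod_modEq _ _)
      exact ⟨i % Function.minimalPeriod σ z,
        ⟨Nat.mod_lt _ hpos, (hpq _).mp (h1.symm ▸ hp)⟩, h1⟩
    · rintro ⟨i, ⟨_, hq⟩, rfl⟩
      exact ⟨⟨i, by simp⟩, (hpq i).mpr hq⟩
  rw [himg, Set.InjOn.ncard_image]
  intro i hi j hj hij
  simp only [Finset.coe_filter, Finset.mem_range, Set.mem_ofPred_eq] at hi hj
  have := (pow_apply_eq_pow_apply_iff_modEq σ z i j).mp hij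
  rwa [Nat.ModEq, Nat.mod_eq_of_lt hi.1, Nat.mod_eq_of_lt hj.1] at this

/-- A path component has exactly two ends. -/
theorem OneSided.ncard_ends {n : ℕ} {f : Surf n} (hf : Involutive3 f) {z : Fin n}
    (hz : OneSided f z) :
    {x | SameCycle (rot f) z x ∧ f Color.G x = x}.ncard +
      {x | SameCycle (rot f) z x ∧ f Color.B x = x}.ncard = 2 := by
  obtain ⟨e, he⟩ := SameCycle.exists_nat_pow_eq hz
  set N := Function.minimalPeriod (rot f) z with hN
  have hG : ∀ i, f Color.G ((rot f ^ i) z) = (rot f ^ i) z ↔ 2 * i ≡ e [MOD N] := by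
    intro i
    rw [← pow_apply_eq_pow_apply_iff_modEq, he, ← rot_pow_green_rot_pow hf i z, two_mul, pow_add,
      Equiv.Perm.mul_apply, EmbeddingLike.apply_eq_iff_eq, eq_comm]
  have hB : ∀ i, f Color.B ((rot f ^ i) z) = (rot f ^ i) z ↔ 2 * i + 1 ≡ e [MOD N] := by
    intro i
    rw [← pow_apply_eq_pow_apply_iff_modEq, he, ← rot_pow_green_rot_pow hf (i + 1) z,
      show 2 * i + 1 = (i + 1) + i by ring, pow_add,
      Equiv.Perm.mul_apply, EmbeddingLike.apply_eq_iff_eq, eq_comm, pow_succ' _ i,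
      Equiv.Perm.mul_apply, green_rot hf]
  rw [ncard_sameCycle_sep (rot f) z (fun x => f Color.G x = x) (fun i => 2 * i ≡ e [MOD N]) hG,
    ncard_sameCycle_sep (rot f) z (fun x => f Color.B x = x) (fun i => 2 * i + 1 ≡ e [MOD N]) hB,
    ← hN, count_two_mul (fun j => j ≡ e [MOD N]),
    card_filter_modEq_range_two_mul N e (minimalPeriod_perm_pos _ _)]

/-- The least element of the cycle of `x` under `σ`. -/
noncomputable def cycRep {n : ℕ} (σ : Equiv.Perm (Fin n)) (x : Fin n) : Fin n :=
  (exists_minRep (sameCycle_equivalence σ) x).choose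

theorem sameCycle_cycRep {n : ℕ} (σ : Equiv.Perm (Fin n)) (x : Fin n) :
    SameCycle σ x (cycRep σ x) :=
  (exists_minRep (sameCycle_equivalence σ) x).choose_spec.1

theorem cycRep_mem {n : ℕ} (σ : Equiv.Perm (Fin n)) (x : Fin n) :
    cycRep σ x ∈ minReps (SameCycle σ) :=
  (exists_minRep (sameCycle_equivalence σ) x).choose_spec.2

theorem cycRep_eq {n : ℕ} {σ : Equiv.Perm (Fin n)} {x y : Fin n} (h : SameCycle σ x y)
    (hy : y ∈ minReps (SameCycle σ)) : cycRep σ x = y :=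
  eq_of_mem_minReps (sameCycle_equivalence σ) (cycRep_mem σ x) hy
    ((sameCycle_cycRep σ x).symm.trans h)

/-- Representatives of the path components. -/
def oneReps {n : ℕ} (f : Surf n) : Set (Fin n) :=
  {x | x ∈ minReps (SameCycle (rot f)) ∧ OneSided f x}

/-- Representatives of the cyclic components. -/
def twoReps {n : ℕ} (f : Surf n) : Set (Fin n) :=
  {x | x ∈ minReps (SameCycle (rot f)) ∧ x < cycRep (rot f) (f Color.G x)}

theorem cycRep_green_involutive {n : ℕ} {f : Surf n} (hf : Involutive3 f) {x : Fin n}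
    (hx : x ∈ minReps (SameCycle (rot f))) :
    cycRep (rot f) (f Color.G (cycRep (rot f) (f Color.G x))) = x := by
  refine cycRep_eq ?_ hx
  have := SameCycle_green hf (sameCycle_cycRep (rot f) (f Color.G x))
  rw [hf.apply] at this
  exact this.symm

theorem two_mul_ncard_twoReps {n : ℕ} {f : Surf n} (hf : Involutive3 f) :
    2 * (twoReps f).ncard + (oneReps f).ncard = numClasses (SameCycle (rot f)) := by
  set g : Fin n → Fin n := fun x => cycRep (rot f) (f Color.G x) with hg
  set T' : Set (Fin n) := {x | x ∈ minReps (SameCycle (rot f)) ∧ g x < x} with hT'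
  have hgg : ∀ x ∈ minReps (SameCycle (rot f)), g (g x) = x := fun x hx =>
    cycRep_green_involutive hf hx
  have hcard : (twoReps f).ncard = T'.ncard := by
    refine Set.ncard_congr (fun x _ => g x) ?_ ?_ ?_
    · intro x hx
      exact ⟨cycRep_mem _ _, by rw [hgg x hx.1]; exact hx.2⟩
    · intro x y hx hy hxy
      rw [← hgg x hx.1, ← hgg y hy.1]
      exact congrArg g hxy
    · intro y hy
      exact ⟨g y, ⟨cycRep_mem _ _, by
        change g y < g (g y)
        rw [hgg y hy.1]; exact hy.2⟩, hgg y hy.1⟩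
  have hunion : minReps (SameCycle (rot f)) = (twoReps f ∪ T') ∪ oneReps f := by
    ext x
    constructor
    · intro hx
      rcases lt_trichotomy x (g x) with h | h | h
      · exact Or.inl (Or.inl ⟨hx, h⟩)
      · refine Or.inr ⟨hx, ?_⟩
        have := sameCycle_cycRep (rot f) (f Color.G x)
        rw [show cycRep (rot f) (f Color.G x) = x from h.symm] at this
        exact this.symm
      · exact Or.inl (Or.inr ⟨hx, h⟩)
    · rintro ((h | h) | h) <;> exact h.1
  rw [numClasses, hunion, Set.ncard_union_eq, Set.ncard_union_eq, ← hcard]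
  · ring
  · rw [Set.disjoint_left]
    intro x hx hx'
    exact lt_asymm hx.2 hx'.2
  · rw [Set.disjoint_left]
    intro x hx hx'
    have : g x = x := cycRep_eq (SameCycle.symm hx'.2) hx'.1
    rcases hx with hx | hx
    · exact absurd hx.2 (by change ¬ x < g x; rw [this]; exact lt_irrefl x)
    · exact absurd hx.2 (by rw [this]; exact lt_irrefl x)

theorem ncard_eq_sum_oneReps {n : ℕ} {f : Surf n} (hf : Involutive3 f) (p : Fin n → Prop)
    (hp : ∀ x, p x → OneSided f x) :
    {x | p x}.ncard =
      ∑ z ∈ (Set.toFinite (oneReps f)).toFinset, {x | SameCycle (rot f) z x ∧ p x}.ncard := by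
  classical
  have h1 : {x | p x}.ncard = (Finset.univ.filter p).card := by
    rw [← Set.ncard_coe_finset]; congr 1; ext x; simp
  rw [h1, Finset.card_eq_sum_card_fiberwise (f := cycRep (rot f))
    (t := (Set.toFinite (oneReps f)).toFinset)]
  · refine Finset.sum_congr rfl fun z hz => ?_
    rw [Set.Finite.mem_toFinset] at hz
    rw [← Set.ncard_coe_finset]
    congr 1
    ext x
    simp only [Finset.coe_filter, Finset.mem_filter, Finset.mem_univ, true_and,
      Set.mem_ofPred_eq]
    constructor
    · rintro ⟨h, h'⟩
      exact ⟨h' ▸ (sameCycle_cycRep _ x).symm, h⟩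
    · rintro ⟨h, h'⟩
      exact ⟨h', cycRep_eq h.symm hz.1⟩
  · intro x hx
    simp only [Finset.coe_filter, Finset.mem_univ, true_and, Set.mem_ofPred_eq] at hx
    rw [Set.Finite.coe_toFinset]
    exact ⟨cycRep_mem _ _, (hp x hx).of_sameCycle hf (sameCycle_cycRep _ x)⟩

theorem fixedCount_green_add_blue {n : ℕ} {f : Surf n} (hf : Involutive3 f) :
    fixedCount (f Color.G) + fixedCount (f Color.B) = 2 * (oneReps f).ncard := by
  rw [fixedCount_eq_ncard, fixedCount_eq_ncard,
    ncard_eq_sum_oneReps hf (fun x => f Color.G x = x) fun x => oneSided_of_green_eq,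
    ncard_eq_sum_oneReps hf (fun x => f Color.B x = x) fun x => oneSided_of_blue_eq hf,
    ← Finset.sum_add_distrib, Finset.sum_congr rfl (g := fun _ => 2), Finset.sum_const,
    ← Set.ncard_eq_toFinset_card, smul_eq_mul, mul_comm]
  intro z hz
  rw [Set.Finite.mem_toFinset] at hz
  exact hz.2.ncard_ends hf

/-- The invariant properties of a spherical square-tiled surface with at most one vertex of
angle `π` and `k` folded edges. -/
structure Spherical {n : ℕ} (f : Surf n) (k : ℕ) : Prop where
  inv : Involutive3 f
  conn : ∀ x y, EqvGen (fun a b => ∃ X, b = f X a) x y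
  euler : 2 * numClasses (SameCycle (prodRGB f)) + k = n + 4
  fixed : totalFixed f = k
  pole : {x | prodRGB f x = x}.ncard ≤ 1

theorem prodRGB_eq {n : ℕ} (f : Surf n) : prodRGB f = f Color.R * rot f := by
  rw [prodRGB, rot, mul_assoc]

namespace Spherical

variable {n : ℕ} {f : Surf n} {k : ℕ}

theorem forall_of_closed (hf : Spherical f k) {r : Fin n → Fin n → Prop} (hr : Equivalence r)
    (hrot : ∀ x, r x (rot f x)) (hR : ∀ x, r x (f Color.R x)) (hG : ∀ x, r x (f Color.G x))
    (x y : Fin n) : r x y := by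
  refine eqvGen_le hr ?_ (hf.conn x y)
  rintro x y ⟨X, rfl⟩
  cases X with
  | R => exact hR x
  | G => exact hG x
  | B =>
    have := hG (rot f x)
    rw [green_rot hf.inv] at this
    exact hr.trans (hrot x) this

theorem euler_lower (hf : Spherical f k) :
    (twoReps f).ncard + 1 ≤ numClasses (GenRel (f Color.R) (rot f)) := by
  have h1 := riemann_hurwitz (f Color.R) (rot f) (hf.inv _)
  have h2 := two_mul_ncard_twoReps hf.inv
  have h3 := fixedCount_green_add_blue hf.inv
  have h4 := hf.euler
  have h5 := hf.fixed
  rw [totalFixed, fixedCount_eq_ncard (f Color.R)] at h5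
  rw [prodRGB_eq] at h4
  omega

/-- Crossing the representative edges recovers any crossing of a cyclic component. -/
theorem cross (hf : Spherical f k) {r : Fin n → Fin n → Prop} (hr : Equivalence r)
    (hrot : ∀ x, r x (rot f x)) (y : Fin n)
    (hT : ∀ w ∈ twoReps f, Horiz f y w → r w (f Color.G w)) : r y (f Color.G y) := by
  have hs : ∀ {a b}, SameCycle (rot f) a b → r a b := fun h => sameCycle_le hr hrot h
  have h1 := sameCycle_cycRep (rot f) y
  have h2 := sameCycle_cycRep (rot f) (f Color.G y)
  rcases lt_trichotomy (cycRep (rot f) y) (cycRep (rot f) (f Color.G y)) with h | h | h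
  · have hw : cycRep (rot f) y ∈ twoReps f := by
      refine ⟨cycRep_mem _ _, ?_⟩
      rwa [cycRep_eq ((SameCycle_green hf.inv h1).symm.trans h2) (cycRep_mem _ _)]
    exact hr.trans (hs h1) (hr.trans (hT _ hw (Or.inl h1)) (hs (SameCycle_green hf.inv h1.symm)))
  · rw [h] at h1
    exact hs (h1.trans h2.symm)
  · have h3 : SameCycle (rot f) (f Color.G (cycRep (rot f) (f Color.G y))) y := by
      have := SameCycle_green hf.inv h2
      rw [hf.inv.apply] at this
      exact this.symm
    have hw : cycRep (rot f) (f Color.G y) ∈ twoReps f := by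
      refine ⟨cycRep_mem _ _, ?_⟩
      rwa [cycRep_eq (h3.trans h1) (cycRep_mem _ _)]
    exact hr.symm (hr.trans (hs h2) (hr.trans (hT _ hw (Or.inr h2)) (hs h3)))

end Spherical

/-- Connection without crossing the horizontal component of `h`. -/
def AvoidRel {n : ℕ} (f : Surf n) (h : Fin n) : Fin n → Fin n → Prop :=
  EqvGen fun x y => y = f Color.R x ∨ SameCycle (rot f) x y ∨ (Horiz f x y ∧ ¬ Horiz f h x)

theorem avoidRel_equivalence {n : ℕ} (f : Surf n) (h : Fin n) : Equivalence (AvoidRel f h) :=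
  eqvGen_equivalence _

theorem avoidRel_of_genRel {n : ℕ} {f : Surf n} (h : Fin n) {x y : Fin n}
    (hxy : GenRel (f Color.R) (rot f) x y) : AvoidRel f h x y := by
  refine eqvGen_le (avoidRel_equivalence f h) (fun x y hs => ?_) hxy
  rcases hs with rfl | rfl
  · exact EqvGen.rel _ _ (Or.inl rfl)
  · exact EqvGen.rel _ _ (Or.inr (Or.inl (sameCycle_step _ _)))

namespace Spherical

variable {n : ℕ} {f : Surf n} {k : ℕ}

/-- Jordan separation: a cyclic component separates its two sides. -/
theorem separates (hf : Spherical f k)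
    {x : Fin n} (hx : ¬ OneSided f x) : ¬ AvoidRel f x x (f Color.G x) := by
  intro hK
  obtain ⟨w, hw, hxw⟩ : ∃ w ∈ twoReps f, Horiz f x w := by
    by_contra hcon
    push Not at hcon
    exact hx (hf.cross (sameCycle_equivalence _) (sameCycle_step _) x
      fun w hw h => absurd h (hcon w hw))
  set E : Fin n → Fin n → Prop := fun x y => y = f Color.R x ∨ y = rot f x
  have hcount := numClasses_eqvGen_le_add_ncard E (f Color.G) (twoReps f \ {w})
  set r := EqvGen fun x y => E x y ∨ (x ∈ twoReps f \ {w} ∧ y = f Color.G x) with hr_def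
  have hr : Equivalence r := eqvGen_equivalence _
  have hrot : ∀ y, r y (rot f y) := fun y => EqvGen.rel _ _ (Or.inl (Or.inr rfl))
  have hR : ∀ y, r y (f Color.R y) := fun y => EqvGen.rel _ _ (Or.inl (Or.inl rfl))
  have hs : ∀ {a b}, SameCycle (rot f) a b → r a b := fun h => sameCycle_le hr hrot h
  have hh := horiz_equivalence hf.inv
  have hG1 : ∀ y, ¬ Horiz f x y → r y (f Color.G y) := by
    intro y hy
    refine hf.cross hr hrot y fun v hv hyv => EqvGen.rel _ _ (Or.inr ⟨⟨hv, ?_⟩, rfl⟩)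
    rintro rfl
    exact hy (hh.trans hxw (hh.symm hyv))
  have hxG : r x (f Color.G x) := by
    refine eqvGen_le hr (fun a b hab => ?_) hK
    rcases hab with rfl | h | ⟨h, h'⟩
    · exact hR a
    · exact hs h
    · rcases h with h | h
      · exact hs h
      · exact hr.trans (hG1 a h') (hs h)
  have hG : ∀ y, r y (f Color.G y) := by
    intro y
    by_cases hy : Horiz f x y
    · rcases hy with hy | hy
      · exact hr.trans (hs hy.symm) (hr.trans hxG (hs (SameCycle_green hf.inv hy)))
      · have := SameCycle_green hf.inv hy
        rw [hf.inv.apply] at this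
        exact hr.trans (hs hy.symm) (hr.trans (hr.symm hxG) (hs this))
    · exact hG1 y hy
  have hone := numClasses_le_one (hf.forall_of_closed hr hrot hR hG)
  have hlow := hf.euler_lower
  have hT := Set.ncard_sdiff_singleton_add_one hw
  have hEq : numClasses (GenRel (f Color.R) (rot f)) = numClasses (EqvGen E) := rfl
  omega

theorem euler_upper (hf : Spherical f k) :
    numClasses (GenRel (f Color.R) (rot f)) ≤ (twoReps f).ncard + 1 := by
  set E : Fin n → Fin n → Prop := fun x y => y = f Color.R x ∨ y = rot f x
  have hcount := numClasses_eqvGen_le_add_ncard E (f Color.G) (twoReps f)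
  set r := EqvGen fun x y => E x y ∨ (x ∈ twoReps f ∧ y = f Color.G x) with hr_def
  have hr : Equivalence r := eqvGen_equivalence _
  have hrot : ∀ y, r y (rot f y) := fun y => EqvGen.rel _ _ (Or.inl (Or.inr rfl))
  have hR : ∀ y, r y (f Color.R y) := fun y => EqvGen.rel _ _ (Or.inl (Or.inl rfl))
  have hone := numClasses_le_one (hf.forall_of_closed hr hrot hR fun y =>
    hf.cross hr hrot y fun v hv _ => EqvGen.rel _ _ (Or.inr ⟨hv, rfl⟩))
  have hEq : numClasses (GenRel (f Color.R) (rot f)) = numClasses (EqvGen E) := rfl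
  omega

/-- A side of a component that is glued to itself carries a folded edge. -/
theorem exists_fixed_of_closed (hf : Spherical f k) {u : Fin n}
    (hu : ∀ y, SameCycle (rot f) u y → SameCycle (rot f) u (f Color.R y)) :
    ∃ y, SameCycle (rot f) u y ∧ f Color.R y = y := by
  by_contra hcon
  push Not at hcon
  set ρ := rot f with hρ
  set s : Set (Fin n) := {y | SameCycle ρ u y} with hs
  have hRs : ∀ y, f Color.R y ∈ s ↔ y ∈ s := by
    intro y
    refine ⟨fun h => ?_, fun h => hu y h⟩
    have := hu _ h
    rwa [hf.inv.apply] at this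
  have hρs : ∀ y, ρ y ∈ s ↔ y ∈ s := fun y =>
    ⟨fun h => SameCycle.trans h (sameCycle_step ρ y).symm,
      fun h => SameCycle.trans h (sameCycle_step ρ y)⟩
  classical
  have hmap : ∀ x, (if x ∈ s then x else f Color.R x) ∈ s ↔ x ∈ s := by
    intro x
    by_cases h : x ∈ s
    · simp [h]
    · simp [h, hRs]
  have hinvol : Function.Involutive fun x => if x ∈ s then x else f Color.R x := by
    intro x
    by_cases h : x ∈ s
    · simp [h]
    · simp [h, hRs, hf.inv.apply]
  set S : Equiv.Perm (Fin n) := hinvol.toPerm with hS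
  have hSs : ∀ x ∈ s, S x = x := fun x hx => if_pos hx
  have hSn : ∀ x, x ∉ s → S x = f Color.R x := fun x hx => if_neg hx
  have hSS : S * S = 1 := Equiv.ext hinvol
  have hRH := riemann_hurwitz S ρ hSS
  have hfix : {x | S x = x}.ncard = {x | f Color.R x = x}.ncard + s.ncard := by
    rw [← Set.ncard_union_eq]
    · congr 1
      ext x
      by_cases h : x ∈ s
      · simp [h, hSs]
      · simp [h, hSn]
    · rw [Set.disjoint_left]
      exact fun x hx hx' => hcon x hx' hx
  have hcls : numClasses (GenRel S ρ) ≤ numClasses (GenRel (f Color.R) ρ) := by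
    refine numClasses_anti fun x y hxy => ?_
    refine eqvGen_le (genRel_equivalence S ρ) (fun x y h => ?_) hxy
    rcases h with rfl | rfl
    · by_cases h : x ∈ s
      · exact genRel_of_sameCycle (SameCycle.trans (SameCycle.symm h) ((hRs x).mpr h))
      · rw [← hSn x h]; exact genRel_left S ρ x
    · exact genRel_right S ρ x
  set π := f Color.R * ρ with hπ
  have hsplit : ∀ A : Set (Fin n), A.ncard = (A ∩ s).ncard + (A \ s).ncard := fun A =>
    (Set.ncard_inter_add_ncard_sdiff_eq_ncard A s).symm
  have hsub : ∀ σ τ : Equiv.Perm (Fin n), (∀ x, τ x ∈ s ↔ x ∈ s) → (∀ x, x ∉ s → σ x = τ x) →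
      ∀ x y, x ∉ s → SameCycle τ x y → SameCycle σ x y := by
    intro σ τ hτ hστ x y hx hxy
    obtain ⟨i, rfl⟩ := hxy.exists_nat_pow_eq
    have key : ∀ i : ℕ, (τ ^ i) x ∉ s ∧ (σ ^ i) x = (τ ^ i) x := by
      intro i
      induction i with
      | zero => exact ⟨hx, rfl⟩
      | succ i ih =>
        rw [pow_succ', pow_succ', Equiv.Perm.mul_apply, Equiv.Perm.mul_apply, ih.2, hτ]
        exact ⟨ih.1, hστ _ ih.1⟩
    exact ⟨i, by rw [zpow_natCast]; exact (key i).2⟩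
  have hπs : ∀ x, π x ∈ s ↔ x ∈ s := fun x => by
    rw [hπ, Equiv.Perm.mul_apply, hRs, hρs]
  have hSρs : ∀ x, (S * ρ) x ∈ s ↔ x ∈ s := fun x => by
    rw [Equiv.Perm.mul_apply, ← hρs x]; exact hmap _
  have heq : ∀ x, x ∉ s → π x = (S * ρ) x := fun x hx => by
    rw [hπ, Equiv.Perm.mul_apply, Equiv.Perm.mul_apply, hSn _ (by rwa [hρs])]
  have hout : (minReps (SameCycle π) \ s).ncard ≤ (minReps (SameCycle (S * ρ)) \ s).ncard := by
    refine Set.ncard_le_ncard ?_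
    rintro x ⟨hx, hxs⟩
    exact ⟨fun y hy => hx y (hsub π (S * ρ) hSρs heq x y hxs hy), hxs⟩
  have hin : 1 ≤ (minReps (SameCycle (S * ρ)) ∩ s).ncard := by
    refine (Set.ncard_pos (Set.toFinite _)).mpr ⟨cycRep (S * ρ) u, cycRep_mem _ _, ?_⟩
    have h1 : ∀ x y, SameCycle (S * ρ) x y → (x ∈ s ↔ y ∈ s) := fun x y h =>
      sameCycle_le (r := fun x y => x ∈ s ↔ y ∈ s)
        ⟨fun _ => Iff.rfl, fun h => h.symm, fun h h' => h.trans h'⟩ (fun x => (hSρs x).symm) h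
    exact (h1 _ _ (sameCycle_cycRep (S * ρ) u)).mp (SameCycle.refl ρ u)
  have hhalf : 2 * (minReps (SameCycle π) ∩ s).ncard ≤ s.ncard + 1 := by
    set A := minReps (SameCycle π) ∩ s with hA
    have h1 : A.ncard = (A ∩ {x | π x = x}).ncard + (A \ {x | π x = x}).ncard :=
      (Set.ncard_inter_add_ncard_sdiff_eq_ncard A _).symm
    have h2 : (A ∩ {x | π x = x}).ncard ≤ 1 := by
      refine (Set.ncard_le_ncard Set.inter_subset_right).trans ?_
      have := hf.pole
      rwa [prodRGB_eq] at this
    have h3 : (A \ {x | π x = x}).ncard ≤ (s \ A).ncard := by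
      refine Set.ncard_le_ncard_of_injOn π ?_ π.injective.injOn
      rintro x ⟨⟨hx, hxs⟩, hne⟩
      refine ⟨(hπs x).mpr hxs, fun h => hne ?_⟩
      exact eq_of_mem_minReps (sameCycle_equivalence π) h.1 hx (sameCycle_step π x).symm
    have h4 : (s \ A).ncard + A.ncard = s.ncard :=
      Set.ncard_sdiff_add_ncard_of_subset Set.inter_subset_right
    omega
  have e1 := hsplit (minReps (SameCycle π))
  have e2 := hsplit (minReps (SameCycle (S * ρ)))
  have e3 := hf.euler
  have e4 := hf.fixed
  have e5 := hf.euler_upper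
  have e6 := two_mul_ncard_twoReps hf.inv
  have e7 := fixedCount_green_add_blue hf.inv
  rw [totalFixed, fixedCount_eq_ncard (f Color.R)] at e4
  rw [prodRGB_eq, ← hρ, ← hπ] at e3
  rw [← hρ] at e5 e6
  unfold numClasses at *
  omega

/-- There are at most `k - 3` vertices of angle at least `3π`. -/
theorem ncard_big_le (hf : Spherical f k) :
    {x | x ∈ minReps (SameCycle (prodRGB f)) ∧ prodRGB f (prodRGB f x) ≠ x}.ncard + 3 ≤ k := by
  set π := prodRGB f with hπ
  set M := minReps (SameCycle π) with hM
  set X := {x | x ∈ M ∧ π (π x) ≠ x} with hX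
  have he := sameCycle_equivalence π
  have h1 : M.ncard = (M ∩ {x | π x = x}).ncard + (M \ {x | π x = x}).ncard :=
    (Set.ncard_inter_add_ncard_sdiff_eq_ncard M _).symm
  have h2 : (M ∩ {x | π x = x}).ncard ≤ 1 :=
    (Set.ncard_le_ncard Set.inter_subset_right).trans hf.pole
  have hA : (π '' (M \ {x | π x = x})).ncard = (M \ {x | π x = x}).ncard :=
    π.injective.injOn.ncard_image
  have hB : ((fun x => π (π x)) '' X).ncard = X.ncard :=
    (π.injective.comp π.injective).injOn.ncard_image
  have hd1 : Disjoint M (π '' (M \ {x | π x = x})) := by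
    rw [Set.disjoint_left]
    rintro _ h ⟨x, hx, rfl⟩
    exact hx.2 (eq_of_mem_minReps he h hx.1 (sameCycle_step π x).symm)
  have hd2 : Disjoint (M ∪ π '' (M \ {x | π x = x})) ((fun x => π (π x)) '' X) := by
    rw [Set.disjoint_left]
    have hs2 : ∀ x, SameCycle π x (π (π x)) := fun x =>
      (sameCycle_step π x).trans (sameCycle_step π _)
    rintro _ (h | ⟨y, hy, hyx⟩) ⟨x, hx, rfl⟩
    · exact hx.2 (eq_of_mem_minReps he h hx.1 (hs2 x).symm)
    · have h3 : y = π x := π.injective hyx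
      have h4 : y = x := eq_of_mem_minReps he hy.1 hx.1
        (by rw [h3]; exact (sameCycle_step π x).symm)
      exact hy.2 (by rw [Set.mem_ofPred_eq, h4, ← h3, h4])
  have hle : (M ∪ π '' (M \ {x | π x = x}) ∪ (fun x => π (π x)) '' X).ncard ≤ n := by
    refine (Set.ncard_le_ncard (Set.subset_univ _)).trans ?_
    rw [Set.ncard_univ, Nat.card_eq_fintype_card, Fintype.card_fin]
  rw [Set.ncard_union_eq hd2, Set.ncard_union_eq hd1, hA, hB] at hle
  have he := hf.euler
  rw [numClasses, ← hπ, ← hM] at he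
  omega

/-- A component side which is glued both to itself and to something else touches a vertex of
angle at least `3π`. -/
theorem exists_big (hf : Spherical f k) {u : Fin n} (hu : SameCycle (rot f) u (f Color.R u))
    (hex : ∃ y, SameCycle (rot f) u y ∧ ¬ SameCycle (rot f) u (f Color.R y)) :
    ∃ x, x ∈ minReps (SameCycle (prodRGB f)) ∧ prodRGB f (prodRGB f x) ≠ x ∧
      GenRel (f Color.R) (rot f) u x := by
  by_contra hcon
  push Not at hcon
  set π := prodRGB f with hπ
  set ρ := rot f with hρ
  set V := GenRel (f Color.R) ρ with hV
  have hVe : Equivalence V := genRel_equivalence _ _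
  have hπV : ∀ {x y}, SameCycle π x y → V x y := fun h => by
    refine sameCycle_le hVe (fun z => ?_) h
    rw [hπ, prodRGB_eq, Equiv.Perm.mul_apply]
    exact hVe.trans (genRel_right _ _ z) (genRel_left _ _ _)
  have hinv : ∀ z, V u z → π (π z) = z := by
    intro z hz
    by_contra hne
    have h1 := sameCycle_cycRep π z
    refine hcon (cycRep π z) (cycRep_mem π z) (fun h => hne ?_) (hVe.trans hz (hπV h1))
    obtain ⟨i, hi⟩ := h1.symm.exists_nat_pow_eq
    rw [← hi]
    have : π (π ((π ^ i) (cycRep π z))) = (π ^ i) (π (π (cycRep π z))) := by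
      have h2 := congrArg (fun σ : Equiv.Perm (Fin n) => σ (cycRep π z))
        (((Commute.refl π).mul_left (Commute.refl π)).pow_right i).eq
      simpa only [Equiv.Perm.mul_apply] using h2
    rw [this, h]
  have hstep : ∀ z, V u z → SameCycle ρ (f Color.R z) (f Color.R (ρ z)) := by
    intro z hz
    have h1 := hinv z hz
    rw [hπ, prodRGB_eq, Equiv.Perm.mul_apply, Equiv.Perm.mul_apply] at h1
    have h2 : ρ (f Color.R (ρ z)) = f Color.R z := by
      rw [← h1, hf.inv.apply, h1]
    rw [← h2]
    exact (sameCycle_step ρ _).symm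
  obtain ⟨y, hy, hny⟩ := hex
  obtain ⟨i, rfl⟩ := hy.exists_nat_pow_eq
  clear hy
  refine hny (hu.trans ?_)
  clear hny
  induction i with
  | zero => exact SameCycle.refl _ _
  | succ i ih =>
    have : V u ((ρ ^ i) u) := genRel_of_sameCycle ⟨i, by simp⟩
    rw [pow_succ', Equiv.Perm.mul_apply]
    exact ih.trans (hstep _ this)

end Spherical

/-! ### Cylinder shears -/

section Shear

variable {n : ℕ} {f : Surf n} (hf : Involutive3 f) {i j : Color} {c : Set (Fin n)}

theorem invariant_iff (hf : Involutive3 f) (h : ∀ x ∈ c, f i x ∈ c) (x : Fin n) :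
    f i x ∈ c ↔ x ∈ c :=
  ⟨fun hx => hf.apply i x ▸ h _ hx, h x⟩

theorem restrictPerm_apply {σ : Equiv.Perm (Fin n)} (h : ∀ x, σ x ∈ c ↔ x ∈ c) (x : Fin n)
    [Decidable (x ∈ c)] : restrictPerm σ c x = if x ∈ c then σ x else x := by
  rw [restrictPerm, dif_pos h]
  by_cases hx : x ∈ c <;> simp [hx]

theorem shear_left_of_mem (hf : Involutive3 f) (hi : ∀ x ∈ c, f i x ∈ c)
    (hj : ∀ x ∈ c, f j x ∈ c) {x : Fin n} (hx : x ∈ c) : shear f i j c i x = f j x := by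
  classical
  rw [shear, if_pos (Or.inl rfl), Equiv.Perm.mul_apply, Equiv.Perm.mul_apply,
    restrictPerm_apply (invariant_iff hf hj), if_pos hx,
    restrictPerm_apply (invariant_iff hf hi), if_pos (hj x hx), hf.apply]

theorem shear_right_of_mem (hf : Involutive3 f) (hi : ∀ x ∈ c, f i x ∈ c)
    (hj : ∀ x ∈ c, f j x ∈ c) {x : Fin n} (hx : x ∈ c) :
    shear f i j c j x = f j (f i (f j x)) := by
  classical
  rw [shear, if_pos (Or.inr rfl), Equiv.Perm.mul_apply, Equiv.Perm.mul_apply,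
    restrictPerm_apply (invariant_iff hf hj), if_pos hx,
    restrictPerm_apply (invariant_iff hf hi), if_pos (hj x hx)]

theorem shear_of_notMem (hf : Involutive3 f) (hi : ∀ x ∈ c, f i x ∈ c)
    (hj : ∀ x ∈ c, f j x ∈ c) {x : Fin n} (hx : x ∉ c) (X : Color) :
    shear f i j c X x = f X x := by
  classical
  rw [shear]
  split_ifs
  · rw [Equiv.Perm.mul_apply, Equiv.Perm.mul_apply,
      restrictPerm_apply (invariant_iff hf hj), if_neg hx,
      restrictPerm_apply (invariant_iff hf hi), if_neg hx]
  · rfl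

theorem shear_of_ne {X : Color} (hi : X ≠ i) (hj : X ≠ j) : shear f i j c X = f X := by
  rw [shear, if_neg (by tauto)]

theorem Involutive3.shear (hf : Involutive3 f) (hi : ∀ x ∈ c, f i x ∈ c)
    (hj : ∀ x ∈ c, f j x ∈ c) : Involutive3 (shear f i j c) := by
  intro X
  ext1 x
  rw [Equiv.Perm.mul_apply, Equiv.Perm.one_apply]
  by_cases hXi : X = i
  · subst hXi
    by_cases hx : x ∈ c
    · rw [shear_left_of_mem hf hi hj hx, shear_left_of_mem hf hi hj (hj x hx), hf.apply]
    · rw [shear_of_notMem hf hi hj hx, shear_of_notMem hf hi hj, hf.apply]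
      rwa [invariant_iff hf hi]
  by_cases hXj : X = j
  · subst hXj
    by_cases hx : x ∈ c
    · rw [shear_right_of_mem hf hi hj hx,
        shear_right_of_mem hf hi hj (hj _ (hi _ (hj x hx)))]
      simp only [hf.apply]
    · rw [shear_of_notMem hf hi hj hx, shear_of_notMem hf hi hj, hf.apply]
      rwa [invariant_iff hf hj]
  · rw [shear_of_ne hXi hXj, hf.apply]

theorem shear_fixedCount (hf : Involutive3 f) (hi : ∀ x ∈ c, f i x ∈ c)
    (hj : ∀ x ∈ c, f j x ∈ c) :
    fixedCount (shear f i j c i) + fixedCount (shear f i j c j) =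
      fixedCount (f i) + fixedCount (f j) := by
  have hsplit : ∀ s : Set (Fin n), s.ncard = (s ∩ c).ncard + (s \ c).ncard := fun s =>
    (Set.ncard_inter_add_ncard_sdiff_eq_ncard s c).symm
  simp only [fixedCount_eq_ncard]
  rw [hsplit {x | shear f i j c i x = x}, hsplit {x | shear f i j c j x = x},
    hsplit {x | f i x = x}, hsplit {x | f j x = x}]
  have h1 : {x | shear f i j c i x = x} ∩ c = {x | f j x = x} ∩ c := by
    ext x
    refine and_congr_left fun hx => ?_
    rw [Set.mem_ofPred_eq, Set.mem_ofPred_eq, shear_left_of_mem hf hi hj hx]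
  have h2 : ({x | shear f i j c j x = x} ∩ c).ncard = ({x | f i x = x} ∩ c).ncard := by
    refine Set.ncard_congr (fun x _ => f j x) ?_ (fun x y _ _ h => (f j).injective h) ?_
    · rintro x ⟨hx, hxc⟩
      refine ⟨?_, hj x hxc⟩
      rw [Set.mem_ofPred_eq, shear_right_of_mem hf hi hj hxc] at hx
      rw [Set.mem_ofPred_eq, ← hf.apply j (f i (f j x)), hx]
    · rintro x ⟨hx, hxc⟩
      refine ⟨f j x, ⟨?_, hj x hxc⟩, hf.apply j x⟩
      rw [Set.mem_ofPred_eq] at hx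
      rw [Set.mem_ofPred_eq, shear_right_of_mem hf hi hj (hj x hxc), hf.apply, hx]
  have h3 : ∀ X, {x | shear f i j c X x = x} \ c = {x | f X x = x} \ c := by
    intro X
    ext x
    refine and_congr_left fun hx => ?_
    rw [Set.mem_ofPred_eq, Set.mem_ofPred_eq, shear_of_notMem hf hi hj hx]
  rw [h1, h2, h3, h3]
  ring

theorem shear_mul_left (hf : Involutive3 f) (hi : ∀ x ∈ c, f i x ∈ c)
    (hj : ∀ x ∈ c, f j x ∈ c) : shear f i j c i * shear f i j c j = f i * f j := by
  ext1 x
  rw [Equiv.Perm.mul_apply, Equiv.Perm.mul_apply]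
  by_cases hx : x ∈ c
  · rw [shear_right_of_mem hf hi hj hx, shear_left_of_mem hf hi hj (hj _ (hi _ (hj x hx))),
      hf.apply]
  · rw [shear_of_notMem hf hi hj hx, shear_of_notMem hf hi hj]
    rwa [invariant_iff hf hj]

theorem shear_mul_right (hf : Involutive3 f) (hi : ∀ x ∈ c, f i x ∈ c)
    (hj : ∀ x ∈ c, f j x ∈ c) : shear f i j c j * shear f i j c i = f j * f i := by
  ext1 x
  rw [Equiv.Perm.mul_apply, Equiv.Perm.mul_apply]
  by_cases hx : x ∈ c
  · rw [shear_left_of_mem hf hi hj hx, shear_right_of_mem hf hi hj (hj x hx), hf.apply]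
  · rw [shear_of_notMem hf hi hj hx, shear_of_notMem hf hi hj]
    rwa [invariant_iff hf hi]

theorem shear_conn (hf : Involutive3 f) (hi : ∀ x ∈ c, f i x ∈ c)
    (hj : ∀ x ∈ c, f j x ∈ c) {x y : Fin n} (h : EqvGen (fun a b => ∃ X, b = f X a) x y) :
    EqvGen (fun a b => ∃ X, b = shear f i j c X a) x y := by
  have he := eqvGen_equivalence fun a b => ∃ X, b = shear f i j c X a
  refine eqvGen_le he ?_ h
  rintro a _ ⟨X, rfl⟩
  have hs : ∀ X a, EqvGen (fun a b => ∃ X, b = shear f i j c X a) a (shear f i j c X a) :=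
    fun X a => EqvGen.rel _ _ ⟨X, rfl⟩
  by_cases ha : a ∈ c
  · by_cases hXi : X = i
    · subst hXi
      have h1 := hs X a
      have h2 := hs j (f j a)
      have h3 := hs X (f j (f X a))
      rw [shear_left_of_mem hf hi hj ha] at h1
      rw [shear_right_of_mem hf hi hj (hj a ha), hf.apply] at h2
      rw [shear_left_of_mem hf hi hj (hj _ (hi _ ha)), hf.apply] at h3
      exact he.trans h1 (he.trans h2 h3)
    by_cases hXj : X = j
    · subst hXj
      have := hs i a
      rwa [shear_left_of_mem hf hi hj ha] at this
    · have := hs X a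
      rwa [shear_of_ne hXi hXj] at this
  · have := hs X a
    rwa [shear_of_notMem hf hi hj ha] at this

theorem isComponent_of_conn (hf : Involutive3 f) (hi : ∀ x ∈ c, f i x ∈ c)
    (hj : ∀ x ∈ c, f j x ∈ c) {v : Fin n} (hv : v ∈ c)
    (hc : ∀ y ∈ c, EqvGen (fun a b => b = f i a ∨ b = f j a) v y) : IsComponent n f i j c := by
  refine ⟨v, ?_⟩
  set H := Subgroup.closure ({f i, f j} : Set (Equiv.Perm (Fin n))) with hH
  ext y
  constructor
  · intro hy
    have he : Equivalence fun a b : Fin n => b ∈ MulAction.orbit H a :=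
      ⟨fun a => MulAction.mem_orbit_self a, fun h => MulAction.mem_orbit_symm.mp h,
        fun h h' => MulAction.mem_orbit_iff.mpr <| by
          obtain ⟨g, rfl⟩ := h
          obtain ⟨g', rfl⟩ := h'
          exact ⟨g' * g, mul_smul _ _ _⟩⟩
    refine eqvGen_le he ?_ (hc y hy)
    rintro a b (rfl | rfl)
    · exact ⟨⟨f i, Subgroup.subset_closure (by simp)⟩, rfl⟩
    · exact ⟨⟨f j, Subgroup.subset_closure (by simp)⟩, rfl⟩
  · rintro ⟨⟨g, hg⟩, rfl⟩
    change g v ∈ c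
    have key : ∀ x, g x ∈ c ↔ x ∈ c := by
      induction hg using Subgroup.closure_induction with
      | mem x hx =>
        rcases hx with rfl | hx
        · exact invariant_iff hf hi
        · rw [Set.mem_singleton_iff.mp hx]
          exact invariant_iff hf hj
      | one => exact fun x => Iff.rfl
      | mul g h _ _ hg hh => exact fun x => (hg _).trans (hh x)
      | inv g _ hg =>
        intro x
        rw [← hg, ← Equiv.Perm.mul_apply, mul_inv_cancel, Equiv.Perm.one_apply]
    exact (key v).mpr hv

theorem isComponent_horiz (hf : Involutive3 f) (x : Fin n) :
    IsComponent n f Color.G Color.B {y | Horiz f x y} := by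
  have he := horiz_equivalence hf
  refine isComponent_of_conn hf (fun y hy => he.trans hy (horiz_green y))
    (fun y hy => he.trans hy (horiz_blue hf y)) (he.refl x) ?_
  have hE := eqvGen_equivalence fun a b => b = f Color.G a ∨ b = f Color.B a
  have hG : ∀ a, EqvGen (fun a b => b = f Color.G a ∨ b = f Color.B a) a (f Color.G a) :=
    fun a => EqvGen.rel _ _ (Or.inl rfl)
  have hs : ∀ {a b}, SameCycle (rot f) a b →
      EqvGen (fun a b => b = f Color.G a ∨ b = f Color.B a) a b := by
    intro a b h
    exact sameCycle_le hE (fun z => hE.trans (EqvGen.rel _ _ (Or.inr rfl)) (hG (f Color.B z))) h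
  rintro y (hy | hy)
  · exact hs hy
  · exact hE.trans (hG x) (hs hy)

end Shear

theorem Spherical.shear_green {n k : ℕ} {f : Surf n} {j : Color} {c : Set (Fin n)}
    (hf : Spherical f k) (hj : j ≠ Color.G) (hic : ∀ x ∈ c, f Color.G x ∈ c)
    (hjc : ∀ x ∈ c, f j x ∈ c) :
    Spherical (shear f Color.G j c) k ∧ prodRGB (shear f Color.G j c) = prodRGB f := by
  have hinv := hf.inv
  have hprod : prodRGB (shear f Color.G j c) = prodRGB f := by
    rw [prodRGB, prodRGB]
    cases j with
    | G => exact absurd rfl hj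
    | R =>
      rw [shear_mul_right hinv hic hjc, shear_of_ne (by decide) (by decide)]
    | B =>
      rw [mul_assoc, mul_assoc, shear_mul_left hinv hic hjc,
        shear_of_ne (by decide) (by decide)]
  have hfix : totalFixed (shear f Color.G j c) = totalFixed f := by
    have := shear_fixedCount hinv hic hjc
    rw [totalFixed, totalFixed]
    cases j with
    | G => exact absurd rfl hj
    | R =>
      rw [shear_of_ne (X := Color.B) (by decide) (by decide)]
      omega
    | B =>
      rw [shear_of_ne (X := Color.R) (by decide) (by decide)]
      omega
  refine ⟨⟨hinv.shear hic hjc, fun x y => shear_conn hinv hic hjc (hf.conn x y), ?_, ?_, ?_⟩,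
    hprod⟩
  · rw [hprod]; exact hf.euler
  · rw [hfix]; exact hf.fixed
  · rw [hprod]; exact hf.pole

theorem MixedSeq.append {n : ℕ} {s t : ℕ} {f g h : Surf n} (h1 : MixedSeq n s f g)
    (h2 : MixedSeq n t g h) : MixedSeq n (s + t) f h := by
  induction s generalizing f with
  | zero => rw [Nat.zero_add]; rw [show f = g from h1]; exact h2
  | succ s ih =>
    obtain ⟨f', hf', h1⟩ := h1
    rw [Nat.succ_add]
    exact ⟨f', hf', ih h1⟩

theorem MixedSeq.single {n : ℕ} {f g : Surf n} (h : VertStep n f g ∨ HorizPowStep n f g) :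
    MixedSeq n 1 f g := ⟨g, h, rfl⟩

/-- Twisting horizontal components: the red involution and the rotation do not change, and the
green one changes only inside cycles of the rotation. -/
structure TwEq {n : ℕ} (f f' : Surf n) : Prop where
  red : f' Color.R = f Color.R
  rot_eq : rot f' = rot f
  green : ∀ y, SameCycle (rot f) (f Color.G y) (f' Color.G y)

namespace TwEq

variable {n : ℕ} {f f' f'' : Surf n}

theorem refl (f : Surf n) : TwEq f f := ⟨rfl, rfl, fun _ => SameCycle.refl _ _⟩

theorem trans (h : TwEq f f') (h' : TwEq f' f'') : TwEq f f'' :=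
  ⟨h'.red.trans h.red, h'.rot_eq.trans h.rot_eq, fun y =>
    (h.green y).trans (h.rot_eq ▸ h'.green y)⟩

theorem oneSided_iff (h : TwEq f f') (x : Fin n) : OneSided f' x ↔ OneSided f x := by
  rw [OneSided, OneSided, h.rot_eq]
  exact ⟨fun k => k.trans (h.green x).symm, fun k => k.trans (h.green x)⟩

theorem horiz_iff (h : TwEq f f') (x y : Fin n) : Horiz f' x y ↔ Horiz f x y := by
  rw [Horiz, Horiz, h.rot_eq]
  exact or_congr Iff.rfl ⟨fun k => (h.green x).trans k, fun k => (h.green x).symm.trans k⟩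

theorem prod_eq (h : TwEq f f') : prodRGB f' = prodRGB f := by
  rw [prodRGB_eq, prodRGB_eq, h.red, h.rot_eq]

theorem oneReps_eq (h : TwEq f f') : oneReps f' = oneReps f := by
  ext x
  simp only [oneReps, Set.mem_ofPred_eq, h.oneSided_iff, h.rot_eq]

end TwEq

/-- Any horizontal component can be twisted so that the green involution exchanges `x` with a
prescribed element `u` of the opposite cycle. -/
theorem Spherical.exists_twist {n k : ℕ} {f : Surf n} (hf : Spherical f k) {x u : Fin n}
    (hu : SameCycle (rot f) (f Color.G x) u) :
    ∃ f', HorizPowStep n f f' ∧ Spherical f' k ∧ TwEq f f' ∧ f' Color.G x = u ∧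
      ∀ y, ¬ Horiz f x y → f' Color.G y = f Color.G y := by
  have hinv := hf.inv
  have he := horiz_equivalence hinv
  set c : Set (Fin n) := {y | Horiz f x y} with hc
  have hcG : ∀ y ∈ c, f Color.G y ∈ c := fun y hy => he.trans hy (horiz_green y)
  have hcB : ∀ y ∈ c, f Color.B y ∈ c := fun y hy => he.trans hy (horiz_blue hinv y)
  have hcρ : ∀ y ∈ c, rot f y ∈ c := fun y hy => hcG _ (hcB _ hy)
  have hcρi : ∀ m : ℕ, ∀ y ∈ c, (rot f ^ m) y ∈ c := by
    intro m
    induction m with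
    | zero => exact fun y hy => hy
    | succ m ih => intro y hy; rw [pow_succ']; exact hcρ _ (ih y hy)
  have key : ∀ m : ℕ, Spherical (shearPow f Color.G Color.B c m) k ∧
      shearPow f Color.G Color.B c m Color.R = f Color.R ∧
      rot (shearPow f Color.G Color.B c m) = rot f ∧
      (∀ y ∈ c, shearPow f Color.G Color.B c m Color.G y = f Color.G ((rot f ^ m) y)) ∧
      (∀ y ∉ c, shearPow f Color.G Color.B c m Color.G y = f Color.G y) := by
    intro m
    induction m with
    | zero => exact ⟨hf, rfl, rfl, fun _ _ => rfl, fun _ _ => rfl⟩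
    | succ m ih =>
      obtain ⟨h1, h2, h3, h4, h5⟩ := ih
      set g := shearPow f Color.G Color.B c m with hg
      have hgB : ∀ y, g Color.B y = g Color.G (rot f y) := fun y => by
        rw [← h3, green_rot h1.inv]
      have hgc : ∀ y ∈ c, g Color.G y ∈ c := fun y hy => by
        rw [h4 y hy]; exact hcG _ (hcρi m y hy)
      have hgc' : ∀ y ∈ c, g Color.B y ∈ c := fun y hy => by
        rw [hgB]; exact hgc _ (hcρ y hy)
      change Spherical (shear g Color.G Color.B c) k ∧ shear g Color.G Color.B c Color.R = _ ∧
        rot (shear g Color.G Color.B c) = _ ∧ (∀ y ∈ c, shear g Color.G Color.B c Color.G y = _) ∧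
        (∀ y ∉ c, shear g Color.G Color.B c Color.G y = _)
      refine ⟨(h1.shear_green (by decide) hgc hgc').1, ?_, ?_, ?_, ?_⟩
      · rw [shear_of_ne (by decide) (by decide), h2]
      · rw [rot, shear_mul_left h1.inv hgc hgc', ← h3, rot]
      · intro y hy
        rw [shear_left_of_mem h1.inv hgc hgc' hy, hgB, h4 _ (hcρ y hy), pow_succ]
        rfl
      · intro y hy
        rw [shear_of_notMem h1.inv hgc hgc' hy, h5 y hy]
  obtain ⟨i, hi⟩ := hu.symm.exists_nat_pow_eq
  set m := i + orderOf (rot f) with hm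
  have hmi : rot f ^ m = rot f ^ i := by rw [hm, pow_add, pow_orderOf_eq_one, mul_one]
  have hpos : 1 ≤ m := (orderOf_pos (rot f)).trans_le (Nat.le_add_left _ _)
  obtain ⟨h1, h2, h3, h4, h5⟩ := key m
  have hrev : ∀ y, (rot f ^ m) (f Color.G ((rot f ^ m) y)) = f Color.G y := fun y =>
    rot_pow_green_rot_pow hinv m y
  refine ⟨shearPow f Color.G Color.B c m,
    ⟨Color.G, Color.B, c, m, rfl, isComponent_horiz hinv x, hpos, rfl⟩, h1, ⟨h2, h3, ?_⟩, ?_, ?_⟩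
  · intro y
    by_cases hy : y ∈ c
    · rw [h4 y hy]
      have : SameCycle (rot f) (f Color.G ((rot f ^ m) y)) (f Color.G y) :=
        ⟨m, by rw [zpow_natCast, hrev]⟩
      exact this.symm
    · rw [h5 y hy]
  · rw [h4 x (he.refl x)]
    have h6 := hrev x
    rw [hmi, ← hi] at h6
    rw [hmi]
    exact (rot f ^ i).injective h6
  · exact fun y hy => h5 y hy

/-! ### Vertical components built step by step -/

theorem eqvGen_mono_rel {α : Type*} {E F : α → α → Prop} (h : ∀ x y, E x y → F x y) {x y : α}
    (hxy : EqvGen E x y) : EqvGen F x y :=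
  eqvGen_le (eqvGen_equivalence F) (fun x y hE => EqvGen.rel x y (h x y hE)) hxy

/-- Representatives of the vertices of angle at least `3π`. -/
def bigReps {n : ℕ} (f : Surf n) : Set (Fin n) :=
  {x | x ∈ minReps (SameCycle (prodRGB f)) ∧ prodRGB f (prodRGB f x) ≠ x}

/-- The number of big vertices on component sides that meet `D`. -/
noncomputable def bigCount {n : ℕ} (f : Surf n) (D : Set (Fin n)) : ℕ :=
  {x | x ∈ bigReps f ∧ ∃ d ∈ D, GenRel (f Color.R) (rot f) d x}.ncard

theorem bigCount_mono {n : ℕ} (f : Surf n) {D D' : Set (Fin n)} (h : D ⊆ D') :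
    bigCount f D ≤ bigCount f D' :=
  Set.ncard_le_ncard fun _ hx => ⟨hx.1, hx.2.imp fun _ hd => ⟨h hd.1, hd.2⟩⟩

theorem TwEq.bigCount_eq {n : ℕ} {f f' : Surf n} (h : TwEq f f') (D : Set (Fin n)) :
    bigCount f' D = bigCount f D := by
  simp only [bigCount, bigReps, h.prod_eq, h.red, h.rot_eq]

/-- A partial vertical component `D` that continues with the square `v`. -/
structure Walk {n : ℕ} (f : Surf n) (D : Set (Fin n)) (v : Fin n) : Prop where
  green : ∀ x ∈ D, f Color.G x ∈ D
  red : ∀ x ∈ D, f Color.R x ∈ D ∨ f Color.R x = v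
  head : f Color.R v ∈ D ∨ f Color.R v = v
  fresh : ∀ x ∈ D, ¬ Horiz f v x
  trans : ∀ x ∈ D, ∀ y ∈ D, Horiz f x y → y = x ∨ y = f Color.G x
  two : ∀ x ∈ D, f Color.G x = x ∨ ¬ OneSided f x
  conn : ∀ x ∈ D, EqvGen (fun a b => a ∈ D ∧ (b = f Color.G a ∨ b = f Color.R a)) v x

/-- A vertical component that crosses every horizontal component at most once. -/
structure VertLoop {n : ℕ} (f : Surf n) (D : Set (Fin n)) : Prop where
  green : ∀ x ∈ D, f Color.G x ∈ D
  red : ∀ x ∈ D, f Color.R x ∈ D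
  trans : ∀ x ∈ D, ∀ y ∈ D, Horiz f x y → y = x ∨ y = f Color.G x
  two : ∀ x ∈ D, f Color.G x = x ∨ ¬ OneSided f x
  conn : ∀ x ∈ D, ∀ y ∈ D, EqvGen (fun a b => b = f Color.G a ∨ b = f Color.R a) x y

/-- The conclusion of the vertical walk. -/
def WalkEnd {n : ℕ} (k : ℕ) (f : Surf n) (D : Set (Fin n)) (v : Fin n) : Prop :=
  ∃ (t : ℕ) (f' : Surf n) (D' : Set (Fin n)),
    Spherical f' k ∧ MixedSeq n t f f' ∧ TwEq f f' ∧ D ⊆ D' ∧ v ∈ D' ∧ VertLoop f' D' ∧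
      (∀ x ∈ D, f' Color.G x = f Color.G x) ∧ t + bigCount f D ≤ bigCount f D' + 1 ∧
      ∃ y ∈ D', y ∉ D ∧ (f Color.R y = y ∨ OneSided f y)

namespace Walk

variable {n k : ℕ} {f : Surf n} {D : Set (Fin n)} {v : Fin n}

theorem notMem (hf : Spherical f k) (hw : Walk f D v) : v ∉ D := fun h =>
  hw.fresh v h ((horiz_equivalence hf.inv).refl v)

theorem avoidRel (hw : Walk f D v) {x : Fin n} (hx : x ∈ D) : AvoidRel f v v x := by
  refine eqvGen_mono_rel ?_ (hw.conn x hx)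
  rintro a b ⟨ha, rfl | rfl⟩
  · exact Or.inr (Or.inr ⟨horiz_green a, hw.fresh a ha⟩)
  · exact Or.inl rfl

/-- Adding the last component of a walk gives a closed vertical component. -/
theorem vertLoop_insert (hf : Spherical f k) (hw : Walk f D v) {f' : Surf n} {u : Fin n}
    (hf' : Spherical f' k) (htw : TwEq f f') (hG : ∀ y ∈ D, f' Color.G y = f Color.G y)
    (hvu : f' Color.G v = u) (hu : f Color.R u = u ∨ u = v)
    (hone : u = v ∨ ¬ OneSided f v) : VertLoop f' (insert v (insert u D)) := by
  have he := horiz_equivalence hf.inv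
  have hHv : Horiz f v u := by rw [← htw.horiz_iff, ← hvu]; exact horiz_green v
  have hGu : f' Color.G u = v := by rw [← hvu, hf'.inv.apply]
  set E := fun a b => b = f' Color.G a ∨ b = f' Color.R a with hE
  have heE := eqvGen_equivalence E
  have hvall : ∀ x ∈ insert v (insert u D), EqvGen E v x := by
    rintro x (rfl | rfl | hx)
    · exact heE.refl _
    · exact EqvGen.rel _ _ (Or.inl hvu.symm)
    · refine eqvGen_mono_rel ?_ (hw.conn x hx)
      rintro a b ⟨ha, h⟩
      change b = f' Color.G a ∨ b = f' Color.R a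
      rwa [hG a ha, htw.red]
  refine ⟨?_, ?_, ?_, ?_, fun x hx y hy => heE.trans (heE.symm (hvall x hx)) (hvall y hy)⟩
  · rintro x (rfl | rfl | hx)
    · rw [hvu]; exact Or.inr (Or.inl rfl)
    · rw [hGu]; exact Or.inl rfl
    · rw [hG x hx]; exact Or.inr (Or.inr (hw.green x hx))
  · have hv : f Color.R v ∈ insert v (insert u D) := by
      rcases hw.head with h | h
      · exact Or.inr (Or.inr h)
      · exact Or.inl h
    rw [htw.red]
    rintro x (rfl | rfl | hx)
    · exact hv
    · rcases hu with h | rfl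
      · rw [h]; exact Or.inr (Or.inl rfl)
      · exact hv
    · rcases hw.red x hx with h | h
      · exact Or.inr (Or.inr h)
      · exact Or.inl h
  · intro x hx y hy h
    rw [htw.horiz_iff] at h
    rcases hx with rfl | rfl | hx <;> rcases hy with rfl | rfl | hy
    · exact Or.inl rfl
    · exact Or.inr hvu.symm
    · exact absurd h (hw.fresh y hy)
    · exact Or.inr hGu.symm
    · exact Or.inl rfl
    · exact absurd (he.trans hHv h) (hw.fresh y hy)
    · exact absurd (he.symm h) (hw.fresh x hx)
    · exact absurd (he.trans hHv (he.symm h)) (hw.fresh x hx)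
    · rw [hG x hx]; exact hw.trans x hx y hy h
  · intro x hx
    rw [htw.oneSided_iff]
    rcases hx with rfl | rfl | hx
    · rcases hone with h | h
      · exact Or.inl (hvu.trans h)
      · exact Or.inr h
    · rcases hone with h | h
      · exact Or.inl (hGu.trans h.symm)
      · exact Or.inr fun h' => h (h'.of_horiz hf.inv (he.symm hHv))
    · rw [hG x hx]; exact hw.two x hx

/-- Continuing a walk through a cyclic component. -/
theorem step (hf : Spherical f k) (hw : Walk f D v) {f' : Surf n} {u : Fin n}
    (hf' : Spherical f' k) (htw : TwEq f f') (hG : ∀ y ∈ D, f' Color.G y = f Color.G y)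
    (hvu : f' Color.G v = u) (hone : ¬ OneSided f v) (hGv : SameCycle (rot f) (f Color.G v) u)
    (hu : ¬ SameCycle (rot f) (f Color.G v) (f Color.R u)) :
    Walk f' (insert v (insert u D)) (f Color.R u) := by
  have he := horiz_equivalence hf.inv
  have hHv : Horiz f v u := Or.inr hGv
  have hGu : f' Color.G u = v := by rw [← hvu, hf'.inv.apply]
  have hK := avoidRel_equivalence f v
  have hKρ : ∀ {a b}, SameCycle (rot f) a b → AvoidRel f v a b := fun h =>
    EqvGen.rel _ _ (Or.inr (Or.inl h))
  have hKu : AvoidRel f v (f Color.R u) (f Color.G v) :=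
    hK.symm (hK.trans (hKρ hGv) (EqvGen.rel _ _ (Or.inl rfl)))
  set E := fun a b => a ∈ insert v (insert u D) ∧ (b = f' Color.G a ∨ b = f' Color.R a) with hE
  have heE := eqvGen_equivalence E
  have hvall : ∀ x ∈ insert v (insert u D), EqvGen E v x := by
    rintro x (rfl | rfl | hx)
    · exact heE.refl _
    · exact EqvGen.rel _ _ ⟨Or.inl rfl, Or.inl hvu.symm⟩
    · refine eqvGen_mono_rel ?_ (hw.conn x hx)
      rintro a b ⟨ha, h⟩
      rw [hE]
      refine ⟨Or.inr (Or.inr ha), ?_⟩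
      rwa [hG a ha, htw.red]
  refine ⟨?_, ?_, ?_, ?_, ?_, ?_, ?_⟩
  · rintro x (rfl | rfl | hx)
    · rw [hvu]; exact Or.inr (Or.inl rfl)
    · rw [hGu]; exact Or.inl rfl
    · rw [hG x hx]; exact Or.inr (Or.inr (hw.green x hx))
  · rw [htw.red]
    rintro x (rfl | rfl | hx)
    · rcases hw.head with h | h
      · exact Or.inl (Or.inr (Or.inr h))
      · exact Or.inl (Or.inl h)
    · exact Or.inr rfl
    · rcases hw.red x hx with h | h
      · exact Or.inl (Or.inr (Or.inr h))
      · exact Or.inl (Or.inl h)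
  · rw [htw.red, hf.inv.apply]
    exact Or.inl (Or.inr (Or.inl rfl))
  · have hv : ¬ Horiz f (f Color.R u) v := by
      intro h
      rcases he.symm h with h | h
      · exact hf.separates hone (hK.trans (hKρ h) hKu)
      · exact hu h
    intro x hx
    rw [htw.horiz_iff]
    rcases hx with rfl | rfl | hx
    · exact hv
    · exact fun h => hv (he.trans h (he.symm hHv))
    · intro h
      refine hf.separates hone (hK.trans (hw.avoidRel hx) (hK.trans ?_ hKu))
      exact EqvGen.rel _ _ (Or.inr (Or.inr ⟨he.symm h, hw.fresh x hx⟩))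
  · intro x hx y hy h
    rw [htw.horiz_iff] at h
    rcases hx with rfl | rfl | hx <;> rcases hy with rfl | rfl | hy
    · exact Or.inl rfl
    · exact Or.inr hvu.symm
    · exact absurd h (hw.fresh y hy)
    · exact Or.inr hGu.symm
    · exact Or.inl rfl
    · exact absurd (he.trans hHv h) (hw.fresh y hy)
    · exact absurd (he.symm h) (hw.fresh x hx)
    · exact absurd (he.trans hHv (he.symm h)) (hw.fresh x hx)
    · rw [hG x hx]; exact hw.trans x hx y hy h
  · intro x hx
    rw [htw.oneSided_iff]
    rcases hx with rfl | rfl | hx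
    · exact Or.inr hone
    · exact Or.inr fun h' => hone (h'.of_horiz hf.inv (he.symm hHv))
    · rw [hG x hx]; exact hw.two x hx
  · intro x hx
    refine heE.trans (heE.symm (heE.trans (hvall u (Or.inr (Or.inl rfl))) ?_)) (hvall x hx)
    exact EqvGen.rel _ _ ⟨Or.inr (Or.inl rfl), Or.inr (by rw [htw.red])⟩

theorem walkEnd_of_step (hf : Spherical f k) (hw : Walk f D v) {f' : Surf n} {u : Fin n} {s : ℕ}
    (hf' : Spherical f' k) (hs : MixedSeq n s f f') (htw : TwEq f f')
    (hG : ∀ y ∈ D, f' Color.G y = f Color.G y)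
    (hvu : f' Color.G v = u) (hone : ¬ OneSided f v) (hGv : SameCycle (rot f) (f Color.G v) u)
    (hu : ¬ SameCycle (rot f) (f Color.G v) (f Color.R u))
    (hcost : s + bigCount f D ≤ bigCount f (insert v (insert u D)))
    (ih : ∀ v', Walk f' (insert v (insert u D)) v' → WalkEnd k f' (insert v (insert u D)) v') :
    WalkEnd k f D v := by
  have hw' := hw.step hf hf' htw hG hvu hone hGv hu
  obtain ⟨t, f'', D', h1, h2, h3, h4, -, h6, h7, h8, y, hy, hyD, h9⟩ := ih _ hw'
  rw [htw.bigCount_eq, htw.bigCount_eq] at h8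
  rw [htw.red, htw.oneSided_iff] at h9
  refine ⟨s + t, f'', D', h1, hs.append h2, htw.trans h3,
    fun x hx => h4 (Or.inr (Or.inr hx)), h4 (Or.inl rfl), h6,
    fun x hx => (h7 x (Or.inr (Or.inr hx))).trans (hG x hx), by omega, y, hy,
    fun h => hyD (Or.inr (Or.inr h)), h9⟩

theorem walkEnd (N : ℕ) : ∀ (f : Surf n) (D : Set (Fin n)) (v : Fin n), Spherical f k →
    Walk f D v → n ≤ D.ncard + N → WalkEnd k f D v := by
  induction N with
  | zero =>
    intro f D v hf hw hN
    have h1 : D.ncard < (Set.univ : Set (Fin n)).ncard :=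
      Set.ncard_lt_ncard ⟨Set.subset_univ _, fun h => hw.notMem hf (h (Set.mem_univ v))⟩
    rw [Set.ncard_univ, Nat.card_eq_fintype_card, Fintype.card_fin] at h1
    omega
  | succ N ih =>
    intro f D v hf hw hN
    have he := horiz_equivalence hf.inv
    have hcard : ∀ u, n ≤ (insert v (insert u D)).ncard + N := by
      intro u
      have h1 : (insert v D).ncard = D.ncard + 1 :=
        Set.ncard_insert_of_notMem (hw.notMem hf)
      have h2 : (insert v D).ncard ≤ (insert v (insert u D)).ncard :=
        Set.ncard_le_ncard (Set.insert_subset_insert (Set.subset_insert _ _))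
      omega
    have hsub : ∀ u, D ⊆ insert v (insert u D) := fun u x hx => Or.inr (Or.inr hx)
    have hfin : ∀ (f' : Surf n) (u : Fin n), HorizPowStep n f f' → Spherical f' k → TwEq f f' →
        (∀ y, ¬ Horiz f v y → f' Color.G y = f Color.G y) → f' Color.G v = u →
        (f Color.R u = u ∨ u = v) → (u = v ∨ ¬ OneSided f v) → Horiz f v u →
        (f Color.R u = u ∨ OneSided f u) → WalkEnd k f D v := by
      intro f' u h1 h2 h3 h4 h5 h6 h7 h8 h9
      have hG : ∀ y ∈ D, f' Color.G y = f Color.G y := fun y hy => h4 y (hw.fresh y hy)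
      have hm := bigCount_mono f (hsub u)
      exact ⟨1, f', insert v (insert u D), h2, MixedSeq.single (Or.inr h1), h3, hsub u, Or.inl rfl,
        hw.vertLoop_insert hf h2 h3 hG h5 h6 h7, hG, by omega, u, Or.inr (Or.inl rfl),
        fun h => hw.fresh u h h8, h9⟩
    by_cases hone : OneSided f v
    · obtain ⟨f', h1, h2, h3, h4, h5⟩ := hf.exists_twist (x := v) (u := v) hone.symm
      exact hfin f' v h1 h2 h3 h5 h4 (Or.inr rfl) (Or.inl rfl) (he.refl v) (Or.inr hone)
    by_cases hB1 : ∃ u, SameCycle (rot f) (f Color.G v) u ∧ f Color.R u = u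
    · obtain ⟨u, hu, hRu⟩ := hB1
      obtain ⟨f', h1, h2, h3, h4, h5⟩ := hf.exists_twist hu
      exact hfin f' u h1 h2 h3 h5 h4 (Or.inl hRu) (Or.inr hone) (Or.inr hu) (Or.inl hRu)
    by_cases hB2 : SameCycle (rot f) (f Color.G v) (f Color.R (f Color.G v))
    · obtain ⟨u, hu, hRu⟩ : ∃ u, SameCycle (rot f) (f Color.G v) u ∧
          ¬ SameCycle (rot f) (f Color.G v) (f Color.R u) := by
        by_contra hcon
        push Not at hcon
        exact hB1 (hf.exists_fixed_of_closed hcon)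
      obtain ⟨f', h1, h2, h3, h4, h5⟩ := hf.exists_twist hu
      refine hw.walkEnd_of_step hf h2 (MixedSeq.single (Or.inr h1)) h3
        (fun y hy => h5 y (hw.fresh y hy)) h4 hone hu hRu ?_ fun v' hw' => ih _ _ _ h2 hw' (hcard u)
      obtain ⟨x, hx1, hx2, hx3⟩ := hf.exists_big hB2 ⟨u, hu, hRu⟩
      have hV := genRel_equivalence (f Color.R) (rot f)
      have hux : GenRel (f Color.R) (rot f) u x := hV.trans (hV.symm (genRel_of_sameCycle hu)) hx3
      rw [add_comm]
      refine Set.ncard_lt_ncard ⟨fun x hx => ⟨hx.1, hx.2.imp fun _ hd => ⟨hsub u hd.1, hd.2⟩⟩,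
        fun h => ?_⟩
      obtain ⟨-, d, hd, hdx⟩ := h ⟨⟨hx1, hx2⟩, u, Or.inr (Or.inl rfl), hux⟩
      have hK := avoidRel_equivalence f v
      refine hf.separates hone (hK.trans (hw.avoidRel hd)
        (avoidRel_of_genRel v (hV.trans hdx (hV.symm hx3))))
    · refine hw.walkEnd_of_step hf hf (s := 0) rfl (TwEq.refl f) (fun _ _ => rfl) rfl hone
        (SameCycle.refl _ _) hB2 ?_ fun v' hw' => ih _ _ _ hf hw' (hcard _)
      have := bigCount_mono f (hsub (f Color.G v))
      omega

end Walk

/-! ### Absorbing horizontal components by a vertical shear -/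

namespace VertLoop

variable {n k : ℕ} {f : Surf n} {D : Set (Fin n)}

theorem vertStep (hf : Spherical f k) (hD : VertLoop f D) {v : Fin n} (hv : v ∈ D) :
    VertStep n f (shear f Color.G Color.R D) :=
  ⟨Color.G, Color.R, D, Set.pair_comm _ _,
    isComponent_of_conn hf.inv hD.green hD.red hv fun y hy => hD.conn v hv y hy, rfl⟩

theorem eq_of_sameCycle (hD : VertLoop f D) {x z : Fin n} (hx : x ∈ D) (hz : z ∈ D)
    (h : SameCycle (rot f) x z) : z = x := by
  rcases hD.trans x hx z hz (Or.inl h) with h1 | h1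
  · exact h1
  · rcases hD.two x hx with h2 | h2
    · exact h1.trans h2
    · rw [h1] at h; exact absurd h h2

theorem horiz_shear (hf : Spherical f k) (hD : VertLoop f D) {x y : Fin n} (hx : x ∈ D)
    (h : Horiz f x y) : Horiz (shear f Color.G Color.R D) x y := by
  set f' := shear f Color.G Color.R D with hf'
  have hs := hf.shear_green (j := Color.R) (by decide) hD.green hD.red
  rw [← hf'] at hs
  have he' := horiz_equivalence hs.1.inv
  have hB : f' Color.B = f Color.B := shear_of_ne (by decide) (by decide)
  have hpow : ∀ i : ℕ, Horiz f' x ((rot f ^ i) x) := by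
    intro i
    induction i with
    | zero => exact he'.refl x
    | succ i ih =>
      by_cases hi : (rot f ^ (i + 1)) x ∈ D
      · rw [hD.eq_of_sameCycle hx hi ⟨(i + 1 : ℕ), by rw [zpow_natCast]⟩]
        exact he'.refl x
      · rw [pow_succ', Equiv.Perm.mul_apply] at hi ⊢
        refine he'.trans ih (he'.trans (horiz_blue hs.1.inv _) ?_)
        have h1 := horiz_green (f := f') (f' Color.B ((rot f ^ i) x))
        rw [hB, show f' Color.G (f Color.B ((rot f ^ i) x)) = _ from
          shear_of_notMem hf.inv hD.green hD.red ?_ _] at h1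
        · rw [hB]; exact h1
        · rw [← invariant_iff hf.inv hD.green]; exact hi
  have hsc : ∀ z, SameCycle (rot f) x z → Horiz f' x z := by
    intro z hz
    obtain ⟨i, rfl⟩ := hz.exists_nat_pow_eq
    exact hpow i
  rcases h with h | h
  · exact hsc y h
  · have h1 := SameCycle_green hf.inv h
    rw [hf.inv.apply] at h1
    have h2 : SameCycle (rot f) x ((rot f)⁻¹ (f Color.G y)) :=
      h1.trans (SameCycle.symm ⟨1, by simp⟩)
    have h3 : f' Color.B ((rot f)⁻¹ (f Color.G y)) = y := by
      rw [hB, ← green_rot hf.inv]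
      simp [hf.inv.apply]
    have h4 := horiz_blue hs.1.inv ((rot f)⁻¹ (f Color.G y))
    rw [h3] at h4
    exact he'.trans (hsc _ h2) h4

theorem horiz_shear_of_mem (hf : Spherical f k) (hD : VertLoop f D) {x y : Fin n} (hx : x ∈ D)
    (hy : y ∈ D) : Horiz (shear f Color.G Color.R D) x y := by
  have hs := hf.shear_green (j := Color.R) (by decide) hD.green hD.red
  have he' := horiz_equivalence hs.1.inv
  have hr : Equivalence fun a b => (a ∈ D ↔ b ∈ D) ∧
      (a ∈ D → Horiz (shear f Color.G Color.R D) a b) :=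
    ⟨fun a => ⟨Iff.rfl, fun _ => he'.refl a⟩,
      fun h => ⟨h.1.symm, fun hb => he'.symm (h.2 (h.1.mpr hb))⟩,
      fun h h' => ⟨h.1.trans h'.1, fun ha => he'.trans (h.2 ha) (h'.2 (h.1.mp ha))⟩⟩
  refine (eqvGen_le hr ?_ (hD.conn x hx y hy)).2 hx
  rintro a b (rfl | rfl)
  · exact ⟨(invariant_iff hf.inv hD.green a).symm,
      fun ha => hD.horiz_shear hf ha (horiz_green a)⟩
  · refine ⟨(invariant_iff hf.inv hD.red a).symm, fun ha => ?_⟩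
    have := horiz_green (f := shear f Color.G Color.R D) a
    rwa [shear_left_of_mem hf.inv hD.green hD.red ha] at this

/-- If the vertical component starts at the end of a path component, then the path component
survives the shear. -/
theorem oneSided_shear (hf : Spherical f k) (hD : VertLoop f D) {a : Fin n} (ha : a ∈ D)
    (hGa : f Color.G a = a) : OneSided (shear f Color.G Color.R D) a := by
  set f' := shear f Color.G Color.R D with hf'
  have hs := hf.shear_green (j := Color.R) (by decide) hD.green hD.red
  have he' := horiz_equivalence hs.1.inv
  have hB : f' Color.B = f Color.B := shear_of_ne (by decide) (by decide)
  have hone := oneSided_of_green_eq hGa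
  suffices h : ∃ e, SameCycle (rot f) a e ∧ (f' Color.G e = e ∨ f' Color.B e = e) by
    obtain ⟨e, hae, h⟩ := h
    have hae' : Horiz f' a e := hD.horiz_shear hf ha (Or.inl hae)
    rcases h with h | h
    · exact (oneSided_of_green_eq h).of_horiz hs.1.inv (he'.symm hae')
    · exact (oneSided_of_blue_eq hs.1.inv h).of_horiz hs.1.inv (he'.symm hae')
  have hends := hone.ncard_ends hf.inv
  by_cases hb : ∃ e, SameCycle (rot f) a e ∧ f Color.B e = e
  · obtain ⟨e, h1, h2⟩ := hb
    exact ⟨e, h1, Or.inr (by rw [hB, h2])⟩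
  · have h0 : {x | SameCycle (rot f) a x ∧ f Color.B x = x} = ∅ := by
      ext x
      simp only [Set.mem_ofPred_eq, Set.mem_empty_iff_false, iff_false]
      exact fun h => hb ⟨x, h⟩
    rw [h0, Set.ncard_empty, add_zero] at hends
    obtain ⟨e, ⟨h1, h2⟩, h3⟩ := Set.exists_ne_of_one_lt_ncard
      (s := {x | SameCycle (rot f) a x ∧ f Color.G x = x}) (by omega) a
    refine ⟨e, h1, Or.inl ?_⟩
    rw [hf', shear_of_notMem hf.inv hD.green hD.red, h2]
    exact fun he => h3 (hD.eq_of_sameCycle ha he h1)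

end VertLoop

/-- The folded edges and path components away from the horizontal component of `p`. -/
noncomputable def endCount {n : ℕ} (f : Surf n) (p : Fin n) : ℕ :=
  {z | f Color.R z = z ∧ ¬ SameCycle (rot f) p z}.ncard +
    {x | x ∈ oneReps f ∧ ¬ SameCycle (rot f) p x}.ncard

/-- The big vertices that are not connected to `p` through one-sided crossings. -/
noncomputable def farCount {n : ℕ} (f : Surf n) (p : Fin n) : ℕ :=
  {x | x ∈ bigReps f ∧ ¬ GenRel (f Color.R) (rot f) p x}.ncard

theorem TwEq.endCount_eq {n : ℕ} {f f' : Surf n} (h : TwEq f f') (p : Fin n) :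
    endCount f' p = endCount f p := by
  simp only [endCount, h.oneReps_eq, h.red, h.rot_eq]

namespace VertLoop

variable {n k : ℕ} {f : Surf n} {D : Set (Fin n)}

/-- The shear along a vertical loop merges all the horizontal components it crosses. -/
theorem shear_potential (hf : Spherical f k) (hD : VertLoop f D) {a p y : Fin n} (ha : a ∈ D)
    (hGa : f Color.G a = a) (hpa : SameCycle (rot f) p a) (hy : y ∈ D)
    (hya : y ≠ a) (hend : f Color.R y = y ∨ OneSided f y) :
    OneSided (shear f Color.G Color.R D) p ∧
      endCount (shear f Color.G Color.R D) p + 1 ≤ endCount f p ∧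
      farCount (shear f Color.G Color.R D) p + bigCount f D ≤ (bigReps f).ncard := by
  set f' := shear f Color.G Color.R D with hf'
  obtain ⟨hs, hprod⟩ := hf.shear_green (j := Color.R) (by decide) hD.green hD.red
  rw [← hf'] at hs hprod
  have he := horiz_equivalence hf.inv
  have he' := horiz_equivalence hs.inv
  have hB : f' Color.B = f Color.B := shear_of_ne (by decide) (by decide)
  have honea : OneSided f' a := hD.oneSided_shear hf ha hGa
  set U := {z | ∃ d ∈ D, Horiz f d z} with hU
  have hDU : ∀ z ∈ D, z ∈ U := fun z hz => ⟨z, hz, he.refl z⟩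
  have hUG : ∀ z, f Color.G z ∈ U ↔ z ∈ U := invariant_iff hf.inv
    fun z ⟨d, hd, h⟩ => ⟨d, hd, he.trans h (horiz_green z)⟩
  have hUB : ∀ z, f Color.B z ∈ U ↔ z ∈ U := invariant_iff hf.inv
    fun z ⟨d, hd, h⟩ => ⟨d, hd, he.trans h (horiz_blue hf.inv z)⟩
  have hUH : ∀ z ∈ U, SameCycle (rot f') a z := fun z ⟨d, hd, h⟩ =>
    honea.sameCycle (he'.trans (hD.horiz_shear_of_mem hf ha hd) (hD.horiz_shear hf hd h))
  have hpU : p ∈ U := ⟨a, ha, Or.inl hpa.symm⟩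
  have hUp : ∀ z ∈ U, SameCycle (rot f') p z := fun z hz => (hUH p hpU).symm.trans (hUH z hz)
  have hpH : ∀ z, SameCycle (rot f) p z → z ∈ U := fun z hz => ⟨a, ha, Or.inl (hpa.symm.trans hz)⟩
  have hoff : ∀ z, z ∉ U → ∀ X, f' X z = f X z := fun z hz X =>
    shear_of_notMem hf.inv hD.green hD.red (fun h => hz (hDU z h)) X
  have hρ : ∀ z, z ∉ U → rot f' z = rot f z ∧ rot f z ∉ U := by
    intro z hz
    have h1 : f Color.B z ∉ U := fun h => hz ((hUB z).mp h)
    rw [rot, rot, Equiv.Perm.mul_apply, Equiv.Perm.mul_apply, hoff z hz, hoff _ h1]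
    exact ⟨rfl, fun h => h1 ((hUG _).mp h)⟩
  have hρi : ∀ z, z ∉ U → ∀ i : ℕ, (rot f' ^ i) z = (rot f ^ i) z ∧ (rot f ^ i) z ∉ U := by
    intro z hz i
    induction i with
    | zero => exact ⟨rfl, hz⟩
    | succ i ih =>
      have := hρ _ ih.2
      rw [pow_succ', pow_succ', Equiv.Perm.mul_apply, Equiv.Perm.mul_apply, ih.1]
      exact this
  have hsc : ∀ z, z ∉ U → ∀ w, SameCycle (rot f') z w ↔ SameCycle (rot f) z w := by
    intro z hz w
    constructor
    · intro h
      obtain ⟨i, rfl⟩ := h.exists_nat_pow_eq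
      exact ⟨i, by rw [zpow_natCast, (hρi z hz i).1]⟩
    · intro h
      obtain ⟨i, rfl⟩ := h.exists_nat_pow_eq
      exact ⟨i, by rw [zpow_natCast, (hρi z hz i).1]⟩
  have hyp : ¬ SameCycle (rot f) p y := fun h =>
    hya (hD.eq_of_sameCycle ha hy (hpa.symm.trans h))
  have hR : {z | f' Color.R z = z ∧ ¬ SameCycle (rot f') p z} ⊆
      {z | f Color.R z = z ∧ ¬ SameCycle (rot f) p z} := by
    rintro z ⟨h1, h2⟩
    have hz : z ∉ U := fun h => h2 (hUp z h)
    exact ⟨by rw [← hoff z hz]; exact h1, fun h => hz (hpH z h)⟩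
  have hO : {x | x ∈ oneReps f' ∧ ¬ SameCycle (rot f') p x} ⊆
      {x | x ∈ oneReps f ∧ ¬ SameCycle (rot f) p x} := by
    rintro z ⟨⟨h0, h1⟩, h2⟩
    have hz : z ∉ U := fun h => h2 (hUp z h)
    refine ⟨⟨fun w hw => h0 w ((hsc z hz w).mpr hw), ?_⟩, fun h => hz (hpH z h)⟩
    rw [OneSided, hsc z hz, hoff z hz] at h1
    exact h1
  refine ⟨honea.of_sameCycle hs.inv (hUH p hpU), ?_, ?_⟩
  · rcases hend with h | h
    · have h1 : {z | f' Color.R z = z ∧ ¬ SameCycle (rot f') p z}.ncard <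
          {z | f Color.R z = z ∧ ¬ SameCycle (rot f) p z}.ncard :=
        Set.ncard_lt_ncard ⟨hR, fun hc =>
          (hc (show y ∈ {z | f Color.R z = z ∧ ¬ SameCycle (rot f) p z} from ⟨h, hyp⟩)).2
            (hUp y (hDU y hy))⟩
      have h2 := Set.ncard_le_ncard hO
      rw [endCount, endCount]
      omega
    · have hcy := sameCycle_cycRep (rot f) y
      have h1 : {x | x ∈ oneReps f' ∧ ¬ SameCycle (rot f') p x}.ncard <
          {x | x ∈ oneReps f ∧ ¬ SameCycle (rot f) p x}.ncard :=
        Set.ncard_lt_ncard ⟨hO, fun hc =>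
          (hc (show cycRep (rot f) y ∈ {x | x ∈ oneReps f ∧ ¬ SameCycle (rot f) p x} from
            ⟨⟨cycRep_mem _ _, h.of_sameCycle hf.inv hcy⟩, fun h => hyp (h.trans hcy.symm)⟩)).2
            (hUp _ ⟨y, hy, Or.inl hcy⟩)⟩
      have h2 := Set.ncard_le_ncard hR
      rw [endCount, endCount]
      omega
  · have hV' := genRel_equivalence (f' Color.R) (rot f')
    have hUV : ∀ z ∈ U, ∀ w ∈ U, GenRel (f' Color.R) (rot f') z w := fun z hz w hw =>
      genRel_of_sameCycle ((hUH z hz).symm.trans (hUH w hw))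
    have hV : ∀ {z w}, GenRel (f Color.R) (rot f) z w → GenRel (f' Color.R) (rot f') z w := by
      intro z w h
      refine eqvGen_le hV' ?_ h
      rintro z w (rfl | rfl)
      · by_cases hz : z ∈ D
        · exact hUV _ (hDU z hz) _ (hDU _ (hD.red z hz))
        · have := genRel_left (f' Color.R) (rot f') z
          rwa [hf', shear_of_notMem hf.inv hD.green hD.red hz, ← hf'] at this
      · by_cases hz : z ∈ U
        · refine hUV z hz _ ?_
          rw [rot, Equiv.Perm.mul_apply, hUG, hUB]
          exact hz
        · have := genRel_right (f' Color.R) (rot f') z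
          rwa [(hρ z hz).1] at this
    rw [farCount, bigCount, ← Set.ncard_union_eq]
    · refine Set.ncard_le_ncard ?_
      rintro x (h | h)
      · have := h.1
        rwa [bigReps, hprod] at this
      · exact h.1
    · rw [Set.disjoint_left]
      rintro x ⟨-, h⟩ ⟨-, d, hd, hdx⟩
      exact h (hV'.trans (hUV p hpU d (hDU d hd)) (hV hdx))

end VertLoop

namespace Spherical

variable {n k : ℕ} {f : Surf n}

/-- One absorption step. -/
theorem exists_absorb (hf : Spherical f k) {p : Fin n} (hp : OneSided f p) {y : Fin n}
    (hy : ¬ SameCycle (rot f) p y) :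
    ∃ t f', MixedSeq n t f f' ∧ Spherical f' k ∧ OneSided f' p ∧
      endCount f' p + 1 ≤ endCount f p ∧ t + farCount f' p ≤ farCount f p + 3 := by
  obtain ⟨a, hpa, hRa⟩ : ∃ a, SameCycle (rot f) p a ∧ ¬ SameCycle (rot f) p (f Color.R a) := by
    by_contra hcon
    push Not at hcon
    have hr : Equivalence fun x y => SameCycle (rot f) p x ↔ SameCycle (rot f) p y :=
      ⟨fun _ => Iff.rfl, fun h => h.symm, fun h h' => h.trans h'⟩
    refine hy ((hf.forall_of_closed hr (fun x => ?_) (fun x => ?_) (fun x => ?_) p y).mp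
      (SameCycle.refl _ _))
    · exact ⟨fun h => h.trans (sameCycle_step _ _), fun h => h.trans (sameCycle_step _ _).symm⟩
    · exact ⟨hcon x, fun h => by simpa only [hf.inv.apply] using hcon _ h⟩
    · refine ⟨fun h => h.trans (hp.of_sameCycle hf.inv h), fun h => ?_⟩
      have h1 := hp.of_sameCycle hf.inv h
      rw [OneSided, hf.inv.apply] at h1
      exact h.trans h1
  have honea := hp.of_sameCycle hf.inv hpa
  obtain ⟨f₁, h1, hf₁, htw, hGa, -⟩ := hf.exists_twist (x := a) (u := a) honea.symm
  have he := horiz_equivalence hf.inv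
  have hw : Walk f₁ {a} (f₁ Color.R a) := by
    refine ⟨?_, ?_, ?_, ?_, ?_, ?_, ?_⟩
    · rintro x rfl; exact hGa
    · rintro x rfl; exact Or.inr rfl
    · exact Or.inl (hf₁.inv.apply _ _)
    · rintro x rfl h
      rw [htw.horiz_iff, htw.red] at h
      exact hRa (hpa.trans (honea.sameCycle (he.symm h)))
    · rintro x rfl y rfl -; exact Or.inl rfl
    · rintro x rfl; exact Or.inl hGa
    · rintro x rfl; exact EqvGen.symm _ _ (EqvGen.rel _ _ ⟨rfl, Or.inr rfl⟩)
  obtain ⟨t, f₂, D, hf₂, h2, htw₂, hD, -, hloop, hG, hcost, y, hyD, hya, hend⟩ :=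
    Walk.walkEnd n f₁ _ _ hf₁ hw (Nat.le_add_left _ _)
  have haD : a ∈ D := hD rfl
  have htw' := htw.trans htw₂
  have hGa₂ : f₂ Color.G a = a := (hG a rfl).trans hGa
  have hend' : f₂ Color.R y = y ∨ OneSided f₂ y := by
    rwa [htw₂.red, htw₂.oneSided_iff]
  obtain ⟨h3, h4, h5⟩ := hloop.shear_potential hf₂ haD hGa₂ (p := p)
    (by rw [htw'.rot_eq]; exact hpa) hyD hya hend'
  refine ⟨1 + t + 1, _, ((MixedSeq.single (Or.inr h1)).append h2).append
    (MixedSeq.single (Or.inl (hloop.vertStep hf₂ haD))),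
    (hf₂.shear_green (by decide) hloop.green hloop.red).1, h3, ?_, ?_⟩
  · rwa [htw'.endCount_eq] at h4
  · rw [htw'.bigCount_eq] at h5
    rw [htw.bigCount_eq, htw.bigCount_eq] at hcost
    have h6 : (bigReps f).ncard ≤ farCount f p + bigCount f {a} := by
      rw [farCount, bigCount]
      refine le_trans (Set.ncard_le_ncard ?_) (Set.ncard_union_le _ _)
      intro x hx
      by_cases h : GenRel (f Color.R) (rot f) p x
      · refine Or.inr ⟨hx, a, rfl, ?_⟩
        have hV := genRel_equivalence (f Color.R) (rot f)
        exact hV.trans (hV.symm (genRel_of_sameCycle hpa)) h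
      · exact Or.inl ⟨hx, h⟩
    have h7 : (bigReps f₂).ncard = (bigReps f).ncard := by rw [bigReps, bigReps, htw'.prod_eq]
    omega

theorem exists_absorb_all (N : ℕ) : ∀ (f : Surf n) (p : Fin n), Spherical f k → OneSided f p →
    endCount f p ≤ N → ∃ t f', MixedSeq n t f f' ∧ Spherical f' k ∧
      (∀ y, SameCycle (rot f') p y) ∧ t ≤ 3 * endCount f p + farCount f p := by
  induction N with
  | zero =>
    intro f p hf hp hN
    by_cases h : ∀ y, SameCycle (rot f) p y
    · exact ⟨0, f, rfl, hf, h, Nat.zero_le _⟩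
    · push Not at h
      obtain ⟨y, hy⟩ := h
      obtain ⟨t, f', -, -, -, h4, -⟩ := hf.exists_absorb hp hy
      omega
  | succ N ih =>
    intro f p hf hp hN
    by_cases h : ∀ y, SameCycle (rot f) p y
    · exact ⟨0, f, rfl, hf, h, Nat.zero_le _⟩
    · push Not at h
      obtain ⟨y, hy⟩ := h
      obtain ⟨t, f', h1, h2, h3, h4, h5⟩ := hf.exists_absorb hp hy
      obtain ⟨t', f'', h6, h7, h8, h9⟩ := ih f' p h2 h3 (by omega)
      exact ⟨t + t', f'', h1.append h6, h7, h8, by omega⟩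

/-- Creating a path component. -/
theorem exists_start (hf : Spherical f k) :
    ∃ t f' p, MixedSeq n t f f' ∧ Spherical f' k ∧ OneSided f' p ∧ t ≤ k := by
  have hk : (bigReps f).ncard + 3 ≤ k := hf.ncard_big_le
  by_cases hG : ∃ z, f Color.G z = z
  · obtain ⟨z, hz⟩ := hG
    exact ⟨0, f, z, rfl, hf, oneSided_of_green_eq hz, Nat.zero_le _⟩
  by_cases hB : ∃ z, f Color.B z = z
  · obtain ⟨z, hz⟩ := hB
    exact ⟨0, f, z, rfl, hf, oneSided_of_blue_eq hf.inv hz, Nat.zero_le _⟩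
  obtain ⟨z, hz⟩ : ∃ z, f Color.R z = z := by
    by_contra hR
    have h0 : ∀ X, ¬ (∃ z, f X z = z) → fixedCount (f X) = 0 := by
      intro X h
      rw [fixedCount, Finset.card_eq_zero, Finset.filter_eq_empty_iff]
      exact fun x _ hx => h ⟨x, hx⟩
    have := hf.fixed
    rw [totalFixed, h0 _ hR, h0 _ hG, h0 _ hB] at this
    omega
  have hw : Walk f ∅ z :=
    ⟨fun _ h => h.elim, fun _ h => h.elim, Or.inr hz, fun _ h => h.elim, fun _ h => h.elim,
      fun _ h => h.elim, fun _ h => h.elim⟩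
  obtain ⟨t, f', D, hf', h1, htw, -, hzD, hloop, -, hcost, -⟩ :=
    Walk.walkEnd n f _ _ hf hw (Nat.le_add_left _ _)
  refine ⟨t + 1, _, z, h1.append (MixedSeq.single (Or.inl (hloop.vertStep hf' hzD))),
    (hf'.shear_green (by decide) hloop.green hloop.red).1, oneSided_of_green_eq ?_, ?_⟩
  · rw [shear_left_of_mem hf'.inv hloop.green hloop.red hzD, htw.red, hz]
  · have h2 : bigCount f D ≤ (bigReps f).ncard := Set.ncard_le_ncard fun x hx => hx.1
    omega

theorem endCount_le (hf : Spherical f k) (p : Fin n) : endCount f p ≤ k := by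
  have h1 := fixedCount_green_add_blue hf.inv
  have h2 := hf.fixed
  have h3 : {z | f Color.R z = z ∧ ¬ SameCycle (rot f) p z}.ncard ≤ fixedCount (f Color.R) := by
    rw [fixedCount_eq_ncard]
    exact Set.ncard_le_ncard fun x hx => hx.1
  have h4 : {x | x ∈ oneReps f ∧ ¬ SameCycle (rot f) p x}.ncard ≤ (oneReps f).ncard :=
    Set.ncard_le_ncard fun x hx => hx.1
  rw [totalFixed] at h2
  rw [endCount]
  omega

theorem exists_path (hf : Spherical f k) :
    ∃ t f' p, MixedSeq n t f f' ∧ Spherical f' k ∧ (∀ y, SameCycle (rot f') p y) ∧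
      t ≤ 5 * k := by
  obtain ⟨t, f', p, h1, h2, h3, h4⟩ := hf.exists_start
  obtain ⟨t', f'', h5, h6, h7, h8⟩ := exists_absorb_all _ f' p h2 h3 le_rfl
  have h9 := h2.endCount_le p
  have h10 : farCount f' p ≤ (bigReps f').ncard := Set.ncard_le_ncard fun x hx => hx.1
  have h11 : (bigReps f').ncard + 3 ≤ k := h2.ncard_big_le
  exact ⟨t + t', f'', p, h1.append h5, h6, h7, by omega⟩

end Spherical

/-! ### Profiles -/

theorem numClasses_sameCycle {n : ℕ} (σ : Equiv.Perm (Fin n)) :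
    numClasses (SameCycle σ) = fixedCount σ + σ.cycleType.card := by
  have h1 := (Set.ncard_inter_add_ncard_sdiff_eq_ncard (minReps (SameCycle σ)) {x | σ x = x}).symm
  rw [numClasses, h1, fixedCount_eq_ncard]
  congr 1
  · congr 1
    refine Set.inter_eq_right.mpr fun x hx y hy => ?_
    obtain ⟨i, rfl⟩ := hy.exists_nat_pow_eq
    rw [Equiv.Perm.pow_apply_eq_self_of_apply_eq_self hx]
  · rw [Equiv.Perm.cycleType_def, Multiset.card_map, ← Finset.card_def, ← Set.ncard_coe_finset]
    refine Set.ncard_congr (fun x _ => σ.cycleOf x) ?_ ?_ ?_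
    · rintro x ⟨-, hx⟩
      exact Equiv.Perm.cycleOf_mem_cycleFactorsFinset_iff.mpr (Equiv.Perm.mem_support.mpr hx)
    · rintro x y ⟨hx, hx'⟩ ⟨hy, -⟩ hxy
      refine eq_of_mem_minReps (sameCycle_equivalence σ) hx hy ?_
      have h3 : x ∈ (σ.cycleOf x).support := by
        rw [Equiv.Perm.mem_support_cycleOf_iff]
        exact ⟨SameCycle.refl _ _, Equiv.Perm.mem_support.mpr hx'⟩
      rw [hxy, Equiv.Perm.mem_support_cycleOf_iff] at h3
      exact h3.1.symm
    · intro c hc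
      obtain ⟨x, hx⟩ := (Equiv.Perm.mem_cycleFactorsFinset_iff.mp hc).1.nonempty_support
      have hcx : c = σ.cycleOf x := Equiv.Perm.cycle_is_cycleOf hx hc
      have hxσ : x ∈ σ.support := Equiv.Perm.mem_cycleFactorsFinset_support_le hc hx
      have hs := sameCycle_cycRep σ x
      refine ⟨cycRep σ x, ⟨cycRep_mem σ x, fun h => ?_⟩, ?_⟩
      · exact Equiv.Perm.mem_support.mp hxσ (hs.apply_eq_self_iff.mpr h)
      · rw [hcx, hs.cycleOf_eq]

theorem sum_cycleCount {n : ℕ} (hn : 1 ≤ n) (σ : Equiv.Perm (Fin n)) :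
    (∑ i ∈ Finset.Icc 1 n, (cycleCount σ i : ℤ) * ((i : ℤ) - 2)) =
      n - 2 * (numClasses (SameCycle σ) : ℤ) := by
  have h1 : ∀ i, (cycleCount σ i : ℤ) =
      (σ.cycleType.count i : ℤ) + if i = 1 then (fixedCount σ : ℤ) else 0 := by
    intro i
    rw [cycleCount]
    split_ifs with h
    · have : σ.cycleType.count i = 0 := by
        rw [Multiset.count_eq_zero]
        intro hi
        have := Equiv.Perm.two_le_of_mem_cycleType hi
        omega
      rw [this]; simp
    · simp
  have h2 : (∑ i ∈ Finset.Icc 1 n, (σ.cycleType.count i : ℤ) * ((i : ℤ) - 2)) =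
      (σ.cycleType.map fun i : ℕ => (i : ℤ) - 2).sum := by
    rw [Finset.sum_multiset_map_count]
    symm
    refine Finset.sum_subset_zero_on_sdiff ?_ ?_ ?_
    · intro i hi
      rw [Multiset.mem_toFinset] at hi
      have h3 := Equiv.Perm.two_le_of_mem_cycleType hi
      have h4 : i ≤ σ.support.card := Equiv.Perm.le_card_support_of_mem_cycleType hi
      have h5 : σ.support.card ≤ n := by simpa using Finset.card_le_univ σ.support
      rw [Finset.mem_Icc]
      omega
    · intro i hi
      rw [Finset.mem_sdiff, Multiset.mem_toFinset] at hi
      rw [Multiset.count_eq_zero.mpr hi.2]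
      simp
    · intro i _
      simp
  have h3 : (σ.cycleType.map fun i : ℕ => (i : ℤ) - 2).sum =
      (σ.cycleType.sum : ℤ) - 2 * σ.cycleType.card := by
    rw [Multiset.sum_map_sub, Multiset.map_const', Multiset.sum_replicate]
    congr 1
    · rw [← Nat.cast_multiset_sum]
    · simp [mul_comm]
  have h4 : fixedCount σ + σ.support.card = n := by
    have := Finset.card_filter_add_card_filter_not (s := (Finset.univ : Finset (Fin n)))
      (fun x => σ x = x)
    rw [Finset.card_univ, Fintype.card_fin] at this
    exact this
  have h5 : (∑ i ∈ Finset.Icc 1 n, (if i = 1 then (fixedCount σ : ℤ) else 0) * ((i : ℤ) - 2)) =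
      - (fixedCount σ : ℤ) := by
    rw [Finset.sum_eq_single 1]
    · simp
    · intro i _ hi
      simp [hi]
    · intro h
      exact absurd (Finset.mem_Icc.mpr ⟨le_rfl, hn⟩) h
  simp only [h1, add_mul, Finset.sum_add_distrib]
  rw [h2, h3, h5, numClasses_sameCycle, Equiv.Perm.sum_cycleType]
  push_cast
  have h6 : (fixedCount σ : ℤ) + σ.support.card = n := by exact_mod_cast h4
  linarith

theorem IsSTS.spherical {n : ℕ} {τ : Surf n} {μ : ℕ → ℕ} {k : ℕ} (h : IsSTS n τ)
    (hp : HasProfile τ μ k)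
    (hs : (∑ i ∈ Finset.Icc 1 n, (μ i : ℤ) * ((i : ℤ) - 2)) = (k : ℤ) - 4) (h1 : μ 1 ≤ 1) :
    Spherical τ k := by
  obtain ⟨hn, hinv, hconn⟩ := h
  have hE := eqvGen_equivalence fun a b => ∃ X, b = τ X a
  refine ⟨hinv, fun x y => ?_, ?_, hp.2, ?_⟩
  · obtain ⟨g, hg, rfl⟩ := hconn x y
    clear hconn
    induction hg using Subgroup.closure_induction generalizing x with
    | mem g hg =>
      rcases hg with rfl | rfl | rfl
      · exact EqvGen.rel _ _ ⟨_, rfl⟩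
      · exact EqvGen.rel _ _ ⟨_, rfl⟩
      · exact EqvGen.rel _ _ ⟨_, rfl⟩
    | one => exact hE.refl x
    | mul g h _ _ hg hh => exact hE.trans (hh x) (hg (h x))
    | inv g _ hg =>
      have := hg (g⁻¹ x)
      rw [← Equiv.Perm.mul_apply, mul_inv_cancel, Equiv.Perm.one_apply] at this
      exact hE.symm this
  · have h2 := sum_cycleCount hn (prodRGB τ)
    rw [Finset.sum_congr rfl fun i hi => by rw [hp.1 i (Finset.mem_Icc.mp hi).1], hs] at h2
    omega
  · have := hp.1 1 le_rfl
    rw [cycleCount, if_pos rfl, fixedCount_eq_ncard] at this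
    omega

theorem Spherical.isPathLike {n k : ℕ} {f : Surf n} (hf : Spherical f k) {p : Fin n}
    (hp : ∀ y, SameCycle (rot f) p y) : IsPathLike n f := by
  constructor
  · intro x y
    obtain ⟨i, hi⟩ := (hp x).symm.trans (hp y)
    refine ⟨rot f ^ i, Subgroup.zpow_mem _ (Subgroup.mul_mem _ ?_ ?_) i, hi⟩
    · exact Subgroup.subset_closure (by simp)
    · exact Subgroup.subset_closure (by simp)
  · have h := OneSided.ncard_ends hf.inv (z := p) (hp _)
    simp only [hp, true_and] at h
    rw [fixedCount_eq_ncard, fixedCount_eq_ncard, h]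

/-- There is a constant `C > 0` such that every square-tiled surface
with spherical profile `(μ, k)` satisfying `μ_1 ≤ 1` can be transformed into a
path-like square-tiled surface by at most `C·k` operations, each a single vertical
cylinder shear or a power of a horizontal cylinder shear. -/
theorem stmt13 :
    ∃ C : ℕ, 0 < C ∧
      ∀ (n : ℕ) (τ : Surf n) (μ : ℕ → ℕ) (k : ℕ),
        IsSTS n τ → HasProfile τ μ k →
        (∑ i ∈ Finset.Icc 1 n, (μ i : ℤ) * ((i : ℤ) - 2)) = (k : ℤ) - 4 →
        μ 1 ≤ 1 →
        ∃ (L : ℕ) (τ' : Surf n), L ≤ C * k ∧ MixedSeq n L τ τ' ∧ IsPathLike n τ' := by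
  refine ⟨5, by norm_num, fun n τ μ k h hp hs h1 => ?_⟩
  obtain ⟨t, τ', p, h2, h3, h4, h5⟩ := (h.spherical hp hs h1).exists_path
  exact ⟨t, τ', h5, h2, h3.isPathLike h4⟩
end

section
/- Let g ≥ 2, μ_2 ≥ 0, and let μ be [2^{μ_2}, 4g−2] or [2^{μ_2}, (2g)^2]. Then there exist two square-tiled surfaces τ and τ' in ST^hyp_Ab(μ) such that every sequence of powers of cylinder shears transforming τ into a square-tiled surface isomorphic to τ' has length at least g−2. -/
/-- Collapses `v - 1`, `v` and `v + 1` to a single value and translates everything above. -/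
def squash (v y : ℤ) : ℤ := min y (max (v - 1) (y - 2))

theorem squash_eq {v y z : ℤ} (hy : |y - v| ≤ 1) (hz : |z - v| ≤ 1) :
    squash v y = squash v z := by
  rw [abs_le] at hy hz
  simp only [squash]
  omega

theorem abs_squash_sub_le {v y z : ℤ} (h : |y - z| ≤ 1) :
    |squash v y - squash v z| ≤ 1 := by
  rw [abs_le] at *
  simp only [squash]
  omega

theorem sub_two_le_squash_sub {D v y z : ℤ} (h : D ≤ y - z) :
    D - 2 ≤ squash v y - squash v z := by
  simp only [squash]
  omega

/-- There are two integer heights, one constant on `{R,G}`-components and the other on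
`{G,B}`-components, which differ by at most one everywhere, the second of which takes two
values at distance at least `D`. -/
def HasSpread {n : ℕ} (f : Surf n) (D : ℤ) : Prop :=
  ∃ p q : Fin n → ℤ,
    ((∀ x, p (f Color.R x) = p x) ∧ ∀ x, p (f Color.G x) = p x) ∧
    ((∀ x, q (f Color.G x) = q x) ∧ ∀ x, q (f Color.B x) = q x) ∧
    (∀ x, |p x - q x| ≤ 1) ∧ ∃ x y, D ≤ q x - q y

theorem restrictPerm_apply_of_notMem {α : Type*} (σ : Equiv.Perm α) {c : Set α} {x : α}
    (hx : x ∉ c) : restrictPerm σ c x = x := by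
  unfold restrictPerm
  split_ifs <;> simp [hx]

theorem restrictPerm_apply_mem {α : Type*} (σ : Equiv.Perm α) {c : Set α} {x : α}
    (hx : x ∈ c) : restrictPerm σ c x ∈ c := by
  unfold restrictPerm
  split_ifs with h
  · simpa [hx] using (h x).2 hx
  · simpa using hx

theorem shearPow_apply_of_ne {n : ℕ} (f : Surf n) {i j X : Color} (c : Set (Fin n)) (m : ℕ)
    (hi : X ≠ i) (hj : X ≠ j) : shearPow f i j c m X = f X := by
  induction m with
  | zero => rfl
  | succ m ih => simp [shearPow, shear, hi, hj, ih]

theorem shearPow_apply_of_notMem {n : ℕ} (f : Surf n) (i j X : Color) {c : Set (Fin n)} (m : ℕ)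
    {x : Fin n} (hx : x ∉ c) : shearPow f i j c m X x = f X x := by
  induction m with
  | zero => rfl
  | succ m ih =>
    simp only [shearPow, shear]
    split_ifs
    · simp [restrictPerm_apply_of_notMem _ hx, ih]
    · exact ih

theorem shearPow_apply_mem {n : ℕ} (f : Surf n) (i j X : Color) {c : Set (Fin n)} (m : ℕ)
    (hX : ∀ x ∈ c, f X x ∈ c) {x : Fin n} (hx : x ∈ c) : shearPow f i j c m X x ∈ c := by
  induction m generalizing x with
  | zero => exact hX x hx
  | succ m ih =>
    simp only [shearPow, shear]
    split_ifs
    · exact ih (restrictPerm_apply_mem _ (restrictPerm_apply_mem _ hx))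
    · exact ih hx

theorem apply_eq_of_mem_closure {α β : Type*} {S : Set (Equiv.Perm α)} {u : α → β}
    (hu : ∀ s ∈ S, ∀ x, u (s x) = u x) {p : Equiv.Perm α} (hp : p ∈ Subgroup.closure S) (x : α) :
    u (p x) = u x := by
  induction hp using Subgroup.closure_induction generalizing x with
  | mem s hs => exact hu s hs x
  | one => rfl
  | mul s t _ _ hs ht => rw [Equiv.Perm.mul_apply, hs, ht]
  | inv s _ hs => rw [← hs (s⁻¹ x)]; simp

theorem squash_shearPow {n : ℕ} {f : Surf n} {i j X : Color} {c : Set (Fin n)} {m : ℕ}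
    {u : Fin n → ℤ} {v : ℤ} (hu : ∀ x, u (f X x) = u x)
    (hX : (∀ x ∈ c, f X x ∈ c) ∧ (∀ x ∈ c, |u x - v| ≤ 1) ∨ X ≠ i ∧ X ≠ j) (x : Fin n) :
    squash v (u (shearPow f i j c m X x)) = squash v (u x) := by
  rcases hX with ⟨hc, hv⟩ | ⟨hi, hj⟩
  · by_cases hx : x ∈ c
    · exact squash_eq (hv _ (shearPow_apply_mem f i j X m hc hx)) (hv _ hx)
    · rw [shearPow_apply_of_notMem f i j X m hx, hu]
  · rw [shearPow_apply_of_ne f c m hi hj, hu]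

theorem IsComponent.apply_mem {n : ℕ} {f : Surf n} {i j : Color} {c : Set (Fin n)}
    (hc : IsComponent n f i j c) {X : Color} (hX : X = i ∨ X = j) {x : Fin n} (hx : x ∈ c) :
    f X x ∈ c := by
  obtain ⟨y, rfl⟩ := hc
  have hmem : f X ∈ Subgroup.closure ({f i, f j} : Set (Equiv.Perm (Fin n))) :=
    Subgroup.subset_closure (by rcases hX with rfl | rfl <;> simp)
  exact MulAction.mem_orbit_of_mem_orbit
    (⟨f X, hmem⟩ : ↥(Subgroup.closure ({f i, f j} : Set (Equiv.Perm (Fin n))))) hx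

theorem IsComponent.exists_eq {n : ℕ} {f : Surf n} {i j : Color} {c : Set (Fin n)}
    (hc : IsComponent n f i j c) {u : Fin n → ℤ} (hi : ∀ x, u (f i x) = u x)
    (hj : ∀ x, u (f j x) = u x) : ∃ v, ∀ x ∈ c, u x = v := by
  obtain ⟨y, rfl⟩ := hc
  refine ⟨u y, ?_⟩
  rintro _ ⟨⟨p, hp⟩, rfl⟩
  exact apply_eq_of_mem_closure (by simpa using ⟨hi, hj⟩) hp y

theorem HasSpread.step {n : ℕ} {f f' : Surf n} {D : ℤ} (h : HasSpread f D)
    (hs : ShearPowStep n f f') : HasSpread f' (D - 2) := by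
  obtain ⟨p, q, ⟨hpR, hpG⟩, ⟨hqG, hqB⟩, hpq, x, y, hxy⟩ := h
  obtain ⟨i, j, c, m, hij, hc, -, rfl⟩ := hs
  suffices ∃ v : ℤ, (∀ X, X ≠ Color.B →
        (∀ x ∈ c, f X x ∈ c) ∧ (∀ x ∈ c, |p x - v| ≤ 1) ∨ X ≠ i ∧ X ≠ j) ∧
      ∀ X, X ≠ Color.R →
        (∀ x ∈ c, f X x ∈ c) ∧ (∀ x ∈ c, |q x - v| ≤ 1) ∨ X ≠ i ∧ X ≠ j by
    obtain ⟨v, hp, hq⟩ := this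
    exact ⟨fun x => squash v (p x), fun x => squash v (q x),
      ⟨squash_shearPow hpR (hp _ (by decide)), squash_shearPow hpG (hp _ (by decide))⟩,
      ⟨squash_shearPow hqG (hq _ (by decide)), squash_shearPow hqB (hq _ (by decide))⟩,
      fun x => abs_squash_sub_le (hpq x), x, y, sub_two_le_squash_sub hxy⟩
  have hmem : ∀ X, (∀ x ∈ c, f X x ∈ c) ∨ X ≠ i ∧ X ≠ j := fun X => by
    by_cases hX : X = i ∨ X = j
    · exact Or.inl fun x hx => hc.apply_mem hX hx
    · exact Or.inr (not_or.1 hX)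
  have key : ∀ v : ℤ, (∀ x ∈ c, p x = v) ∨ (∀ x ∈ c, q x = v) →
      (∀ x ∈ c, |p x - v| ≤ 1) ∧ ∀ x ∈ c, |q x - v| ≤ 1 := by
    rintro v (h | h) <;> refine ⟨fun x hx => ?_, fun x hx => ?_⟩ <;> have h1 := hpq x <;>
      rw [← h x hx] <;> simp [abs_sub_comm] <;> simpa [abs_sub_comm] using h1
  obtain ⟨v, hv⟩ : ∃ v : ℤ, (∀ x ∈ c, p x = v) ∨ (∀ x ∈ c, q x = v) := by
    rcases hij with h | h <;> rw [Set.pair_eq_pair_iff] at h <;>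
      rcases h with ⟨rfl, rfl⟩ | ⟨rfl, rfl⟩
    · exact (hc.exists_eq hpR hpG).imp fun _ => Or.inl
    · exact (hc.exists_eq hpG hpR).imp fun _ => Or.inl
    · exact (hc.exists_eq hqG hqB).imp fun _ => Or.inr
    · exact (hc.exists_eq hqB hqG).imp fun _ => Or.inr
  obtain ⟨hp, hq⟩ := key v hv
  exact ⟨v, fun X _ => (hmem X).imp_left fun h => ⟨h, hp⟩,
    fun X _ => (hmem X).imp_left fun h => ⟨h, hq⟩⟩

theorem HasSpread.le_of_shearPowSeq {n L : ℕ} {f f'' τ' : Surf n} {D : ℤ} (h : HasSpread f D)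
    (hs : ShearPowSeq n L f f'') (hiso : Isomorphic n τ' f'')
    (htrans : ∀ x y : Fin n,
      ∃ p ∈ Subgroup.closure ({τ' Color.G, τ' Color.B} : Set (Equiv.Perm (Fin n))), p x = y) :
    D ≤ 2 * L := by
  induction L generalizing f D with
  | zero =>
    obtain rfl : f = f'' := hs
    obtain ⟨σ, hσ⟩ := hiso
    obtain ⟨p, q, -, ⟨hqG, hqB⟩, -, x, y, hxy⟩ := h
    obtain ⟨s, hs, hsxy⟩ := htrans (σ⁻¹ y) (σ⁻¹ x)
    have hconj : ∀ X, (∀ x, q (f X x) = q x) → ∀ x, (q ∘ σ) (τ' X x) = (q ∘ σ) x := by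
      intro X hX x
      have := hX (σ x)
      rw [hσ X] at this
      simpa using this
    have := apply_eq_of_mem_closure (u := q ∘ σ)
      (by simpa using ⟨hconj _ hqG, hconj _ hqB⟩) hs (σ⁻¹ y)
    rw [hsxy] at this
    simp at this
    simp [this] at hxy
    simpa using hxy
  | succ L ih =>
    obtain ⟨f', hstep, hs⟩ := hs
    have := ih (h.step hstep) hs
    push_cast
    linarith

theorem support_cycleOf_card {n : ℕ} (f : Equiv.Perm (Fin n)) {x : Fin n} (hx : f x ≠ x) :
    (f.cycleOf x).support.card = Function.minimalPeriod f x := by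
  have hcyc := Equiv.Perm.isCycle_cycleOf f hx
  have hx' : f.cycleOf x x ≠ x := by rwa [Equiv.Perm.cycleOf_apply_self]
  have key : ∀ k : ℕ, (f.cycleOf x).support.card ∣ k ↔ Function.minimalPeriod f x ∣ k := by
    intro k
    rw [← hcyc.orderOf, orderOf_dvd_iff_pow_eq_one, ← Function.isPeriodicPt_iff_minimalPeriod_dvd,
      hcyc.pow_eq_one_iff' hx', Equiv.Perm.cycleOf_pow_apply_self, Function.IsPeriodicPt,
      Function.IsFixedPt, Equiv.Perm.iterate_eq_pow]
  exact Nat.dvd_antisymm ((key _).2 dvd_rfl) ((key _).1 dvd_rfl)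

/-- Every cycle of length `i` consists of `i` points of minimal period `i`. -/
theorem mul_cycleCount {n : ℕ} (f : Equiv.Perm (Fin n)) {i : ℕ} (hi : 1 ≤ i) :
    i * cycleCount f i = (Finset.univ.filter fun x => Function.minimalPeriod f x = i).card := by
  unfold cycleCount
  split_ifs with h1
  · subst h1
    simp only [fixedCount, one_mul, Function.minimalPeriod_eq_one_iff_isFixedPt]
    rfl
  · have hfix : ∀ x, Function.minimalPeriod f x = i → f x ≠ x := by
      rintro x hx hfx
      exact h1 (hx ▸ Function.minimalPeriod_eq_one_iff_isFixedPt.2 hfx)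
    have hset : (Finset.univ.filter fun x => Function.minimalPeriod f x = i) =
        (f.cycleFactorsFinset.filter fun s => s.support.card = i).biUnion
          fun s => s.support := by
      ext x
      simp only [Finset.mem_filter, Finset.mem_univ, true_and, Finset.mem_biUnion]
      constructor
      · intro hx
        have hfx := hfix x hx
        refine ⟨f.cycleOf x, ⟨Equiv.Perm.cycleOf_mem_cycleFactorsFinset_iff.2
          (Equiv.Perm.mem_support.2 hfx), by rw [support_cycleOf_card f hfx, hx]⟩, ?_⟩
        rw [Equiv.Perm.mem_support, Equiv.Perm.cycleOf_apply_self]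
        exact hfx
      · rintro ⟨s, ⟨hs, hcard⟩, hxs⟩
        have hfx : f x ≠ x := Equiv.Perm.mem_support.1
          (Equiv.Perm.mem_cycleFactorsFinset_support_le hs hxs)
        rw [← support_cycleOf_card f hfx, ← Equiv.Perm.cycle_is_cycleOf hxs hs, hcard]
    rw [hset, Finset.card_biUnion, Finset.sum_congr rfl (g := fun _ => i), Finset.sum_const,
      smul_eq_mul, mul_comm, Equiv.Perm.cycleType_def, Multiset.count_map]
    · congr 2
      rw [Finset.filter_val]
      exact Multiset.filter_congr fun s _ => eq_comm
    · intro s hs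
      exact (Finset.mem_filter.1 hs).2
    · intro s hs t ht hst
      exact (Equiv.Perm.cycleFactorsFinset_pairwise_disjoint f (Finset.mem_filter.1 hs).1
        (Finset.mem_filter.1 ht).1 hst).disjoint_support

section DoubleCover

variable {m n : ℕ} (e : Fin m × Bool ≃ Fin n)

/-- The lift of a permutation to the double cover which exchanges the two sheets. -/
def sheetSwap (σ : Equiv.Perm (Fin m)) : Equiv.Perm (Fin n) :=
  e.permCongr (Equiv.prodCongr σ Equiv.boolNot)

@[simp]
theorem sheetSwap_apply (σ : Equiv.Perm (Fin m)) (x : Fin m) (b : Bool) :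
    sheetSwap e σ (e (x, b)) = e (σ x, !b) := by
  simp [sheetSwap]

theorem forall_cover {P : Fin n → Prop} : (∀ x, P x) ↔ ∀ x b, P (e (x, b)) := by
  rw [← e.forall_congr_right, Prod.forall]

theorem sheetSwap_mul_mul (σ₁ σ₂ σ₃ : Equiv.Perm (Fin m)) :
    sheetSwap e σ₁ * sheetSwap e σ₂ * sheetSwap e σ₃ = sheetSwap e (σ₁ * σ₂ * σ₃) := by
  ext1 x
  revert x
  rw [forall_cover e]
  simp

theorem sheetSwap_ne (σ : Equiv.Perm (Fin m)) (x : Fin n) : sheetSwap e σ x ≠ x := by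
  revert x
  rw [forall_cover e]
  simp

theorem sheetSwap_iterate (σ : Equiv.Perm (Fin m)) (k : ℕ) (x : Fin m) (b : Bool) :
    (sheetSwap e σ)^[k] (e (x, b)) = e (σ^[k] x, Bool.not^[k] b) := by
  induction k with
  | zero => rfl
  | succ k ih => simp only [Function.iterate_succ_apply', ih, sheetSwap_apply]

theorem not_iterate_eq_self {k : ℕ} {b : Bool} : Bool.not^[k] b = b ↔ 2 ∣ k := by
  rcases Nat.even_or_odd k with h | h
  · simp [Bool.involutive_not.iterate_even h, h.two_dvd]
  · rw [Bool.involutive_not.iterate_odd h]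
    simpa using Nat.odd_iff.1 h

theorem minimalPeriod_sheetSwap (σ : Equiv.Perm (Fin m)) (x : Fin m) (b : Bool) :
    Function.minimalPeriod (sheetSwap e σ) (e (x, b)) =
      Nat.lcm (Function.minimalPeriod σ x) 2 := by
  have key : ∀ k : ℕ, Function.minimalPeriod (sheetSwap e σ) (e (x, b)) ∣ k ↔
      Nat.lcm (Function.minimalPeriod σ x) 2 ∣ k := by
    intro k
    rw [Nat.lcm_dvd_iff, ← Function.isPeriodicPt_iff_minimalPeriod_dvd,
      ← Function.isPeriodicPt_iff_minimalPeriod_dvd, Function.IsPeriodicPt, Function.IsFixedPt,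
      sheetSwap_iterate, e.apply_eq_iff_eq, Prod.mk_inj, not_iterate_eq_self]
    rfl
  exact Nat.dvd_antisymm ((key _).2 dvd_rfl) ((key _).1 dvd_rfl)

/-- The orientation double cover of a square-tiled surface. -/
def doubleCover (q : Surf m) : Surf n := fun X => sheetSwap e (q X)

theorem prodRGB_doubleCover (q : Surf m) :
    prodRGB (doubleCover e q) = sheetSwap e (prodRGB q) :=
  sheetSwap_mul_mul e _ _ _

theorem fixedCount_sheetSwap (σ : Equiv.Perm (Fin m)) : fixedCount (sheetSwap e σ) = 0 := by
  simp [fixedCount, sheetSwap_ne]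

theorem totalFixed_doubleCover (q : Surf m) : totalFixed (doubleCover e q) = 0 := by
  simp [totalFixed, doubleCover, fixedCount_sheetSwap]

theorem isAbelian_doubleCover (hm : 1 ≤ m) (q : Surf m) : IsAbelian n (doubleCover e q) := by
  refine ⟨{x | (e.symm x).2 = true}, ⟨e (⟨0, hm⟩, true), by simp⟩,
    ⟨e (⟨0, hm⟩, false), by simp⟩, fun X => ?_⟩
  rw [Equiv.image_eq_preimage_symm]
  ext x
  obtain ⟨y, rfl⟩ := (doubleCover e q X).surjective x
  rw [Set.mem_preimage, Equiv.symm_apply_apply]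
  revert y
  rw [forall_cover e]
  simp [doubleCover]

theorem isHyperInvolution_doubleCover {q : Surf m} (hq : IsSTS m q) (hg : genusFour q = -4) :
    IsHyperInvolution (doubleCover e q) (sheetSwap e 1) := by
  refine ⟨fun X => ?_, ?_, fun h => ?_, m, q, hq, ⟨fun x => (e.symm x).1, fun y => ?_, ?_, ?_⟩,
    hg⟩
  · ext1 x
    revert x
    rw [forall_cover e]
    simp [doubleCover]
  · ext1 x
    revert x
    rw [forall_cover e]
    simp
  · exact sheetSwap_ne e 1 (e (⟨0, hq.1⟩, true)) (by simp [h])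
  · exact ⟨e (y, true), by simp⟩
  · simp only [forall_cover e]
    intro x b y b'
    cases b <;> cases b' <;> simp [eq_comm]
  · intro X
    rw [forall_cover e]
    simp [doubleCover]

end DoubleCover

/-- The permutation has a cycle of length `ℓ`, and all its other cycles have length at most two. -/
def HasMainCycle {m : ℕ} (σ : Equiv.Perm (Fin m)) (ℓ : ℕ) : Prop :=
  (∀ x, Function.minimalPeriod σ x = 1 ∨ Function.minimalPeriod σ x = 2 ∨
    Function.minimalPeriod σ x = ℓ) ∧
  (Finset.univ.filter fun x => Function.minimalPeriod σ x = ℓ).card = ℓ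

theorem genusFour_eq_neg_four {m ℓ : ℕ} {q : Surf m} (hℓ : 3 ≤ ℓ) (hm : ℓ ≤ m)
    (hq : HasMainCycle (prodRGB q) ℓ) (hfix : totalFixed q + fixedCount (prodRGB q) = ℓ + 2) :
    genusFour q = -4 := by
  have hcount : cycleCount (prodRGB q) ℓ = 1 := by
    have := mul_cycleCount (prodRGB q) (i := ℓ) (by omega)
    rw [hq.2] at this
    exact Nat.eq_of_mul_eq_mul_left (by omega) (this.trans (mul_one ℓ).symm)
  have hzero : ∀ i, 1 ≤ i → i ≠ 1 → i ≠ 2 → i ≠ ℓ → cycleCount (prodRGB q) i = 0 := by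
    intro i hi h1 h2 h3
    have := mul_cycleCount (prodRGB q) hi
    rw [Finset.filter_false_of_mem (fun x _ => by rcases hq.1 x with h | h | h <;> omega),
      Finset.card_empty] at this
    exact (Nat.mul_eq_zero.1 this).resolve_left (by omega)
  unfold genusFour
  rw [← Finset.sum_subset (s₁ := {1, ℓ}) (by intro i; simp; omega), Finset.sum_pair (by omega),
    hcount]
  · simp only [cycleCount, if_true]
    push_cast
    omega
  · intro i hi hi'
    simp only [Finset.mem_Icc, Finset.mem_insert, Finset.mem_singleton, not_or] at hi hi'
    by_cases h2 : i = 2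
    · simp [h2]
    · simp [hzero i hi.1 hi'.1 h2 hi'.2]

theorem card_filter_cover {m n : ℕ} (e : Fin m × Bool ≃ Fin n) (P : Fin n → Prop)
    (Q : Fin m → Prop) [DecidablePred P] [DecidablePred Q] (h : ∀ x b, P (e (x, b)) ↔ Q x) :
    (Finset.univ.filter P).card = 2 * (Finset.univ.filter Q).card := by
  have : Finset.univ.filter P =
      (Finset.univ.filter Q ×ˢ (Finset.univ : Finset Bool)).map e.toEmbedding := by
    ext z
    revert z
    rw [forall_cover e]
    simp [h]
  rw [this, Finset.card_map, Finset.card_product]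
  simp [mul_comm]

section Profile

variable {m n ℓ c : ℕ} (e : Fin m × Bool ≃ Fin n) {σ : Equiv.Perm (Fin m)}

theorem cycleCount_sheetSwap_two (hℓ : 3 ≤ ℓ) (hm : m = ℓ + c) (hσ : HasMainCycle σ ℓ) :
    cycleCount (sheetSwap e σ) 2 = c := by
  have h := mul_cycleCount (sheetSwap e σ) one_le_two
  rw [card_filter_cover e _ (fun x => ¬ Function.minimalPeriod σ x = ℓ)] at h
  · have h' := Finset.card_filter_add_card_filter_not (s := (Finset.univ : Finset (Fin m)))
      (fun x => Function.minimalPeriod σ x = ℓ)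
    rw [hσ.2, Finset.card_univ, Fintype.card_fin] at h'
    omega
  · intro x b
    rw [minimalPeriod_sheetSwap]
    have hdvd : ℓ ∣ Nat.lcm ℓ 2 := Nat.dvd_lcm_left _ _
    rcases hσ.1 x with hx | hx | hx <;> rw [hx]
    · simp; omega
    · simp; omega
    · simp only [not_true_eq_false, iff_false]
      intro h2
      have := Nat.le_of_dvd two_pos (h2 ▸ hdvd)
      omega

theorem lcm_mul_cycleCount_sheetSwap (hℓ : 3 ≤ ℓ) (hσ : HasMainCycle σ ℓ) :
    Nat.lcm ℓ 2 * cycleCount (sheetSwap e σ) (Nat.lcm ℓ 2) = 2 * ℓ := by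
  have hpos : 0 < Nat.lcm ℓ 2 := Nat.lcm_pos (by omega) two_pos
  have hle := Nat.le_of_dvd hpos (Nat.dvd_lcm_left ℓ 2)
  rw [mul_cycleCount _ hpos,
    card_filter_cover e _ (fun x => Function.minimalPeriod σ x = ℓ), hσ.2]
  intro x b
  rw [minimalPeriod_sheetSwap]
  rcases hσ.1 x with hx | hx | hx <;> rw [hx]
  · rw [Nat.lcm_eq_right (one_dvd 2)]; omega
  · rw [Nat.lcm_self]; omega
  · simp

theorem cycleCount_sheetSwap_eq_zero (hσ : HasMainCycle σ ℓ) {i : ℕ} (hi : 1 ≤ i)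
    (h2 : i ≠ 2) (hi' : i ≠ Nat.lcm ℓ 2) : cycleCount (sheetSwap e σ) i = 0 := by
  have := mul_cycleCount (sheetSwap e σ) hi
  rw [Finset.filter_false_of_mem, Finset.card_empty] at this
  · exact (Nat.mul_eq_zero.1 this).resolve_left (by omega)
  · intro z _
    revert z
    rw [forall_cover e]
    intro x b
    rw [minimalPeriod_sheetSwap]
    rcases hσ.1 x with hx | hx | hx <;> rw [hx]
    · simpa using h2.symm
    · simpa using h2.symm
    · exact fun _ => hi'.symm

theorem lcm_two_of_odd {g : ℕ} (hg : 1 ≤ g) : Nat.lcm (2 * g - 1) 2 = 4 * g - 2 := by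
  have h : Nat.Coprime (2 * g - 1) 2 := by
    rw [Nat.coprime_two_right, Nat.odd_iff]
    omega
  rw [h.lcm_eq_mul]
  omega

theorem profileA_doubleCover {g : ℕ} (hg : 2 ≤ g) {q : Surf m} (hm : m = 2 * g - 1 + c)
    (hq : HasMainCycle (prodRGB q) (2 * g - 1)) : ProfileA n g c (doubleCover e q) := by
  have hlcm := lcm_mul_cycleCount_sheetSwap e (by omega) hq
  rw [lcm_two_of_odd (by omega)] at hlcm
  rw [ProfileA, prodRGB_doubleCover]
  refine ⟨totalFixed_doubleCover e q, cycleCount_sheetSwap_two e (by omega) hm hq,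
    Nat.eq_of_mul_eq_mul_left (by omega) (hlcm.trans (by omega)), fun i hi h2 hi' => ?_⟩
  exact cycleCount_sheetSwap_eq_zero e hq hi h2 (by rwa [lcm_two_of_odd (by omega)])

theorem profileB_doubleCover {g : ℕ} (hg : 2 ≤ g) {q : Surf m} (hm : m = 2 * g + c)
    (hq : HasMainCycle (prodRGB q) (2 * g)) : ProfileB n g c (doubleCover e q) := by
  have hlcm := lcm_mul_cycleCount_sheetSwap e (by omega) hq
  have h2 : Nat.lcm (2 * g) 2 = 2 * g := Nat.lcm_eq_left (Nat.dvd_mul_right 2 g)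
  rw [h2] at hlcm
  rw [ProfileB, prodRGB_doubleCover]
  refine ⟨totalFixed_doubleCover e q, cycleCount_sheetSwap_two e (by omega) hm hq,
    Nat.eq_of_mul_eq_mul_left (by omega) (hlcm.trans (by omega)), fun i hi h hi' => ?_⟩
  exact cycleCount_sheetSwap_eq_zero e hq hi h (by rwa [h2])

theorem exchangesTwoCycles_doubleCover {g : ℕ} (hg : 2 ≤ g) {q : Surf m}
    (hq : HasMainCycle (prodRGB q) (2 * g)) :
    ExchangesTwoCycles (doubleCover e q) (sheetSwap e 1) g := by
  rw [ExchangesTwoCycles, prodRGB_doubleCover, forall_cover e]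
  intro x b hx hsame
  rw [support_cycleOf_card _ (sheetSwap_ne e _ _), minimalPeriod_sheetSwap] at hx
  obtain ⟨k, -, hk⟩ := hsame.exists_pow_eq'
  rw [← Equiv.Perm.iterate_eq_pow, sheetSwap_iterate, sheetSwap_apply, e.apply_eq_iff_eq,
    Prod.mk_inj] at hk
  have hdvd : Function.minimalPeriod (prodRGB q) x ∣ k :=
    Function.IsPeriodicPt.minimalPeriod_dvd hk.1
  have hodd : ¬ 2 ∣ k := by
    rw [← not_iterate_eq_self (b := b), hk.2]
    simp
  rcases hq.1 x with h | h | h <;> rw [h] at hx hdvd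
  · simp at hx; omega
  · exact hodd hdvd
  · exact hodd ((Nat.dvd_mul_right 2 g).trans hdvd)

end Profile

/-- The reflection `x ↦ d - x` of the integers modulo `m`. -/
def reflection (m d : ℕ) (hd : d < m) : Equiv.Perm (Fin m) :=
  Function.Involutive.toPerm
    (fun x => ⟨if x.val ≤ d then d - x.val else d + m - x.val, by split_ifs <;> omega⟩)
    (by intro x; ext; dsimp only; split_ifs <;> omega)

/-- The permutation of `{0, …, m - 1}` which reverses `{0, …, d}` and fixes the other points. -/
def initialFlip (m d : ℕ) (hd : d < m) : Equiv.Perm (Fin m) :=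
  Function.Involutive.toPerm
    (fun x => ⟨if x.val ≤ d then d - x.val else x.val, by split_ifs <;> omega⟩)
    (by intro x; ext; dsimp only; split_ifs <;> omega)

section Reflection

variable {m d : ℕ} (hd : d < m)

theorem reflection_val (x : Fin m) :
    (reflection m d hd x).val = if x.val ≤ d then d - x.val else d + m - x.val := rfl

theorem initialFlip_val (x : Fin m) :
    (initialFlip m d hd x).val = if x.val ≤ d then d - x.val else x.val := rfl

theorem reflection_mul_self : reflection m d hd * reflection m d hd = 1 := by
  ext x
  simp only [Equiv.Perm.mul_apply, reflection_val, Equiv.Perm.one_apply]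
  split_ifs <;> omega

theorem initialFlip_mul_self : initialFlip m d hd * initialFlip m d hd = 1 := by
  ext x
  simp only [Equiv.Perm.mul_apply, initialFlip_val, Equiv.Perm.one_apply]
  split_ifs <;> omega

theorem reflection_succ_reflection (hd' : d + 1 < m) {k : ℕ} (hk : k + 1 < m) :
    reflection m (d + 1) hd' (reflection m d hd ⟨k, by omega⟩) = ⟨k + 1, hk⟩ := by
  ext
  simp only [reflection_val]
  split_ifs <;> omega

end Reflection

section Reach

variable {α : Type*} {S : Set (Equiv.Perm α)}

/-- `y` is the image of `x` under an element of the subgroup generated by `S`. -/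
def Reach (S : Set (Equiv.Perm α)) (x y : α) : Prop :=
  ∃ p ∈ Subgroup.closure S, p x = y

theorem Reach.refl (x : α) : Reach S x x := ⟨1, one_mem _, rfl⟩

theorem Reach.symm {x y : α} : Reach S x y → Reach S y x := by
  rintro ⟨p, hp, rfl⟩
  exact ⟨p⁻¹, inv_mem hp, by simp⟩

theorem Reach.trans {x y z : α} : Reach S x y → Reach S y z → Reach S x z := by
  rintro ⟨p, hp, rfl⟩ ⟨q, hq, rfl⟩
  exact ⟨q * p, mul_mem hq hp, rfl⟩

theorem reach_of_mem {s : Equiv.Perm α} (hs : s ∈ S) (x : α) : Reach S x (s x) :=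
  ⟨s, Subgroup.subset_closure hs, rfl⟩

end Reach

section Transitive

variable {m n d : ℕ} (hd : d < m) (hd' : d + 1 < m)

theorem reach_of_reflections {S : Set (Equiv.Perm (Fin m))} (h₁ : reflection m d hd ∈ S)
    (h₂ : reflection m (d + 1) hd' ∈ S) (x y : Fin m) : Reach S x y := by
  have key : ∀ k (hk : k < m), Reach S ⟨0, by omega⟩ ⟨k, hk⟩ := by
    intro k
    induction k with
    | zero => exact fun _ => Reach.refl _
    | succ k ih =>
      intro hk
      rw [← reflection_succ_reflection hd hd' hk]
      exact ((ih (by omega)).trans (reach_of_mem h₁ _)).trans (reach_of_mem h₂ _)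
  exact (key x x.2).symm.trans (key y y.2)

theorem reach_of_sheetSwap_reflections (e : Fin m × Bool ≃ Fin n)
    {S : Set (Equiv.Perm (Fin n))} (h₁ : sheetSwap e (reflection m d hd) ∈ S)
    (h₂ : sheetSwap e (reflection m (d + 1) hd') ∈ S) {σ : Equiv.Perm (Fin m)}
    (h₃ : sheetSwap e σ ∈ S) {a : Fin m} (ha : σ a = a) (x y : Fin n) : Reach S x y := by
  have key : ∀ b k (hk : k < m), Reach S (e (⟨0, by omega⟩, b)) (e (⟨k, hk⟩, b)) := by
    intro b k
    induction k with
    | zero => exact fun _ => Reach.refl _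
    | succ k ih =>
      intro hk
      have h := ((ih (by omega)).trans (reach_of_mem h₁ _)).trans (reach_of_mem h₂ _)
      rwa [sheetSwap_apply, sheetSwap_apply, reflection_succ_reflection hd hd' hk,
        Bool.not_not] at h
  have hswap : Reach S (e (⟨0, by omega⟩, true)) (e (⟨0, by omega⟩, false)) := by
    have h := (key true a a.2).trans (reach_of_mem h₃ _)
    rw [sheetSwap_apply, Fin.eta, ha] at h
    exact h.trans (key false a a.2).symm
  have hall : ∀ z, Reach S (e (⟨0, by omega⟩, true)) z := by
    rw [forall_cover e]
    intro z b
    cases b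
    · exact hswap.trans (key false z z.2)
    · exact key true z z.2
  exact (hall x).symm.trans (hall y)

end Transitive

section Models

variable {m ℓ c : ℕ}

theorem reflection_eq_self (hc : c + 1 < m) :
    reflection m c (by omega) ⟨(c + 1) / 2, by omega⟩ = ⟨(c + 1) / 2, by omega⟩ ∨
    reflection m (c + 1) hc ⟨(c + 1) / 2, by omega⟩ = ⟨(c + 1) / 2, by omega⟩ := by
  simp only [Fin.ext_iff, reflection_val]
  split_ifs <;> omega

theorem fixedCount_eq_one {σ : Equiv.Perm (Fin m)} (a : Fin m) (h : ∀ x, σ x = x ↔ x = a) :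
    fixedCount σ = 1 := by
  simp [fixedCount, h, Finset.filter_eq']

theorem fixedCount_eq_two {σ : Equiv.Perm (Fin m)} (a b : Fin m) (hab : a ≠ b)
    (h : ∀ x, σ x = x ↔ x = a ∨ x = b) : fixedCount σ = 2 := by
  rw [fixedCount, ← Finset.card_pair hab]
  congr 1
  ext x
  simp [h]

theorem fixedCount_eq_zero {σ : Equiv.Perm (Fin m)} (h : ∀ x, σ x ≠ x) : fixedCount σ = 0 := by
  simp [fixedCount, h]

/-- Rotating by one and then reversing `{0, …, c}`. -/
def flipRotation (m c : ℕ) (hc : c + 1 < m) : Equiv.Perm (Fin m) :=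
  initialFlip m c (by omega) * reflection m (c + 1) hc * reflection m c (by omega)

theorem flipRotation_val (hc : c + 1 < m) (x : Fin m) :
    (flipRotation m c hc x).val =
      if x.val < c then c - 1 - x.val else if x.val + 1 < m then x.val + 1 else c := by
  simp only [flipRotation, Equiv.Perm.mul_apply, initialFlip_val, reflection_val]
  split_ifs <;> omega

theorem fixedCount_reflection_add (hc : c + 1 < m) :
    fixedCount (reflection m c (by omega)) + fixedCount (reflection m (c + 1) hc) = 2 := by
  have h₁ : ∀ x, reflection m c (by omega) x = x ↔ 2 * x.val = c ∨ 2 * x.val = c + m := by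
    intro x
    rw [Fin.ext_iff, reflection_val]
    split_ifs <;> omega
  have h₂ : ∀ x, reflection m (c + 1) hc x = x ↔
      2 * x.val = c + 1 ∨ 2 * x.val = c + 1 + m := by
    intro x
    rw [Fin.ext_iff, reflection_val]
    split_ifs <;> omega
  rcases Nat.even_or_odd' c with ⟨u, hu | hu⟩ <;>
    rcases Nat.even_or_odd' m with ⟨v, hv | hv⟩
  · rw [fixedCount_eq_two ⟨u, by omega⟩ ⟨u + v, by omega⟩ (by simp [Fin.ext_iff]; omega)
        fun x => by simp only [h₁, Fin.ext_iff]; omega,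
      fixedCount_eq_zero fun x => by rw [Ne, h₂]; omega]
  · rw [fixedCount_eq_one ⟨u, by omega⟩ fun x => by simp only [h₁, Fin.ext_iff]; omega,
      fixedCount_eq_one ⟨u + v + 1, by omega⟩ fun x => by simp only [h₂, Fin.ext_iff]; omega]
  · rw [fixedCount_eq_two (σ := reflection m (c + 1) hc) ⟨u + 1, by omega⟩
        ⟨u + v + 1, by omega⟩ (by simp [Fin.ext_iff]; omega)
        fun x => by simp only [h₂, Fin.ext_iff]; omega,
      fixedCount_eq_zero fun x => by rw [Ne, h₁]; omega]
  · rw [fixedCount_eq_one ⟨u + v + 1, by omega⟩ fun x => by simp only [h₁, Fin.ext_iff]; omega,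
      fixedCount_eq_one ⟨u + 1, by omega⟩ fun x => by simp only [h₂, Fin.ext_iff]; omega]

theorem card_filter_lt_val (c : ℕ) (hc : c < m) :
    (Finset.univ.filter fun x : Fin m => c < x.val).card = m - c - 1 := by
  have : (Finset.univ.filter fun x : Fin m => c < x.val) = Finset.Ioi ⟨c, hc⟩ := by
    ext x
    simp [Fin.lt_def]
  rw [this, Fin.card_Ioi]
  simp only
  omega

theorem fixedCount_initialFlip_add (hc : c + 1 < m) :
    fixedCount (initialFlip m c (by omega)) + fixedCount (flipRotation m c hc) = m - c := by
  have h₁ : ∀ x, initialFlip m c (by omega) x = x ↔ c < x.val ∨ 2 * x.val = c := by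
    intro x
    rw [Fin.ext_iff, initialFlip_val]
    split_ifs <;> omega
  have h₂ : ∀ x, flipRotation m c hc x = x ↔ 2 * x.val + 1 = c := by
    intro x
    rw [Fin.ext_iff, flipRotation_val]
    split_ifs <;> omega
  have hcard := card_filter_lt_val (m := m) c (by omega)
  rcases Nat.even_or_odd' c with ⟨u, hu | hu⟩
  · have hins : (Finset.univ.filter fun x => initialFlip m c (by omega) x = x) =
        insert ⟨u, by omega⟩ (Finset.univ.filter fun x : Fin m => c < x.val) := by
      ext x
      simp only [h₁, Finset.mem_filter, Finset.mem_univ, true_and, Finset.mem_insert,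
        Fin.ext_iff]
      omega
    rw [fixedCount_eq_zero (σ := flipRotation m c hc) fun x => by rw [Ne, h₂]; omega,
      fixedCount, hins, Finset.card_insert_of_notMem (by simp; omega), hcard]
    omega
  · have heq : (Finset.univ.filter fun x => initialFlip m c (by omega) x = x) =
        Finset.univ.filter fun x : Fin m => c < x.val := by
      ext x
      simp only [h₁, Finset.mem_filter, Finset.mem_univ, true_and]
      omega
    rw [fixedCount_eq_one (σ := flipRotation m c hc) ⟨u, by omega⟩ fun x => by
      simp only [h₂, Fin.ext_iff]; omega, fixedCount, heq, hcard]
    omega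

theorem flipRotation_iterate_val (hc : c + 1 < m) (x : Fin m) (hx : c ≤ x.val) (k : ℕ) :
    ((flipRotation m c hc)^[k] x).val = c + (x.val - c + k) % (m - c) := by
  induction k with
  | zero =>
    have := Nat.mod_eq_of_lt (a := x.val - c) (b := m - c) (by omega)
    simp only [Function.iterate_zero, id_eq, add_zero, this]
    omega
  | succ k ih =>
    have hlt := Nat.mod_lt (x.val - c + k) (y := m - c) (by omega)
    have hsucc := Nat.add_mod (x.val - c + k) 1 (m - c)
    rw [Nat.mod_eq_of_lt (a := 1) (b := m - c) (by omega)] at hsucc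
    rw [Function.iterate_succ_apply', flipRotation_val, ih, ← add_assoc, hsucc]
    generalize (x.val - c + k) % (m - c) = r at hlt
    by_cases h : r + 1 = m - c
    · rw [h, Nat.mod_self]
      split_ifs <;> omega
    · rw [Nat.mod_eq_of_lt (by omega)]
      split_ifs <;> omega

theorem minimalPeriod_flipRotation (hc : c + 1 < m) (x : Fin m) (hx : c ≤ x.val) :
    Function.minimalPeriod (flipRotation m c hc) x = m - c := by
  have key : ∀ k : ℕ, Function.minimalPeriod (flipRotation m c hc) x ∣ k ↔ m - c ∣ k := by
    intro k
    rw [← Function.isPeriodicPt_iff_minimalPeriod_dvd, Function.IsPeriodicPt,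
      Function.IsFixedPt, Fin.ext_iff, flipRotation_iterate_val hc x hx,
      Nat.dvd_iff_mod_eq_zero]
    have h0 : c + (x.val - c + k) % (m - c) = x.val ↔
        x.val - c + k ≡ x.val - c + 0 [MOD m - c] := by
      rw [Nat.ModEq, add_zero, Nat.mod_eq_of_lt (a := x.val - c) (b := m - c) (by omega)]
      omega
    rw [h0]
    exact ⟨fun h => Nat.ModEq.add_left_cancel' _ h, fun h => Nat.ModEq.add_left _ h⟩
  exact Nat.dvd_antisymm ((key _).2 dvd_rfl) ((key _).1 dvd_rfl)

theorem minimalPeriod_flipRotation_of_lt (hc : c + 1 < m) (x : Fin m) (hx : x.val < c) :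
    Function.minimalPeriod (flipRotation m c hc) x = 1 ∨
      Function.minimalPeriod (flipRotation m c hc) x = 2 := by
  rw [← Nat.dvd_prime Nat.prime_two]
  apply Function.IsPeriodicPt.minimalPeriod_dvd
  change flipRotation m c hc (flipRotation m c hc x) = x
  ext
  rw [flipRotation_val, flipRotation_val]
  split_ifs <;> omega

theorem hasMainCycle_flipRotation (hc : c + 1 < m) (hm : c + 3 ≤ m) :
    HasMainCycle (flipRotation m c hc) (m - c) := by
  have hper : ∀ x, Function.minimalPeriod (flipRotation m c hc) x = m - c ↔ c ≤ x.val := by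
    refine fun x => ⟨fun h => ?_, minimalPeriod_flipRotation hc x⟩
    by_contra hx
    have := minimalPeriod_flipRotation_of_lt hc x (by omega)
    omega
  refine ⟨fun x => ?_, ?_⟩
  · by_cases hx : x.val < c
    · have := minimalPeriod_flipRotation_of_lt hc x hx
      omega
    · exact Or.inr (Or.inr (minimalPeriod_flipRotation hc x (by omega)))
  · have : (Finset.univ.filter fun x : Fin m => c ≤ x.val) = Finset.Ici ⟨c, by omega⟩ := by
      ext x
      simp [Fin.le_def]
    simp only [hper, this, Fin.card_Ici]

theorem minimalPeriod_conj (σ τ : Equiv.Perm (Fin m)) (x : Fin m) :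
    Function.minimalPeriod (τ * σ * τ⁻¹ : Equiv.Perm (Fin m)) (τ x) =
      Function.minimalPeriod σ x := by
  have key : ∀ k : ℕ, Function.minimalPeriod (τ * σ * τ⁻¹ : Equiv.Perm (Fin m)) (τ x) ∣ k ↔
      Function.minimalPeriod σ x ∣ k := by
    intro k
    rw [← Function.isPeriodicPt_iff_minimalPeriod_dvd,
      ← Function.isPeriodicPt_iff_minimalPeriod_dvd, Function.IsPeriodicPt,
      Function.IsPeriodicPt, Function.IsFixedPt, Function.IsFixedPt, Equiv.Perm.iterate_eq_pow,
      Equiv.Perm.iterate_eq_pow, conj_pow]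
    simp
  exact Nat.dvd_antisymm ((key _).2 dvd_rfl) ((key _).1 dvd_rfl)

theorem card_minimalPeriod_conj (σ τ : Equiv.Perm (Fin m)) (i : ℕ) :
    (Finset.univ.filter fun x =>
      Function.minimalPeriod (τ * σ * τ⁻¹ : Equiv.Perm (Fin m)) x = i).card =
    (Finset.univ.filter fun x => Function.minimalPeriod σ x = i).card := by
  symm
  refine Finset.card_equiv τ fun x => ?_
  simp only [Finset.mem_filter, Finset.mem_univ, true_and, minimalPeriod_conj]

theorem HasMainCycle.conj {σ : Equiv.Perm (Fin m)} (h : HasMainCycle σ ℓ)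
    (τ : Equiv.Perm (Fin m)) : HasMainCycle (τ * σ * τ⁻¹) ℓ := by
  refine ⟨fun x => ?_, by rw [card_minimalPeriod_conj, h.2]⟩
  obtain ⟨y, rfl⟩ := τ.surjective x
  rw [minimalPeriod_conj]
  exact h.1 y

theorem fixedCount_conj (σ τ : Equiv.Perm (Fin m)) :
    fixedCount (τ * σ * τ⁻¹) = fixedCount σ := by
  have h₁ := mul_cycleCount (τ * σ * τ⁻¹) le_rfl
  have h₂ := mul_cycleCount σ le_rfl
  rw [card_minimalPeriod_conj, ← h₂] at h₁
  simpa only [cycleCount, if_true, one_mul] using h₁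

/-- A sphere whose `{G,B}`-permutations act transitively. -/
def oneCylinderSphere (m c : ℕ) (hc : c + 1 < m) : Surf m
  | Color.R => initialFlip m c (by omega)
  | Color.G => reflection m (c + 1) hc
  | Color.B => reflection m c (by omega)

/-- A sphere whose double cover is a staircase with one long step. -/
def staircaseSphere (m c : ℕ) (hc : c + 1 < m) : Surf m
  | Color.R => reflection m c (by omega)
  | Color.G => initialFlip m c (by omega)
  | Color.B => reflection m (c + 1) hc

theorem isSTS_oneCylinderSphere (hc : c + 1 < m) : IsSTS m (oneCylinderSphere m c hc) := by
  refine ⟨by omega, fun X => ?_, reach_of_reflections (by omega) hc ?_ ?_⟩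
  · cases X
    exacts [initialFlip_mul_self (by omega), reflection_mul_self hc, reflection_mul_self (by omega)]
  all_goals simp [oneCylinderSphere]

theorem isSTS_staircaseSphere (hc : c + 1 < m) : IsSTS m (staircaseSphere m c hc) := by
  refine ⟨by omega, fun X => ?_, reach_of_reflections (by omega) hc ?_ ?_⟩
  · cases X
    exacts [reflection_mul_self (by omega), initialFlip_mul_self (by omega), reflection_mul_self hc]
  all_goals simp [staircaseSphere]

theorem prodRGB_oneCylinderSphere (hc : c + 1 < m) :
    prodRGB (oneCylinderSphere m c hc) = flipRotation m c hc := rfl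

theorem prodRGB_staircaseSphere (hc : c + 1 < m) :
    prodRGB (staircaseSphere m c hc) =
      reflection m c (by omega) * flipRotation m c hc * (reflection m c (by omega))⁻¹ := by
  have h := mul_inv_cancel (reflection m c (by omega))
  simp only [prodRGB, staircaseSphere, flipRotation, mul_assoc, h, mul_one]

theorem fixedCounts_oneCylinderSphere (hc : c + 1 < m) :
    totalFixed (oneCylinderSphere m c hc) + fixedCount (prodRGB (oneCylinderSphere m c hc)) =
      m - c + 2 := by
  have h₁ := fixedCount_initialFlip_add hc
  have h₂ := fixedCount_reflection_add hc
  rw [prodRGB_oneCylinderSphere]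
  simp only [totalFixed, oneCylinderSphere]
  omega

theorem fixedCounts_staircaseSphere (hc : c + 1 < m) :
    totalFixed (staircaseSphere m c hc) + fixedCount (prodRGB (staircaseSphere m c hc)) =
      m - c + 2 := by
  have h₁ := fixedCount_initialFlip_add hc
  have h₂ := fixedCount_reflection_add hc
  rw [prodRGB_staircaseSphere, fixedCount_conj]
  simp only [totalFixed, staircaseSphere]
  omega

variable {n : ℕ} (e : Fin m × Bool ≃ Fin n)

theorem doubleCover_mul_self {q : Surf m} (hq : ∀ X, q X * q X = 1) (X : Color) :
    doubleCover e q X * doubleCover e q X = 1 := by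
  ext1 x
  revert x
  rw [forall_cover e]
  intro x b
  have : q X (q X x) = x := DFunLike.congr_fun (hq X) x
  simp [doubleCover, this]

theorem reach_oneCylinder (hc : c + 1 < m) (x y : Fin n) :
    Reach {doubleCover e (oneCylinderSphere m c hc) Color.G,
      doubleCover e (oneCylinderSphere m c hc) Color.B} x y := by
  rcases reflection_eq_self hc with h | h
  all_goals
    refine reach_of_sheetSwap_reflections (by omega) hc e ?_ ?_ ?_ h x y
    all_goals simp [doubleCover, oneCylinderSphere]

theorem isSTS_oneCylinder (hc : c + 1 < m) :
    IsSTS n (doubleCover e (oneCylinderSphere m c hc)) := by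
  refine ⟨Fin.pos (e (⟨0, by omega⟩, true)),
    doubleCover_mul_self e (isSTS_oneCylinderSphere hc).2.1, fun x y => ?_⟩
  obtain ⟨p, hp, hxy⟩ := reach_oneCylinder e hc x y
  exact ⟨p, Subgroup.closure_mono (Set.subset_insert _ _) hp, hxy⟩

theorem isSTS_staircase (hc : c + 1 < m) :
    IsSTS n (doubleCover e (staircaseSphere m c hc)) := by
  refine ⟨Fin.pos (e (⟨0, by omega⟩, true)),
    doubleCover_mul_self e (isSTS_staircaseSphere hc).2.1, ?_⟩
  rcases reflection_eq_self hc with h | h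
  all_goals
    refine reach_of_sheetSwap_reflections (by omega) hc e ?_ ?_ ?_ h
    all_goals simp [doubleCover, staircaseSphere]

theorem hasSpread_staircase {g : ℕ} (hg : 1 ≤ g) (hc : c + 1 < m)
    (hm : m = 2 * g - 1 + c ∨ m = 2 * g + c) :
    HasSpread (doubleCover e (staircaseSphere m c hc)) (2 * g - 2) := by
  let P : Fin m → ℤ := fun x => if x.val ≤ c then 0 else 2 * min ((x.val : ℤ) - c) (m - x.val)
  let Q : Fin m → ℤ := fun x =>
    if x.val ≤ c then 1 else 2 * min ((x.val : ℤ) - c - 1) (m - x.val) + 1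
  refine ⟨fun z => P (e.symm z).1, fun z => Q (e.symm z).1, ⟨?_, ?_⟩, ⟨?_, ?_⟩, ?_,
    e (⟨g + c, by omega⟩, true), e (⟨0, by omega⟩, true), ?_⟩
  iterate 5
    rw [forall_cover e]
    intro x b
    have hx := x.2
    simp only [doubleCover, staircaseSphere, sheetSwap_apply, Equiv.symm_apply_apply, P, Q,
      reflection_val, initialFlip_val, abs_le]
    split_ifs <;> omega
  simp only [Equiv.symm_apply_apply, Q]
  split_ifs <;> omega

end Models

/-- For `g ≥ 2`, `μ2 ≥ 0` and `μ = [2^{μ2}, 4g-2]` or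
`μ = [2^{μ2}, (2g)^2]`, there are two square-tiled surfaces in `ST^hyp_Ab(μ)` such
that any sequence of powers of cylinder shears connecting them (up to isomorphism)
has length at least `g - 2`. -/
theorem stmt18 (g μ2 : ℕ) (hg : 2 ≤ g) :
    (∃ (n : ℕ) (τ τ' : Surf n), InSTHypA n g μ2 τ ∧ InSTHypA n g μ2 τ' ∧
      ∀ (L : ℕ) (f'' : Surf n), Isomorphic n τ' f'' → ShearPowSeq n L τ f'' →
        g - 2 ≤ L) ∧
    (∃ (n : ℕ) (τ τ' : Surf n), InSTHypB n g μ2 τ ∧ InSTHypB n g μ2 τ' ∧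
      ∀ (L : ℕ) (f'' : Surf n), Isomorphic n τ' f'' → ShearPowSeq n L τ f'' →
        g - 2 ≤ L) := by
  refine ⟨?_, ?_⟩
  · obtain ⟨m, hm⟩ : ∃ m, m = 2 * g - 1 + μ2 := ⟨_, rfl⟩
    have hc : μ2 + 1 < m := by omega
    have hℓ : m - μ2 = 2 * g - 1 := by omega
    have hflip := hasMainCycle_flipRotation hc (by omega)
    have honeF := fixedCounts_oneCylinderSphere hc
    have hstairF := fixedCounts_staircaseSphere hc
    have hone : HasMainCycle (prodRGB (oneCylinderSphere m μ2 hc)) (m - μ2) := hflip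
    have hstair : HasMainCycle (prodRGB (staircaseSphere m μ2 hc)) (m - μ2) :=
      prodRGB_staircaseSphere hc ▸ hflip.conj _
    rw [hℓ] at hone hstair honeF hstairF
    let e : Fin m × Bool ≃ Fin (m * 2) :=
      (Equiv.prodCongr (Equiv.refl _) finTwoEquiv.symm).trans finProdFinEquiv
    refine ⟨m * 2, doubleCover e (staircaseSphere m μ2 hc),
      doubleCover e (oneCylinderSphere m μ2 hc),
      ⟨isSTS_staircase e hc,
        isAbelian_doubleCover e (by omega) _,
        profileA_doubleCover e hg (by omega) hstair, _,
        isHyperInvolution_doubleCover e (isSTS_staircaseSphere hc)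
          (genusFour_eq_neg_four (by omega) (by omega) hstair hstairF)⟩,
      ⟨isSTS_oneCylinder e hc,
        isAbelian_doubleCover e (by omega) _,
        profileA_doubleCover e hg (by omega) hone, _,
        isHyperInvolution_doubleCover e (isSTS_oneCylinderSphere hc)
          (genusFour_eq_neg_four (by omega) (by omega) hone honeF)⟩,
      fun L f'' hiso hseq => ?_⟩
    have := (hasSpread_staircase e (g := g) (by omega) hc (by omega)).le_of_shearPowSeq hseq hiso
      (reach_oneCylinder e hc)
    omega
  · obtain ⟨m, hm⟩ : ∃ m, m = 2 * g + μ2 := ⟨_, rfl⟩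
    have hc : μ2 + 1 < m := by omega
    have hℓ : m - μ2 = 2 * g := by omega
    have hflip := hasMainCycle_flipRotation hc (by omega)
    have honeF := fixedCounts_oneCylinderSphere hc
    have hstairF := fixedCounts_staircaseSphere hc
    have hone : HasMainCycle (prodRGB (oneCylinderSphere m μ2 hc)) (m - μ2) := hflip
    have hstair : HasMainCycle (prodRGB (staircaseSphere m μ2 hc)) (m - μ2) :=
      prodRGB_staircaseSphere hc ▸ hflip.conj _
    rw [hℓ] at hone hstair honeF hstairF
    let e : Fin m × Bool ≃ Fin (m * 2) :=
      (Equiv.prodCongr (Equiv.refl _) finTwoEquiv.symm).trans finProdFinEquiv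
    refine ⟨m * 2, doubleCover e (staircaseSphere m μ2 hc),
      doubleCover e (oneCylinderSphere m μ2 hc),
      ⟨isSTS_staircase e hc,
        isAbelian_doubleCover e (by omega) _,
        profileB_doubleCover e hg (by omega) hstair, _,
        isHyperInvolution_doubleCover e (isSTS_staircaseSphere hc)
          (genusFour_eq_neg_four (by omega) (by omega) hstair hstairF),
        exchangesTwoCycles_doubleCover e hg hstair⟩,
      ⟨isSTS_oneCylinder e hc,
        isAbelian_doubleCover e (by omega) _,
        profileB_doubleCover e hg (by omega) hone, _,
        isHyperInvolution_doubleCover e (isSTS_oneCylinderSphere hc)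
          (genusFour_eq_neg_four (by omega) (by omega) hone honeF),
        exchangesTwoCycles_doubleCover e hg hone⟩,
      fun L f'' hiso hseq => ?_⟩
    have := (hasSpread_staircase e (g := g) (by omega) hc (by omega)).le_of_shearPowSeq hseq hiso
      (reach_oneCylinder e hc)
    omega
end
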